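/- There exists a Coxeter decomposition of the second type of the hyperbolic simplex H_11^5 with fundamental simplex H_4^5; it has N = 20 tiles, four of the five ideal vertices of H_11^5 belong to exactly one tile each, and the remaining ideal vertex (the one of type D̃_4) belongs to 16 tiles. -/

import Mathlib

noncomputable section

namespace CD

open MeasureTheory Set
open scoped ENNReal

/-! ## Coxeter diagrams, encoded as Coxeter matrices.
A Coxeter diagram on `k` nodes is encoded by its Coxeter matrix
`M : Matrix (Fin k) (Fin k) ℕ`: `M i i = 1`, and for `i ≠ j` the entry `M i j = m`
means that the corresponding facets meet at the dihedral angle `π / m`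
(`2` = no edge of the diagram, and `0` encodes the label `∞`, i.e. angle `0`,
consistently with `π / 0 = 0` in Lean). -/

/-- A Coxeter diagram: a number of nodes together with a Coxeter matrix. -/
def CM : Type := Σ k : ℕ, Matrix (Fin k) (Fin k) ℕ

/-- The Coxeter matrix on `k` nodes with the given list of labelled edges
(`(i, j, m)` is an edge between nodes `i` and `j` with label `m`). -/
def cmOfEdges (k : ℕ) (E : List (ℕ × ℕ × ℕ)) : Matrix (Fin k) (Fin k) ℕ :=
  Matrix.of fun i j =>
    if i = j then 1 else
      match E.find? (fun e => (e.1 == (i : ℕ) && e.2.1 == (j : ℕ)) ||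
                              (e.1 == (j : ℕ) && e.2.1 == (i : ℕ))) with
      | some e => e.2.2
      | none => 2

/-- The Coxeter matrix of type `A_k`. -/
def cmA (k : ℕ) : Matrix (Fin k) (Fin k) ℕ :=
  Matrix.of fun i j =>
    if i = j then 1
    else if (i : ℕ) + 1 = (j : ℕ) ∨ (j : ℕ) + 1 = (i : ℕ) then 3 else 2

/-- The Coxeter matrix of type `D_k`, with the conventions `D_2 = A_1 + A_1` and
`D_3 = A_3`. -/
def cmD (k : ℕ) : Matrix (Fin k) (Fin k) ℕ :=
  Matrix.of fun i j =>
    if i = j then 1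
    else if k = 2 then 2
    else if ((i : ℕ) + 1 = (j : ℕ) ∧ (j : ℕ) ≤ k - 2) ∨
            ((j : ℕ) + 1 = (i : ℕ) ∧ (i : ℕ) ≤ k - 2) ∨
            ((i : ℕ) = k - 3 ∧ (j : ℕ) = k - 1) ∨
            ((j : ℕ) = k - 3 ∧ (i : ℕ) = k - 1)
      then 3 else 2

/-- Direct sum (disjoint union) of two Coxeter matrices. -/
def cmSum {a b : ℕ} (M : Matrix (Fin a) (Fin a) ℕ) (N : Matrix (Fin b) (Fin b) ℕ) :
    Matrix (Fin (a + b)) (Fin (a + b)) ℕ :=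
  Matrix.of fun i j =>
    if hi : (i : ℕ) < a then
      if hj : (j : ℕ) < a then M ⟨i, hi⟩ ⟨j, hj⟩ else 2
    else
      if _hj : (j : ℕ) < a then 2
      else N ⟨(i : ℕ) - a, by have := i.isLt; omega⟩ ⟨(j : ℕ) - a, by have := j.isLt; omega⟩

def cmAdd (x y : CM) : CM := ⟨x.1 + y.1, cmSum x.2 y.2⟩

def cmNil : CM := ⟨0, Matrix.of fun _ _ => 1⟩

/-- Disjoint union of a list of Coxeter diagrams. -/
def cmList (l : List CM) : CM := l.foldr cmAdd cmNil

def cA (k : ℕ) : CM := ⟨k, cmA k⟩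
def cD (k : ℕ) : CM := ⟨k, cmD k⟩
def cE6 : CM := ⟨6, cmOfEdges 6 [(0,1,3),(1,2,3),(2,3,3),(3,4,3),(2,5,3)]⟩
def cE7 : CM := ⟨7, cmOfEdges 7 [(0,1,3),(1,2,3),(2,3,3),(3,4,3),(4,5,3),(2,6,3)]⟩
def cE8 : CM := ⟨8, cmOfEdges 8 [(0,1,3),(1,2,3),(2,3,3),(3,4,3),(4,5,3),(5,6,3),(2,7,3)]⟩
def cF4 : CM := ⟨4, cmOfEdges 4 [(0,1,3),(1,2,4),(2,3,3)]⟩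
def cH3 : CM := ⟨3, cmOfEdges 3 [(0,1,5),(1,2,3)]⟩
def cH4 : CM := ⟨4, cmOfEdges 4 [(0,1,5),(1,2,3),(2,3,3)]⟩
/-- `G₂^{(5)} = I₂(5)`. -/
def cG25 : CM := ⟨2, cmOfEdges 2 [(0,1,5)]⟩

/-- The affine (Euclidean) Coxeter matrix `Ã₃` (a 4-cycle). -/
def cmA3t : Matrix (Fin 4) (Fin 4) ℕ := cmOfEdges 4 [(0,1,3),(1,2,3),(2,3,3),(0,3,3)]
/-- The affine Coxeter matrix `D̃₄`. -/
def cmD4t : Matrix (Fin 5) (Fin 5) ℕ := cmOfEdges 5 [(0,1,3),(0,2,3),(0,3,3),(0,4,3)]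
/-- The affine Coxeter matrix `C̃₄`. -/
def cmC4t : Matrix (Fin 5) (Fin 5) ℕ := cmOfEdges 5 [(0,1,4),(1,2,3),(2,3,3),(3,4,4)]
/-- The affine Coxeter matrix `F̃₄`. -/
def cmF4t : Matrix (Fin 5) (Fin 5) ℕ := cmOfEdges 5 [(0,1,3),(1,2,3),(2,3,4),(3,4,3)]
/-- The affine Coxeter matrix `C̃₂` (the Euclidean (2,4,4)-triangle). -/
def cmC2t : Matrix (Fin 3) (Fin 3) ℕ := cmOfEdges 3 [(0,1,4),(1,2,4)]
/-- The affine Coxeter matrix `G̃₂` (the Euclidean (2,3,6)-triangle). -/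
def cmG2t : Matrix (Fin 3) (Fin 3) ℕ := cmOfEdges 3 [(0,1,6),(1,2,3)]

/-- Connectedness of a Coxeter diagram. -/
def cmConnected (c : CM) : Prop :=
  ∀ i j : Fin c.1, Relation.ReflTransGen (fun a b => 3 ≤ c.2 a b ∨ c.2 a b = 0) i j

/-! ## Hyperbolic space `H^n`: the hyperboloid model. -/

/-- The Minkowski bilinear form of signature `(n,1)` on `ℝ^{n+1}`. -/
def mink (n : ℕ) (x y : EuclideanSpace ℝ (Fin (n + 1))) : ℝ :=
  -(x 0 * y 0) + ∑ i : Fin n, x i.succ * y i.succ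

/-- The hyperboloid model of hyperbolic `n`-space:
`{x ∈ ℝ^{n+1} : ⟨x,x⟩ = -1, x₀ > 0}`. -/
def hypSet (n : ℕ) : Set (EuclideanSpace ℝ (Fin (n + 1))) :=
  {x | mink n x x = -1 ∧ 0 < x 0}

/-- The closed half-space of `H^n` with (spacelike unit) outward normal `v`. -/
def hHalf (n : ℕ) (v : EuclideanSpace ℝ (Fin (n + 1))) : Set ↥(hypSet n) :=
  {x | mink n v x.val ≤ 0}

/-- The hyperplane of `H^n` with (spacelike unit) normal `v`. -/
def hWall (n : ℕ) (v : EuclideanSpace ℝ (Fin (n + 1))) : Set ↥(hypSet n) :=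
  {x | mink n v x.val = 0}

/-- Projection of the hyperboloid to the Beltrami–Klein ball. -/
def klein (n : ℕ) (x : ↥(hypSet n)) : Fin n → ℝ := fun i => x.val i.succ / x.val 0

/-- The hyperbolic (Riemannian) volume of a subset of `H^n`, computed in the
Beltrami–Klein model, where the volume element is `(1-|y|²)^{-(n+1)/2} dy`. -/
def hVol (n : ℕ) (S : Set ↥(hypSet n)) : ℝ≥0∞ :=
  ∫⁻ y in klein n '' S,
    ENNReal.ofReal ((1 - ∑ i, y i ^ 2) ^ (-((n : ℝ) + 1) / 2)) ∂(volume)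

/-- An isometry of `H^n`: a bijection preserving the Minkowski product
(equivalently, the hyperbolic distance `arcosh(-⟨x,y⟩)`). -/
def hIsIsom (n : ℕ) (g : ↥(hypSet n) → ↥(hypSet n)) : Prop :=
  Function.Bijective g ∧ ∀ x y, mink n (g x).val (g y).val = mink n x.val y.val

/-- Two subsets of `H^n` are congruent if an isometry carries one onto the other. -/
def hCongr (n : ℕ) (A B : Set ↥(hypSet n)) : Prop :=
  ∃ g, hIsIsom n g ∧ g '' A = B

/-- The ambient reflection of `ℝ^{n+1}` in the hyperplane with spacelike unit normal `v`. -/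
def hReflect (n : ℕ) (v x : EuclideanSpace ℝ (Fin (n + 1))) :
    EuclideanSpace ℝ (Fin (n + 1)) :=
  x - (2 * mink n v x) • v

/-- `S` is a facet ((n-1)-dimensional face) of the polyhedron `P ⊆ H^n`:
`S = P ∩ Π` for a supporting hyperplane `Π` of `P`, and `S` lies in no other
hyperplane (so it is genuinely `(n-1)`-dimensional). -/
def hIsFacet (n : ℕ) (P S : Set ↥(hypSet n)) : Prop :=
  S.Nonempty ∧ ∃ v, mink n v v = 1 ∧ P ⊆ hHalf n v ∧ S = P ∩ hWall n v ∧
    ∀ u, mink n u u = 1 → S ⊆ hWall n u → hWall n u = hWall n v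

/-- A convex polyhedron in `H^n`: an intersection of finitely many closed
half-spaces with nonempty interior and finite volume. -/
def hIsPoly (n : ℕ) (P : Set ↥(hypSet n)) : Prop :=
  ∃ (k : ℕ) (v : Fin k → EuclideanSpace ℝ (Fin (n + 1))),
    (∀ i, mink n (v i) (v i) = 1) ∧ P = ⋂ i, hHalf n (v i) ∧
    (interior P).Nonempty ∧ hVol n P < ⊤

/-- A Coxeter polyhedron in `H^n`: a convex polyhedron all of whose dihedral
angles are of the form `π/k`, `k ≥ 2` (the dihedral angle along a ridge with
outward unit normals `u, v` is `π/k` iff `⟨u,v⟩ = -cos (π/k)`). -/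
def hIsCoxPoly (n : ℕ) (P : Set ↥(hypSet n)) : Prop :=
  ∃ (k : ℕ) (v : Fin k → EuclideanSpace ℝ (Fin (n + 1))),
    (∀ i, mink n (v i) (v i) = 1) ∧ P = ⋂ i, hHalf n (v i) ∧
    (interior P).Nonempty ∧ hVol n P < ⊤ ∧
    ∀ i j, hWall n (v i) ≠ hWall n (v j) →
      (∃ x ∈ P, x ∈ hWall n (v i) ∩ hWall n (v j)) →
      ∃ m : ℕ, 2 ≤ m ∧ mink n (v i) (v j) = -Real.cos (Real.pi / (m : ℝ))

/-- A simplex in `H^n` (possibly with ideal vertices): a convex polyhedron with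
exactly `n+1` facets. -/
def hIsSimplex (n : ℕ) (P : Set ↥(hypSet n)) : Prop :=
  hIsPoly n P ∧ {S | hIsFacet n P S}.ncard = n + 1

/-- A Coxeter decomposition of `P ⊆ H^n`: a decomposition of `P` into finitely
many tiles with pairwise disjoint interiors, each tile a Coxeter polyhedron,
such that any two tiles having a common facet are symmetric with respect to
(the hyperplane of) this facet. -/
def hIsCoxDecomp (n : ℕ) (P : Set ↥(hypSet n)) (𝒯 : Set (Set ↥(hypSet n))) : Prop :=
  𝒯.Finite ∧ 𝒯.Nonempty ∧ (∀ T ∈ 𝒯, hIsCoxPoly n T) ∧ ⋃₀ 𝒯 = P ∧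
  (∀ T₁ ∈ 𝒯, ∀ T₂ ∈ 𝒯, T₁ ≠ T₂ → interior T₁ ∩ interior T₂ = ∅) ∧
  (∀ T₁ ∈ 𝒯, ∀ T₂ ∈ 𝒯, T₁ ≠ T₂ → ∀ S, hIsFacet n T₁ S → hIsFacet n T₂ S →
    ∃ v, mink n v v = 1 ∧ S ⊆ hWall n v ∧
      T₂ = {y | ∃ x ∈ T₁, (y : EuclideanSpace ℝ (Fin (n + 1))) = hReflect n v x.val})

/-- A hyperplane (with unit normal `v`) is a mirror of the decomposition `𝒯` of `P`
if it contains a facet of some tile but no facet of `P`. -/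
def hIsMirror (n : ℕ) (P : Set ↥(hypSet n)) (𝒯 : Set (Set ↥(hypSet n)))
    (v : EuclideanSpace ℝ (Fin (n + 1))) : Prop :=
  mink n v v = 1 ∧ (∃ T ∈ 𝒯, ∃ S, hIsFacet n T S ∧ S ⊆ hWall n v) ∧
  ¬∃ S, hIsFacet n P S ∧ S ⊆ hWall n v

/-- The decomposition `𝒯` of `P` is of the second type: every dihedral angle of `P`
is fundamental, i.e. no mirror contains the intersection of two facets of `P`. -/
def hSecondType (n : ℕ) (P : Set ↥(hypSet n)) (𝒯 : Set (Set ↥(hypSet n))) : Prop :=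
  ∀ α β, hIsFacet n P α → hIsFacet n P β → α ≠ β → (α ∩ β).Nonempty →
    ¬∃ v, hIsMirror n P 𝒯 v ∧ α ∩ β ⊆ hWall n v

/-- Decompositions obtainable by the inductive algorithm (decompositions of the
first type), with fundamental simplex `F`: start from (isometric copies of) `F`,
and repeatedly glue two previously obtained decomposed simplices along a common
facet so that the union is again a simplex and the union of the two
decompositions is a Coxeter decomposition of it. -/
inductive hFirstType (n : ℕ) (F : Set ↥(hypSet n)) :
    Set ↥(hypSet n) → Set (Set ↥(hypSet n)) → Prop
  | base (P : Set ↥(hypSet n)) : hCongr n F P → hIsSimplex n P → hFirstType n F P {P}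
  | congr (P : Set ↥(hypSet n)) (𝒯 : Set (Set ↥(hypSet n)))
      (g : ↥(hypSet n) → ↥(hypSet n)) :
      hIsIsom n g → hFirstType n F P 𝒯 → hFirstType n F (g '' P) ((fun T => g '' T) '' 𝒯)
  | glue (P₁ P₂ : Set ↥(hypSet n)) (𝒯₁ 𝒯₂ : Set (Set ↥(hypSet n))) (S : Set ↥(hypSet n)) :
      hFirstType n F P₁ 𝒯₁ → hFirstType n F P₂ 𝒯₂ →
      hIsFacet n P₁ S → hIsFacet n P₂ S →
      interior P₁ ∩ interior P₂ = ∅ →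
      hIsSimplex n (P₁ ∪ P₂) →
      hIsCoxDecomp n (P₁ ∪ P₂) (𝒯₁ ∪ 𝒯₂) →
      hFirstType n F (P₁ ∪ P₂) (𝒯₁ ∪ 𝒯₂)

/-- A vertex of the simplex `P ⊆ H^n`: a point of `P` lying on at least `n` facets. -/
def hIsVertex (n : ℕ) (P : Set ↥(hypSet n)) (x : ↥(hypSet n)) : Prop :=
  x ∈ P ∧ n ≤ {S | hIsFacet n P S ∧ x ∈ S}.ncard

/-- The cone over `S ⊆ H^n` in `ℝ^{n+1}`. -/
def hCone (n : ℕ) (S : Set ↥(hypSet n)) : Set (EuclideanSpace ℝ (Fin (n + 1))) :=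
  {y | ∃ x ∈ S, ∃ t : ℝ, 0 < t ∧ y = t • (x : EuclideanSpace ℝ (Fin (n + 1)))}

/-- The ideal vertices of `P ⊆ H^n`: lightlike directions (normalized by `w₀ = 1`)
in the closure of the cone over `P`. -/
def hIdealVerts (n : ℕ) (P : Set ↥(hypSet n)) : Set (EuclideanSpace ℝ (Fin (n + 1))) :=
  {w | mink n w w = 0 ∧ w 0 = 1 ∧ w ∈ closure (hCone n P)}

/-- The ideal vertex `w` of `P` has horospherical link of the Euclidean type given
by the (affine) Coxeter matrix `M`: the facets of `P` incident to `w` can be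
indexed so that their unit normals have Gram matrix `-cos (π / M i j)`. -/
def hIdealLink (n : ℕ) (P : Set ↥(hypSet n)) (w : EuclideanSpace ℝ (Fin (n + 1)))
    {k : ℕ} (M : Matrix (Fin k) (Fin k) ℕ) : Prop :=
  ∃ e : Fin k → EuclideanSpace ℝ (Fin (n + 1)),
    (∀ i, mink n (e i) (e i) = 1) ∧
    (∀ i, mink n (e i) w = 0) ∧
    (∀ i j, i ≠ j → mink n (e i) (e j) = -Real.cos (Real.pi / (M i j : ℝ))) ∧
    (∀ i j, i ≠ j → hWall n (e i) ≠ hWall n (e j)) ∧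
    {S | hIsFacet n P S ∧ w ∈ closure (hCone n S)} =
      Set.range fun i => P ∩ hWall n (e i)

/-- The number of tiles of `𝒯` incident to the ideal point `w`. -/
def hTilesAt (n : ℕ) (𝒯 : Set (Set ↥(hypSet n)))
    (w : EuclideanSpace ℝ (Fin (n + 1))) : ℕ :=
  {T | T ∈ 𝒯 ∧ w ∈ closure (hCone n T)}.ncard

/-- An occurrence, in the Coxeter diagram of `P`, of a subdiagram of type `M`:
a set `𝒜` of `k` facets of `P` whose unit normals have Gram matrix
`-cos (π / M i j)`. -/
def hSubOcc (n : ℕ) (P : Set ↥(hypSet n)) {k : ℕ} (M : Matrix (Fin k) (Fin k) ℕ)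
    (𝒜 : Set (Set ↥(hypSet n))) : Prop :=
  ∃ e : Fin k → EuclideanSpace ℝ (Fin (n + 1)),
    (∀ i, mink n (e i) (e i) = 1) ∧
    (∀ i j, i ≠ j → mink n (e i) (e j) = -Real.cos (Real.pi / (M i j : ℝ))) ∧
    (∀ i, hIsFacet n P (P ∩ hWall n (e i))) ∧
    𝒜 = Set.range (fun i => P ∩ hWall n (e i)) ∧ 𝒜.ncard = k

/-- The polyhedron `P ⊆ H^n` is a Coxeter simplex with Coxeter diagram (matrix) `M`. -/
def hOfType (n : ℕ) (P : Set ↥(hypSet n)) {k : ℕ} (M : Matrix (Fin k) (Fin k) ℕ) : Prop :=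
  (∀ i, M i i = 1) ∧ (∀ i j, M i j = M j i) ∧
  ∃ e : Fin k → EuclideanSpace ℝ (Fin (n + 1)),
    (∀ i, mink n (e i) (e i) = 1) ∧
    (∀ i j, i ≠ j → mink n (e i) (e j) = -Real.cos (Real.pi / (M i j : ℝ))) ∧
    P = ⋂ i, hHalf n (e i) ∧ (∀ i, hIsFacet n P (P ∩ hWall n (e i)))

/-- Equivalence of two decompositions of the same polyhedron `P`, up to an
isometry preserving `P`. -/
def hDecompEquiv (n : ℕ) (P : Set ↥(hypSet n)) (𝒯₁ 𝒯₂ : Set (Set ↥(hypSet n))) : Prop :=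
  ∃ g, hIsIsom n g ∧ g '' P = P ∧ (fun T => g '' T) '' 𝒯₁ = 𝒯₂

/-- A Coxeter decomposition of the second type of `P` with fundamental simplex `F`. -/
def hSTDecomp (n : ℕ) (P F : Set ↥(hypSet n)) (𝒯 : Set (Set ↥(hypSet n))) : Prop :=
  hIsCoxDecomp n P 𝒯 ∧ (∀ T ∈ 𝒯, hCongr n F T) ∧ hSecondType n P 𝒯

def hCoxSimplex (n : ℕ) (P : Set ↥(hypSet n)) : Prop := hIsCoxPoly n P ∧ hIsSimplex n P

/-! ## The sphere `S^n ⊂ ℝ^{n+1}`. -/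

/-- The Euclidean dot product on `ℝ^{n+1}`. -/
def sdot (n : ℕ) (x y : EuclideanSpace ℝ (Fin (n + 1))) : ℝ := ∑ i, x i * y i

/-- The unit sphere `S^n ⊂ ℝ^{n+1}`. -/
def sSet (n : ℕ) : Set (EuclideanSpace ℝ (Fin (n + 1))) := {x | sdot n x x = 1}

/-- The closed hemisphere of `S^n` with (unit) outward normal `v`. -/
def sHalf (n : ℕ) (v : EuclideanSpace ℝ (Fin (n + 1))) : Set ↥(sSet n) :=
  {x | sdot n v x.val ≤ 0}

/-- The great hypersphere of `S^n` with (unit) normal `v`. -/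
def sWall (n : ℕ) (v : EuclideanSpace ℝ (Fin (n + 1))) : Set ↥(sSet n) :=
  {x | sdot n v x.val = 0}

/-- The spherical (Riemannian) volume of `S ⊆ S^n`: `(n+1)` times the Lebesgue
measure of the cone over `S` truncated at radius `1`. -/
def sVol (n : ℕ) (S : Set ↥(sSet n)) : ℝ≥0∞ :=
  ((n : ℝ≥0∞) + 1) *
    volume {y : Fin (n + 1) → ℝ | ∃ x ∈ S, ∃ t : ℝ, 0 < t ∧ t ≤ 1 ∧
      y = fun i => t * (x : EuclideanSpace ℝ (Fin (n + 1))) i}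

/-- An isometry of `S^n`: a bijection preserving the dot product (equivalently,
the spherical distance). -/
def sIsIsom (n : ℕ) (g : ↥(sSet n) → ↥(sSet n)) : Prop :=
  Function.Bijective g ∧ ∀ x y, sdot n (g x).val (g y).val = sdot n x.val y.val

def sCongr (n : ℕ) (A B : Set ↥(sSet n)) : Prop := ∃ g, sIsIsom n g ∧ g '' A = B

/-- The ambient reflection of `ℝ^{n+1}` in the hyperplane with unit normal `v`. -/
def sReflect (n : ℕ) (v x : EuclideanSpace ℝ (Fin (n + 1))) :
    EuclideanSpace ℝ (Fin (n + 1)) :=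
  x - (2 * sdot n v x) • v

/-- `S` is a facet of the spherical polyhedron `P`. -/
def sIsFacet (n : ℕ) (P S : Set ↥(sSet n)) : Prop :=
  S.Nonempty ∧ ∃ v, sdot n v v = 1 ∧ P ⊆ sHalf n v ∧ S = P ∩ sWall n v ∧
    ∀ u, sdot n u u = 1 → S ⊆ sWall n u → sWall n u = sWall n v

/-- A convex polyhedron in `S^n`. -/
def sIsPoly (n : ℕ) (P : Set ↥(sSet n)) : Prop :=
  ∃ (k : ℕ) (v : Fin k → EuclideanSpace ℝ (Fin (n + 1))),
    (∀ i, sdot n (v i) (v i) = 1) ∧ P = ⋂ i, sHalf n (v i) ∧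
    (interior P).Nonempty ∧ sVol n P < ⊤

/-- A Coxeter polyhedron in `S^n`. -/
def sIsCoxPoly (n : ℕ) (P : Set ↥(sSet n)) : Prop :=
  ∃ (k : ℕ) (v : Fin k → EuclideanSpace ℝ (Fin (n + 1))),
    (∀ i, sdot n (v i) (v i) = 1) ∧ P = ⋂ i, sHalf n (v i) ∧
    (interior P).Nonempty ∧ sVol n P < ⊤ ∧
    ∀ i j, sWall n (v i) ≠ sWall n (v j) →
      (∃ x ∈ P, x ∈ sWall n (v i) ∩ sWall n (v j)) →
      ∃ m : ℕ, 2 ≤ m ∧ sdot n (v i) (v j) = -Real.cos (Real.pi / (m : ℝ))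

/-- A spherical simplex in `S^n`: the intersection of `S^n` with a simplicial cone,
i.e. a convex spherical polyhedron with exactly `n+1` facets. -/
def sIsSimplex (n : ℕ) (P : Set ↥(sSet n)) : Prop :=
  sIsPoly n P ∧ {S | sIsFacet n P S}.ncard = n + 1

/-- A Coxeter decomposition of `P ⊆ S^n`. -/
def sIsCoxDecomp (n : ℕ) (P : Set ↥(sSet n)) (𝒯 : Set (Set ↥(sSet n))) : Prop :=
  𝒯.Finite ∧ 𝒯.Nonempty ∧ (∀ T ∈ 𝒯, sIsCoxPoly n T) ∧ ⋃₀ 𝒯 = P ∧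
  (∀ T₁ ∈ 𝒯, ∀ T₂ ∈ 𝒯, T₁ ≠ T₂ → interior T₁ ∩ interior T₂ = ∅) ∧
  (∀ T₁ ∈ 𝒯, ∀ T₂ ∈ 𝒯, T₁ ≠ T₂ → ∀ S, sIsFacet n T₁ S → sIsFacet n T₂ S →
    ∃ v, sdot n v v = 1 ∧ S ⊆ sWall n v ∧
      T₂ = {y | ∃ x ∈ T₁, (y : EuclideanSpace ℝ (Fin (n + 1))) = sReflect n v x.val})

/-- Mirrors of a spherical Coxeter decomposition. -/
def sIsMirror (n : ℕ) (P : Set ↥(sSet n)) (𝒯 : Set (Set ↥(sSet n)))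
    (v : EuclideanSpace ℝ (Fin (n + 1))) : Prop :=
  sdot n v v = 1 ∧ (∃ T ∈ 𝒯, ∃ S, sIsFacet n T S ∧ S ⊆ sWall n v) ∧
  ¬∃ S, sIsFacet n P S ∧ S ⊆ sWall n v

/-- Second type: every dihedral angle of `P` is fundamental. -/
def sSecondType (n : ℕ) (P : Set ↥(sSet n)) (𝒯 : Set (Set ↥(sSet n))) : Prop :=
  ∀ α β, sIsFacet n P α → sIsFacet n P β → α ≠ β → (α ∩ β).Nonempty →
    ¬∃ v, sIsMirror n P 𝒯 v ∧ α ∩ β ⊆ sWall n v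

/-- `P ⊆ S^n` is a Coxeter simplex with Coxeter diagram (matrix) `M`. -/
def sOfType (n : ℕ) (P : Set ↥(sSet n)) {k : ℕ} (M : Matrix (Fin k) (Fin k) ℕ) : Prop :=
  (∀ i, M i i = 1) ∧ (∀ i j, M i j = M j i) ∧
  ∃ e : Fin k → EuclideanSpace ℝ (Fin (n + 1)),
    (∀ i, sdot n (e i) (e i) = 1) ∧
    (∀ i j, i ≠ j → sdot n (e i) (e j) = -Real.cos (Real.pi / (M i j : ℝ))) ∧
    P = ⋂ i, sHalf n (e i) ∧ (∀ i, sIsFacet n P (P ∩ sWall n (e i)))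

/-- `P ⊆ S^n` is a Coxeter simplex of the type given by the diagram `c`. -/
def sOfTypeCM (n : ℕ) (P : Set ↥(sSet n)) (c : CM) : Prop := sOfType n P c.2

/-! ## Euclidean space `E^n`. -/

/-- The dot product on `E^n`. -/
def edot (n : ℕ) (x y : EuclideanSpace ℝ (Fin n)) : ℝ := ∑ i, x i * y i

/-- The closed affine half-space `{x : ⟨v,x⟩ ≤ c}` of `E^n`. -/
def eHalf (n : ℕ) (v : EuclideanSpace ℝ (Fin n)) (c : ℝ) : Set (EuclideanSpace ℝ (Fin n)) :=
  {x | edot n v x ≤ c}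

/-- The affine hyperplane `{x : ⟨v,x⟩ = c}` of `E^n`. -/
def eWall (n : ℕ) (v : EuclideanSpace ℝ (Fin n)) (c : ℝ) : Set (EuclideanSpace ℝ (Fin n)) :=
  {x | edot n v x = c}

/-- Reflection of `E^n` in the affine hyperplane `{x : ⟨v,x⟩ = c}` (`v` a unit vector). -/
def eReflect (n : ℕ) (v : EuclideanSpace ℝ (Fin n)) (c : ℝ) (x : EuclideanSpace ℝ (Fin n)) :
    EuclideanSpace ℝ (Fin n) :=
  x - (2 * (edot n v x - c)) • v

/-- An isometry of `E^n`. -/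
def eIsIsom (n : ℕ) (g : EuclideanSpace ℝ (Fin n) → EuclideanSpace ℝ (Fin n)) : Prop :=
  Function.Bijective g ∧ ∀ x y, dist (g x) (g y) = dist x y

def eCongr (n : ℕ) (A B : Set (EuclideanSpace ℝ (Fin n))) : Prop :=
  ∃ g, eIsIsom n g ∧ g '' A = B

/-- A similarity transformation of `E^n` carries `A` onto `B`. -/
def eSimilar (n : ℕ) (A B : Set (EuclideanSpace ℝ (Fin n))) : Prop :=
  ∃ (f : EuclideanSpace ℝ (Fin n) → EuclideanSpace ℝ (Fin n)) (r : ℝ), 0 < r ∧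
    Function.Surjective f ∧ (∀ x y, dist (f x) (f y) = r * dist x y) ∧ f '' A = B

/-- `S` is a facet of the Euclidean polyhedron `P`. -/
def eIsFacet (n : ℕ) (P S : Set (EuclideanSpace ℝ (Fin n))) : Prop :=
  S.Nonempty ∧ ∃ v c, edot n v v = 1 ∧ P ⊆ eHalf n v c ∧ S = P ∩ eWall n v c ∧
    ∀ u d, edot n u u = 1 → S ⊆ eWall n u d → eWall n u d = eWall n v c

/-- A convex polyhedron in `E^n`. -/
def eIsPoly (n : ℕ) (P : Set (EuclideanSpace ℝ (Fin n))) : Prop :=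
  ∃ (k : ℕ) (v : Fin k → EuclideanSpace ℝ (Fin n)) (c : Fin k → ℝ),
    (∀ i, edot n (v i) (v i) = 1) ∧ P = ⋂ i, eHalf n (v i) (c i) ∧
    (interior P).Nonempty ∧ volume P < ⊤

/-- A Coxeter polyhedron in `E^n`. -/
def eIsCoxPoly (n : ℕ) (P : Set (EuclideanSpace ℝ (Fin n))) : Prop :=
  ∃ (k : ℕ) (v : Fin k → EuclideanSpace ℝ (Fin n)) (c : Fin k → ℝ),
    (∀ i, edot n (v i) (v i) = 1) ∧ P = ⋂ i, eHalf n (v i) (c i) ∧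
    (interior P).Nonempty ∧ volume P < ⊤ ∧
    ∀ i j, eWall n (v i) (c i) ≠ eWall n (v j) (c j) →
      (∃ x ∈ P, x ∈ eWall n (v i) (c i) ∩ eWall n (v j) (c j)) →
      ∃ m : ℕ, 2 ≤ m ∧ edot n (v i) (v j) = -Real.cos (Real.pi / (m : ℝ))

/-- A simplex in `E^n`: a convex polyhedron with exactly `n+1` facets. -/
def eIsSimplex (n : ℕ) (P : Set (EuclideanSpace ℝ (Fin n))) : Prop :=
  eIsPoly n P ∧ {S | eIsFacet n P S}.ncard = n + 1

/-- A Coxeter decomposition of `P ⊆ E^n`. -/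
def eIsCoxDecomp (n : ℕ) (P : Set (EuclideanSpace ℝ (Fin n)))
    (𝒯 : Set (Set (EuclideanSpace ℝ (Fin n)))) : Prop :=
  𝒯.Finite ∧ 𝒯.Nonempty ∧ (∀ T ∈ 𝒯, eIsCoxPoly n T) ∧ ⋃₀ 𝒯 = P ∧
  (∀ T₁ ∈ 𝒯, ∀ T₂ ∈ 𝒯, T₁ ≠ T₂ → interior T₁ ∩ interior T₂ = ∅) ∧
  (∀ T₁ ∈ 𝒯, ∀ T₂ ∈ 𝒯, T₁ ≠ T₂ → ∀ S, eIsFacet n T₁ S → eIsFacet n T₂ S →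
    ∃ v c, edot n v v = 1 ∧ S ⊆ eWall n v c ∧ T₂ = eReflect n v c '' T₁)

/-- Mirrors of a Euclidean Coxeter decomposition. -/
def eIsMirror (n : ℕ) (P : Set (EuclideanSpace ℝ (Fin n)))
    (𝒯 : Set (Set (EuclideanSpace ℝ (Fin n))))
    (v : EuclideanSpace ℝ (Fin n)) (c : ℝ) : Prop :=
  edot n v v = 1 ∧ (∃ T ∈ 𝒯, ∃ S, eIsFacet n T S ∧ S ⊆ eWall n v c) ∧
  ¬∃ S, eIsFacet n P S ∧ S ⊆ eWall n v c

/-- Second type: every dihedral angle of `P` is fundamental. -/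
def eSecondType (n : ℕ) (P : Set (EuclideanSpace ℝ (Fin n)))
    (𝒯 : Set (Set (EuclideanSpace ℝ (Fin n)))) : Prop :=
  ∀ α β, eIsFacet n P α → eIsFacet n P β → α ≠ β → (α ∩ β).Nonempty →
    ¬∃ v c, eIsMirror n P 𝒯 v c ∧ α ∩ β ⊆ eWall n v c

/-- `P ⊆ E^n` is a Coxeter simplex with Coxeter diagram (matrix) `M`. -/
def eOfType (n : ℕ) (P : Set (EuclideanSpace ℝ (Fin n))) {k : ℕ}
    (M : Matrix (Fin k) (Fin k) ℕ) : Prop :=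
  (∀ i, M i i = 1) ∧ (∀ i j, M i j = M j i) ∧
  ∃ (e : Fin k → EuclideanSpace ℝ (Fin n)) (c : Fin k → ℝ),
    (∀ i, edot n (e i) (e i) = 1) ∧
    (∀ i j, i ≠ j → edot n (e i) (e j) = -Real.cos (Real.pi / (M i j : ℝ))) ∧
    P = ⋂ i, eHalf n (e i) (c i) ∧ (∀ i, eIsFacet n P (P ∩ eWall n (e i) (c i)))

/-! ## The particular non-compact hyperbolic Coxeter simplices occurring in the
classification, identified by the structural data given in the paper
(dimension, compactness, number and types of ideal vertices, subdiagrams of the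
Coxeter diagram, and (relative) volumes). -/

/-- The Coxeter simplex `H₃⁴ ⊂ H⁴`: non-compact, with exactly one ideal vertex,
whose horospherical link is of Euclidean type `Ã₃`; volume `≈ 0.01370778`. -/
def IsH34 {n : ℕ} (P : Set ↥(hypSet n)) : Prop :=
  n = 4 ∧ hCoxSimplex n P ∧ ¬IsCompact P ∧ (hIdealVerts n P).ncard = 1 ∧
  (∀ w ∈ hIdealVerts n P, hIdealLink n P w cmA3t) ∧
  hVol n P ∈ Set.Ioo (ENNReal.ofReal 0.0137077) (ENNReal.ofReal 0.0137078)

/-- The Coxeter simplex `H₉⁴ ⊂ H⁴`: non-compact, with exactly three ideal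
vertices, each of type `Ã₃`, of volume exactly `10` times that of `H₃⁴`. -/
def IsH94 {n : ℕ} (P : Set ↥(hypSet n)) : Prop :=
  n = 4 ∧ hCoxSimplex n P ∧ ¬IsCompact P ∧ (hIdealVerts n P).ncard = 3 ∧
  (∀ w ∈ hIdealVerts n P, hIdealLink n P w cmA3t) ∧
  ∀ F : Set ↥(hypSet n), IsH34 F → hVol n P = 10 * hVol n F

/-- The Coxeter simplex `H₄⁵ ⊂ H⁵`: non-compact, of volume `≈ 0.0010956247`. -/
def IsH45 {n : ℕ} (P : Set ↥(hypSet n)) : Prop :=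
  n = 5 ∧ hCoxSimplex n P ∧ ¬IsCompact P ∧
  hVol n P ∈ Set.Ioo (ENNReal.ofReal 0.0010956) (ENNReal.ofReal 0.0010957)

/-- The Coxeter simplex `H₅⁵ ⊂ H⁵`: non-compact, of volume `≈ 0.0018260413`,
whose Coxeter diagram contains exactly one parabolic subdiagram of type `C̃₄`
and exactly one of type `F̃₄`. -/
def IsH55 {n : ℕ} (P : Set ↥(hypSet n)) : Prop :=
  n = 5 ∧ hCoxSimplex n P ∧ ¬IsCompact P ∧
  {𝒜 | hSubOcc n P cmC4t 𝒜}.ncard = 1 ∧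
  {𝒜 | hSubOcc n P cmF4t 𝒜}.ncard = 1 ∧
  hVol n P ∈ Set.Ioo (ENNReal.ofReal 0.0018260) (ENNReal.ofReal 0.0018261)

/-- The Coxeter simplex `H₇⁵ ⊂ H⁵`: non-compact, of volume `≈ 0.0036520826`,
with three ideal vertices, whose Coxeter diagram contains no parabolic
subdiagram of type `D̃₄`. -/
def IsH75 {n : ℕ} (P : Set ↥(hypSet n)) : Prop :=
  n = 5 ∧ hCoxSimplex n P ∧ ¬IsCompact P ∧ (hIdealVerts n P).ncard = 3 ∧
  (¬∃ 𝒜, hSubOcc n P cmD4t 𝒜) ∧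
  hVol n P ∈ Set.Ioo (ENNReal.ofReal 0.0036520) (ENNReal.ofReal 0.0036521)

/-- The Coxeter simplex `H₁₁⁵ ⊂ H⁵`: non-compact, with five ideal vertices, one
of which has horospherical link of Euclidean type `D̃₄`; its volume is exactly
`20` times that of `H₄⁵` (and exactly `6` times that of `H₇⁵`). -/
def IsH115 {n : ℕ} (P : Set ↥(hypSet n)) : Prop :=
  n = 5 ∧ hCoxSimplex n P ∧ ¬IsCompact P ∧ (hIdealVerts n P).ncard = 5 ∧
  (∃ w ∈ hIdealVerts n P, hIdealLink n P w cmD4t) ∧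
  (∀ F : Set ↥(hypSet n), IsH45 F → hVol n P = 20 * hVol n F) ∧
  (∀ F : Set ↥(hypSet n), IsH75 F → hVol n P = 6 * hVol n F)

/-- The Coxeter simplex `H₁₂⁵ ⊂ H⁵`: non-compact, whose Coxeter diagram contains
exactly two parabolic subdiagrams of type `C̃₄` and exactly four of type `F̃₄`;
its volume is exactly `16` times that of `H₅⁵`. -/
def IsH125 {n : ℕ} (P : Set ↥(hypSet n)) : Prop :=
  n = 5 ∧ hCoxSimplex n P ∧ ¬IsCompact P ∧
  {𝒜 | hSubOcc n P cmC4t 𝒜}.ncard = 2 ∧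
  {𝒜 | hSubOcc n P cmF4t 𝒜}.ncard = 4 ∧
  ∀ F : Set ↥(hypSet n), IsH55 F → hVol n P = 16 * hVol n F

/-- The Coxeter simplex `H₁⁸ ⊂ H⁸`: the non-compact Coxeter simplex of minimal
volume in `H⁸`, with exactly one ideal vertex. -/
def IsH18 {n : ℕ} (P : Set ↥(hypSet n)) : Prop :=
  n = 8 ∧ hCoxSimplex n P ∧ ¬IsCompact P ∧ (hIdealVerts n P).ncard = 1 ∧
  ∀ Q : Set ↥(hypSet n), hCoxSimplex n Q → ¬IsCompact Q → hVol n P ≤ hVol n Q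

/-- The Coxeter simplex `H₄⁸ ⊂ H⁸`: non-compact, with exactly two ideal
vertices, whose Coxeter diagram contains a subdiagram of type `A₈`; its volume
is exactly `272` times that of `H₁⁸`. -/
def IsH48 {n : ℕ} (P : Set ↥(hypSet n)) : Prop :=
  n = 8 ∧ hCoxSimplex n P ∧ ¬IsCompact P ∧ (hIdealVerts n P).ncard = 2 ∧
  (∃ 𝒜, hSubOcc n P (cmA 8) 𝒜) ∧
  ∀ F : Set ↥(hypSet n), IsH18 F → hVol n P = 272 * hVol n F

/-- The Coxeter simplex `H₁⁹ ⊂ H⁹`: the non-compact Coxeter simplex of minimal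
volume in `H⁹`, with exactly one ideal vertex. -/
def IsH19 {n : ℕ} (P : Set ↥(hypSet n)) : Prop :=
  n = 9 ∧ hCoxSimplex n P ∧ ¬IsCompact P ∧ (hIdealVerts n P).ncard = 1 ∧
  ∀ Q : Set ↥(hypSet n), hCoxSimplex n Q → ¬IsCompact Q → hVol n P ≤ hVol n Q

/-- The Coxeter simplex `H₃⁹ ⊂ H⁹`: non-compact, with exactly three ideal
vertices; its volume is exactly `527` times that of `H₁⁹`. -/
def IsH39 {n : ℕ} (P : Set ↥(hypSet n)) : Prop :=
  n = 9 ∧ hCoxSimplex n P ∧ ¬IsCompact P ∧ (hIdealVerts n P).ncard = 3 ∧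
  ∀ F : Set ↥(hypSet n), IsH19 F → hVol n P = 527 * hVol n F

section

/-! ## Algebra of the Minkowski form -/

section Minkowski

variable {n : ℕ}

lemma mink_comm (x y : EuclideanSpace ℝ (Fin (n + 1))) : mink n x y = mink n y x := by
  simp only [mink, mul_comm]

lemma mink_add_right (x y z : EuclideanSpace ℝ (Fin (n + 1))) :
    mink n x (y + z) = mink n x y + mink n x z := by
  simp only [mink, PiLp.add_apply, mul_add, Finset.sum_add_distrib]; ring

lemma mink_smul_right (t : ℝ) (x y : EuclideanSpace ℝ (Fin (n + 1))) :
    mink n x (t • y) = t * mink n x y := by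
  simp only [mink, PiLp.smul_apply, smul_eq_mul, mul_add, Finset.mul_sum]
  congr 1
  · ring
  · exact Finset.sum_congr rfl fun i _ => by ring

lemma mink_add_left (x y z : EuclideanSpace ℝ (Fin (n + 1))) :
    mink n (x + y) z = mink n x z + mink n y z := by
  rw [mink_comm, mink_add_right, mink_comm z, mink_comm z]

lemma mink_smul_left (t : ℝ) (x y : EuclideanSpace ℝ (Fin (n + 1))) :
    mink n (t • x) y = t * mink n x y := by
  rw [mink_comm, mink_smul_right, mink_comm]

/-- The Minkowski form as a bilinear map. -/
def minkB (n : ℕ) :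
    EuclideanSpace ℝ (Fin (n + 1)) →ₗ[ℝ] EuclideanSpace ℝ (Fin (n + 1)) →ₗ[ℝ] ℝ :=
  LinearMap.mk₂ ℝ (mink n) mink_add_left mink_smul_left mink_add_right
    (fun c x y => mink_smul_right c x y)

lemma minkB_apply (x y : EuclideanSpace ℝ (Fin (n + 1))) : minkB n x y = mink n x y := rfl

@[simp] lemma mink_zero_right (x : EuclideanSpace ℝ (Fin (n + 1))) : mink n x 0 = 0 :=
  (minkB n x).map_zero

@[simp] lemma mink_zero_left (x : EuclideanSpace ℝ (Fin (n + 1))) : mink n 0 x = 0 := by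
  rw [mink_comm, mink_zero_right]

lemma mink_neg_right (x y : EuclideanSpace ℝ (Fin (n + 1))) :
    mink n x (-y) = -mink n x y := (minkB n x).map_neg y

lemma mink_neg_left (x y : EuclideanSpace ℝ (Fin (n + 1))) :
    mink n (-x) y = -mink n x y := by rw [mink_comm, mink_neg_right, mink_comm]

lemma mink_sub_right (x y z : EuclideanSpace ℝ (Fin (n + 1))) :
    mink n x (y - z) = mink n x y - mink n x z := (minkB n x).map_sub y z

lemma mink_sub_left (x y z : EuclideanSpace ℝ (Fin (n + 1))) :
    mink n (x - y) z = mink n x z - mink n y z := by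
  rw [mink_comm, mink_sub_right, mink_comm z, mink_comm z]

lemma mink_sum_right {ι : Type*} (s : Finset ι) (x : EuclideanSpace ℝ (Fin (n + 1)))
    (f : ι → EuclideanSpace ℝ (Fin (n + 1))) :
    mink n x (∑ i ∈ s, f i) = ∑ i ∈ s, mink n x (f i) := map_sum (minkB n x) f s

lemma mink_sum_left {ι : Type*} (s : Finset ι) (x : EuclideanSpace ℝ (Fin (n + 1)))
    (f : ι → EuclideanSpace ℝ (Fin (n + 1))) :
    mink n (∑ i ∈ s, f i) x = ∑ i ∈ s, mink n (f i) x := by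
  rw [mink_comm, mink_sum_right]
  exact Finset.sum_congr rfl fun i _ => mink_comm _ _

@[fun_prop]
lemma continuous_mink {X : Type*} [TopologicalSpace X] {f g : X → EuclideanSpace ℝ (Fin (n + 1))}
    (hf : Continuous f) (hg : Continuous g) : Continuous fun x => mink n (f x) (g x) := by
  unfold mink
  fun_prop

lemma mink_nondegenerate {x : EuclideanSpace ℝ (Fin (n + 1))} (h : ∀ y, mink n x y = 0) :
    x = 0 := by
  ext j
  refine Fin.cases ?_ (fun i => ?_) j
  · have := h (EuclideanSpace.single 0 1)
    simpa [mink] using this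
  · have := h (EuclideanSpace.single i.succ 1)
    simpa [mink, PiLp.single_apply, Fin.succ_inj, Fin.succ_ne_zero, (Fin.succ_ne_zero _).symm] using this

/-- The spatial part has nonnegative square norm; Cauchy–Schwarz for spatial parts. -/
lemma spatial_cauchy (x y : EuclideanSpace ℝ (Fin (n + 1))) :
    (mink n x y + x 0 * y 0) ^ 2 ≤ (mink n x x + x 0 ^ 2) * (mink n y y + y 0 ^ 2) := by
  have := Finset.sum_mul_sq_le_sq_mul_sq Finset.univ (fun i : Fin n => x i.succ)
    (fun i : Fin n => y i.succ)
  have h : ∀ x y : EuclideanSpace ℝ (Fin (n + 1)),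
      mink n x y + x 0 * y 0 = ∑ i : Fin n, x i.succ * y i.succ := fun x y => by
    simp [mink]
  rw [h, sq (x 0), sq (y 0), h, h]
  simpa only [sq] using this

lemma spatial_nonneg (x : EuclideanSpace ℝ (Fin (n + 1))) : 0 ≤ mink n x x + x 0 ^ 2 := by
  have : mink n x x + x 0 ^ 2 = ∑ i : Fin n, x i.succ ^ 2 := by
    simp [mink, sq]
  rw [this]; positivity

lemma eq_zero_of_spatial {x : EuclideanSpace ℝ (Fin (n + 1))} (h : mink n x x ≤ 0)
    (h0 : x 0 = 0) : x = 0 := by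
  have h1 : ∑ i : Fin n, x i.succ ^ 2 ≤ 0 := by simpa [mink, h0, sq] using h
  have h2 := (Finset.sum_eq_zero_iff_of_nonneg (fun i _ => sq_nonneg (x i.succ))).1
    (le_antisymm h1 (Finset.sum_nonneg fun i _ => sq_nonneg _))
  ext j
  refine Fin.cases (by simpa using h0) (fun i => ?_) j
  simpa using h2 i (Finset.mem_univ i)

/-- The closed future cone. -/
def Fut (n : ℕ) : Set (EuclideanSpace ℝ (Fin (n + 1))) := {x | mink n x x ≤ 0 ∧ 0 ≤ x 0}

lemma fut_pos {x : EuclideanSpace ℝ (Fin (n + 1))} (hx : x ∈ Fut n) (h : x ≠ 0) : 0 < x 0 :=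
  lt_of_le_of_ne hx.2 fun h0 => h (eq_zero_of_spatial hx.1 h0.symm)

lemma fut_mink_nonpos {x y : EuclideanSpace ℝ (Fin (n + 1))} (hx : x ∈ Fut n)
    (hy : y ∈ Fut n) : mink n x y ≤ 0 := by
  by_contra! h
  have h1 := spatial_cauchy x y
  have h2 : (mink n x x + x 0 ^ 2) * (mink n y y + y 0 ^ 2) ≤ x 0 ^ 2 * y 0 ^ 2 :=
    mul_le_mul (by linarith [hx.1]) (by linarith [hy.1]) (spatial_nonneg y) (sq_nonneg _)
  have h3 : 0 ≤ x 0 * y 0 := mul_nonneg hx.2 hy.2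
  nlinarith

lemma fut_add {x y : EuclideanSpace ℝ (Fin (n + 1))} (hx : x ∈ Fut n) (hy : y ∈ Fut n) :
    x + y ∈ Fut n := by
  refine ⟨?_, by simpa using add_nonneg hx.2 hy.2⟩
  simp only [mink_add_left, mink_add_right, mink_comm y x]
  linarith [hx.1, hy.1, fut_mink_nonpos hx hy]

lemma fut_smul {x : EuclideanSpace ℝ (Fin (n + 1))} (hx : x ∈ Fut n) {t : ℝ} (ht : 0 ≤ t) :
    t • x ∈ Fut n := by
  refine ⟨?_, by simpa using mul_nonneg ht hx.2⟩
  simp only [mink_smul_left, mink_smul_right]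
  nlinarith [mul_nonneg ht ht, hx.1]

lemma fut_sum {ι : Type*} (s : Finset ι) {f : ι → EuclideanSpace ℝ (Fin (n + 1))}
    (h : ∀ i ∈ s, f i ∈ Fut n) : ∑ i ∈ s, f i ∈ Fut n := by
  induction s using Finset.cons_induction with
  | empty => simp [Fut]
  | cons a s ha ih =>
    rw [Finset.sum_cons]
    exact fut_add (h a (by simp)) (ih fun i hi => h i (by simp [hi]))

/-- The orthogonal complement of a nonzero causal vector is positive semidefinite, with radical
spanned by that vector. -/
lemma orth_causal {x y : EuclideanSpace ℝ (Fin (n + 1))} (hx : mink n x x ≤ 0) (hx0 : x 0 ≠ 0)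
    (h : mink n x y = 0) : 0 ≤ mink n y y ∧
      (mink n y y = 0 → y = (y 0 / x 0) • x) := by
  have hpos : 0 < x 0 ^ 2 := by positivity
  set z := y - (y 0 / x 0) • x with hz
  have hz0 : z 0 = 0 := by simp [hz]; field_simp; ring
  have hzz : 0 ≤ mink n z z := by simpa [hz0] using spatial_nonneg z
  have e : mink n z z = mink n y y + (y 0 / x 0) ^ 2 * mink n x x := by
    rw [hz]
    simp only [mink_sub_left, mink_sub_right, mink_smul_left, mink_smul_right, h, mink_comm y x]
    ring
  have h2 : (y 0 / x 0) ^ 2 * mink n x x ≤ 0 := by nlinarith [sq_nonneg (y 0 / x 0)]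
  refine ⟨by linarith, fun hy => ?_⟩
  have : z = 0 := eq_zero_of_spatial (by linarith) hz0
  exact sub_eq_zero.1 this

lemma orth_timelike {x y : EuclideanSpace ℝ (Fin (n + 1))} (hx : mink n x x < 0)
    (h : mink n x y = 0) (hy : y ≠ 0) : 0 < mink n y y := by
  have hx0 : x 0 ≠ 0 := fun h0 => by
    have := spatial_nonneg x
    rw [h0] at this
    linarith [this]
  obtain ⟨h1, h2⟩ := orth_causal hx.le hx0 h
  refine lt_of_le_of_ne h1 fun h3 => hy ?_
  have h4 := h2 h3.symm
  rw [h4, mink_smul_right] at h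
  rcases mul_eq_zero.1 h with h | h
  · rw [h4, h, zero_smul]
  · exact absurd h hx.ne

lemma fut_mink_neg {x y : EuclideanSpace ℝ (Fin (n + 1))} (hx : x ∈ Fut n)
    (hy : y ∈ Fut n) (hx0 : x ≠ 0) (h : ∀ t : ℝ, y ≠ t • x) : mink n x y < 0 := by
  refine lt_of_le_of_ne (fut_mink_nonpos hx hy) fun h0 => ?_
  obtain ⟨h1, h2⟩ := orth_causal hx.1 (fut_pos hx hx0).ne' h0
  exact h _ (h2 (le_antisymm hy.1 h1))

lemma fut_timelike_mink_neg {x y : EuclideanSpace ℝ (Fin (n + 1))} (hx : mink n x x < 0)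
    (hx' : x ∈ Fut n) (hy : y ∈ Fut n) (hy0 : y ≠ 0) : mink n x y < 0 := by
  refine lt_of_le_of_ne (fut_mink_nonpos hx' hy) fun h0 => ?_
  have := orth_timelike hx h0 hy0
  linarith [hy.1]

lemma hypSet_fut {x : EuclideanSpace ℝ (Fin (n + 1))} (hx : x ∈ hypSet n) : x ∈ Fut n :=
  ⟨by linarith [hx.1], hx.2.le⟩

lemma hypSet_ne_zero {x : EuclideanSpace ℝ (Fin (n + 1))} (hx : x ∈ hypSet n) : x ≠ 0 := by
  rintro rfl; simpa using hx.2

/-- Rescaling of a future timelike vector to the hyperboloid. -/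
lemma exists_hyp_smul {x : EuclideanSpace ℝ (Fin (n + 1))} (hx : x ∈ Fut n)
    (h : mink n x x < 0) : ∃ p : ↥(hypSet n), ∃ t : ℝ, 0 < t ∧ p.val = t • x := by
  have hs : 0 < Real.sqrt (-mink n x x) := Real.sqrt_pos.2 (by linarith)
  have hx0 : x ≠ 0 := by rintro rfl; simp at h
  refine ⟨⟨(Real.sqrt (-mink n x x))⁻¹ • x, ?_, ?_⟩, _, inv_pos.2 hs, rfl⟩
  · rw [mink_smul_left, mink_smul_right, ← mul_assoc, ← mul_inv, Real.mul_self_sqrt (by linarith)]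
    field_simp
    rw [div_self h.ne]
  · simpa using mul_pos (inv_pos.2 hs) (fut_pos hx hx0)

end Minkowski

end

section

/-! ## Simplicial frames -/

/-- The six unit outward normals of a (possibly ideal) simplex in `H^5`. -/
structure IsFrame (e : Fin 6 → EuclideanSpace ℝ (Fin (5 + 1))) (P : Set ↥(hypSet 5)) : Prop where
  unit : ∀ i, mink 5 (e i) (e i) = 1
  eq : P = ⋂ i, hHalf 5 (e i)
  fut : ∀ x, (∀ i, mink 5 (e i) x ≤ 0) → x ∈ Fut 5

namespace IsFrame

variable {e : Fin 6 → EuclideanSpace ℝ (Fin (5 + 1))} {P : Set ↥(hypSet 5)}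

lemma mem (h : IsFrame e P) {x : ↥(hypSet 5)} : x ∈ P ↔ ∀ i, mink 5 (e i) x.val ≤ 0 := by
  rw [h.eq]; simp [hHalf]

lemma ker (h : IsFrame e P) {x : EuclideanSpace ℝ (Fin (5 + 1))}
    (hx : ∀ i, mink 5 (e i) x = 0) : x = 0 := by
  have h1 := h.fut x fun i => (hx i).le
  have h2 := h.fut (-x) fun i => by rw [mink_neg_right, hx i, neg_zero]
  refine eq_zero_of_spatial h1.1 (le_antisymm ?_ h1.2)
  have := h2.2
  simp at this
  linarith

/-- Coordinates with respect to the normals. -/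
def coordL (e : Fin 6 → EuclideanSpace ℝ (Fin (5 + 1))) :
    EuclideanSpace ℝ (Fin (5 + 1)) →ₗ[ℝ] (Fin 6 → ℝ) :=
  -LinearMap.pi fun i => minkB 5 (e i)

lemma coordL_apply (x : EuclideanSpace ℝ (Fin (5 + 1))) (i : Fin 6) :
    coordL e x i = -mink 5 (e i) x := rfl

lemma coordL_injective (h : IsFrame e P) : Function.Injective (coordL e) := by
  rw [← LinearMap.ker_eq_bot, LinearMap.ker_eq_bot']
  intro x hx
  refine h.ker fun i => ?_
  have := congrFun hx i
  rw [coordL_apply] at this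
  simpa using this

/-- The coordinate isomorphism. -/
def coordE (h : IsFrame e P) : EuclideanSpace ℝ (Fin (5 + 1)) ≃ₗ[ℝ] (Fin 6 → ℝ) :=
  LinearEquiv.ofInjectiveOfFinrankEq (coordL e) h.coordL_injective (by simp)

lemma coordE_apply (h : IsFrame e P) (x : EuclideanSpace ℝ (Fin (5 + 1))) (i : Fin 6) :
    h.coordE x i = -mink 5 (e i) x := rfl

/-- The vertex vectors: the dual basis up to sign. -/
def dual (h : IsFrame e P) (i : Fin 6) : EuclideanSpace ℝ (Fin (5 + 1)) :=
  h.coordE.symm (Pi.single i 1)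

lemma mink_dual (h : IsFrame e P) (i j : Fin 6) :
    mink 5 (e i) (h.dual j) = if i = j then -1 else 0 := by
  have := h.coordE_apply (h.dual j) i
  rw [dual, LinearEquiv.apply_symm_apply, Pi.single_apply] at this
  rw [dual]
  split_ifs at this ⊢ <;> linarith

lemma mink_dual_sum (h : IsFrame e P) (i : Fin 6) (t : Fin 6 → ℝ) :
    mink 5 (e i) (∑ j, t j • h.dual j) = -t i := by
  simp [mink_sum_right, mink_smul_right, h.mink_dual]

lemma expand (h : IsFrame e P) (x : EuclideanSpace ℝ (Fin (5 + 1))) :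
    x = ∑ i, (-mink 5 (e i) x) • h.dual i := by
  refine sub_eq_zero.1 (h.ker fun i => ?_)
  rw [mink_sub_right, mink_dual_sum]; ring

lemma dual_fut (h : IsFrame e P) (i : Fin 6) : h.dual i ∈ Fut 5 :=
  h.fut _ fun j => by rw [h.mink_dual]; split_ifs <;> norm_num

lemma dual_ne_zero (h : IsFrame e P) (i : Fin 6) : h.dual i ≠ 0 := fun h0 => by
  have := h.mink_dual i i
  rw [h0] at this
  simp at this

lemma dual_mink_neg (h : IsFrame e P) {i j : Fin 6} (hij : i ≠ j) :
    mink 5 (h.dual i) (h.dual j) < 0 := by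
  refine fut_mink_neg (h.dual_fut i) (h.dual_fut j) (h.dual_ne_zero i) fun t ht => ?_
  have := h.mink_dual j j
  rw [ht, mink_smul_right, h.mink_dual, if_neg hij.symm] at this
  simp at this

lemma dual_mink_nonpos (h : IsFrame e P) (i j : Fin 6) :
    mink 5 (h.dual i) (h.dual j) ≤ 0 := fut_mink_nonpos (h.dual_fut i) (h.dual_fut j)

lemma mink_sum_dual_self (h : IsFrame e P) (t : Fin 6 → ℝ) :
    mink 5 (∑ i, t i • h.dual i) (∑ i, t i • h.dual i) =
      ∑ i, ∑ j, t i * t j * mink 5 (h.dual i) (h.dual j) := by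
  simp only [mink_sum_right, mink_sum_left, mink_smul_left, mink_smul_right, Finset.mul_sum]
  rw [Finset.sum_comm]
  exact Finset.sum_congr rfl fun i _ => Finset.sum_congr rfl fun j _ => by ring

lemma sum_mem_fut (h : IsFrame e P) {t : Fin 6 → ℝ} (ht : ∀ i, 0 ≤ t i) :
    ∑ i, t i • h.dual i ∈ Fut 5 := fut_sum _ fun i _ => fut_smul (h.dual_fut i) (ht i)

/-- A nonnegative combination with two positive coefficients is timelike. -/
lemma sum_timelike (h : IsFrame e P) {t : Fin 6 → ℝ} (ht : ∀ i, 0 ≤ t i) {i j : Fin 6}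
    (hij : i ≠ j) (hi : 0 < t i) (hj : 0 < t j) :
    mink 5 (∑ i, t i • h.dual i) (∑ i, t i • h.dual i) < 0 := by
  rw [h.mink_sum_dual_self]
  have h1 : ∀ a b, t a * t b * mink 5 (h.dual a) (h.dual b) ≤ 0 := fun a b =>
    mul_nonpos_of_nonneg_of_nonpos (mul_nonneg (ht a) (ht b)) (h.dual_mink_nonpos a b)
  refine Finset.sum_neg' (fun a _ => Finset.sum_nonpos fun b _ => h1 a b)
    ⟨i, Finset.mem_univ _, Finset.sum_neg' (fun b _ => h1 i b) ⟨j, Finset.mem_univ _, ?_⟩⟩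
  exact mul_neg_of_pos_of_neg (mul_pos hi hj) (h.dual_mink_neg hij)

/-- Points of `P` with prescribed coordinates up to scaling. -/
lemma exists_point (h : IsFrame e P) {t : Fin 6 → ℝ} (ht : ∀ i, 0 ≤ t i) {i j : Fin 6}
    (hij : i ≠ j) (hi : 0 < t i) (hj : 0 < t j) :
    ∃ p ∈ P, ∃ s : ℝ, 0 < s ∧ p.val = s • ∑ i, t i • h.dual i := by
  obtain ⟨p, s, hs, hp⟩ := exists_hyp_smul (h.sum_mem_fut ht) (h.sum_timelike ht hij hi hj)
  refine ⟨p, h.mem.2 fun k => ?_, s, hs, hp⟩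
  rw [hp, mink_smul_right, h.mink_dual_sum]
  nlinarith [ht k]

/-- The closed cone over a frame. -/
lemma closure_cone_inter (h : IsFrame e P) (I : Set (Fin 6)) (hI : ∃ i j, i ≠ j ∧ i ∉ I ∧ j ∉ I) :
    closure (hCone 5 (P ∩ {x | ∀ i ∈ I, x ∈ hWall 5 (e i)})) =
      {x | (∀ i, mink 5 (e i) x ≤ 0) ∧ ∀ i ∈ I, mink 5 (e i) x = 0} := by
  apply subset_antisymm
  · apply closure_minimal
    · rintro _ ⟨x, hx, t, ht, rfl⟩
      refine ⟨fun i => ?_, fun i hi => ?_⟩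
      · rw [mink_smul_right]
        nlinarith [h.mem.1 hx.1 i]
      · have : mink 5 (e i) x.val = 0 := hx.2 i hi
        rw [mink_smul_right, this, mul_zero]
    · simp only [ofPred_and, ofPred_forall]
      refine (isClosed_iInter fun i => isClosed_le (by fun_prop) (by fun_prop)).inter
        (isClosed_iInter fun i => isClosed_iInter fun _ => isClosed_eq (by fun_prop) (by fun_prop))
  · rintro x ⟨h1, h2⟩
    classical
    obtain ⟨i, j, hij, hi, hj⟩ := hI
    set c : EuclideanSpace ℝ (Fin (5 + 1)) := ∑ k, (if k ∈ I then 0 else 1 : ℝ) • h.dual k with hc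
    have key : ∀ s : ℝ, 0 < s → x + s • c ∈ hCone 5 (P ∩ {x | ∀ i ∈ I, x ∈ hWall 5 (e i)}) := by
      intro s hs
      have e1 : x + s • c =
          ∑ k, (-mink 5 (e k) x + if k ∈ I then 0 else s) • h.dual k := by
        conv_lhs => rw [h.expand x]
        rw [hc, Finset.smul_sum, ← Finset.sum_add_distrib]
        refine Finset.sum_congr rfl fun k _ => ?_
        rw [add_smul, smul_smul]
        split_ifs <;> simp
      have ht : ∀ k, 0 ≤ (-mink 5 (e k) x + if k ∈ I then 0 else s) := fun k => by
        have := h1 k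
        split_ifs <;> linarith
      obtain ⟨p, hp, r, hr, hpr⟩ := h.exists_point ht hij
        (by rw [if_neg hi]; linarith [h1 i]) (by rw [if_neg hj]; linarith [h1 j])
      refine ⟨p, ⟨hp, fun k hk => ?_⟩, r⁻¹, inv_pos.2 hr, ?_⟩
      · show mink 5 (e k) p.val = 0
        rw [hpr, mink_smul_right, h.mink_dual_sum, h2 k hk, if_pos hk]; simp
      · rw [hpr, e1, smul_smul, inv_mul_cancel₀ hr.ne', one_smul]
    have hlim : Filter.Tendsto (fun s : ℝ => x + s • c) (nhdsWithin 0 (Ioi 0)) (nhds x) := by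
      have : Continuous fun s : ℝ => x + s • c := by fun_prop
      have h0 := this.tendsto 0
      simp only [zero_smul, add_zero] at h0
      exact h0.mono_left nhdsWithin_le_nhds
    exact mem_closure_of_tendsto hlim (Filter.eventually_of_mem self_mem_nhdsWithin key)

lemma closure_cone (h : IsFrame e P) :
    closure (hCone 5 P) = {x | ∀ i, mink 5 (e i) x ≤ 0} := by
  have := h.closure_cone_inter ∅ ⟨0, 1, by decide, by simp, by simp⟩
  simpa using this

lemma closure_cone_facet (h : IsFrame e P) (i : Fin 6) :
    closure (hCone 5 (P ∩ hWall 5 (e i))) =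
      {x | (∀ j, mink 5 (e j) x ≤ 0) ∧ mink 5 (e i) x = 0} := by
  have := h.closure_cone_inter {i} (by
    fin_cases i
    exacts [⟨1, 2, by decide⟩, ⟨0, 2, by decide⟩, ⟨0, 1, by decide⟩, ⟨0, 1, by decide⟩,
      ⟨0, 1, by decide⟩, ⟨0, 1, by decide⟩])
  simpa using this

/-- The ideal vertices are the null generators. -/
lemma idealVerts (h : IsFrame e P) : hIdealVerts 5 P =
    {w | ∃ i, mink 5 (h.dual i) (h.dual i) = 0 ∧ w = (h.dual i 0)⁻¹ • h.dual i} := by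
  ext w
  rw [hIdealVerts, h.closure_cone]
  constructor
  · rintro ⟨hw, hw0, hc⟩
    set t : Fin 6 → ℝ := fun i => -mink 5 (e i) w with ht
    have ht0 : ∀ i, 0 ≤ t i := fun i => by have := hc i; simp only [ht]; linarith
    have hwt : w = ∑ i, t i • h.dual i := h.expand w
    have hne : ∃ i, 0 < t i := by
      by_contra! hn
      have : w = 0 := h.ker fun i => by have := hn i; have := ht0 i; simp only [ht] at *; linarith
      rw [this] at hw0
      simp at hw0
    obtain ⟨i, hi⟩ := hne
    have h1 : ∀ j, j ≠ i → t j = 0 := by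
      intro j hj
      by_contra hne
      have := h.sum_timelike ht0 hj.symm hi (lt_of_le_of_ne (ht0 j) (Ne.symm hne))
      rw [← hwt, hw] at this
      exact lt_irrefl _ this
    have h2 : w = t i • h.dual i := by
      rw [hwt]
      exact Finset.sum_eq_single i (fun j _ hj => by rw [h1 j hj, zero_smul]) (by simp)
    refine ⟨i, ?_, ?_⟩
    · rw [h2, mink_smul_left, mink_smul_right] at hw
      simpa [hi.ne'] using hw
    · have h3 : t i * h.dual i 0 = 1 := by
        rw [h2] at hw0
        simpa using hw0
      rw [h2, eq_inv_of_mul_eq_one_left h3]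
  · rintro ⟨i, hi, rfl⟩
    have hpos := fut_pos (h.dual_fut i) (h.dual_ne_zero i)
    refine ⟨by simp [mink_smul_left, mink_smul_right, hi], by simp [hpos.ne'], fun j => ?_⟩
    rw [mink_smul_right, h.mink_dual]
    have := inv_pos.2 hpos
    split_ifs <;> linarith

end IsFrame

end

section

/-- Small displacements of a point of the hyperboloid, rescaled, remain in a given
neighbourhood. -/
lemma eventually_push {n : ℕ} (x : ↥(hypSet n)) (v : EuclideanSpace ℝ (Fin (n + 1)))
    {O : Set ↥(hypSet n)} (hO : IsOpen O) (hx : x ∈ O) :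
    ∀ᶠ s : ℝ in nhds 0, ∃ p ∈ O, ∃ r : ℝ, 0 < r ∧ p.val = r • (x.val + s • v) := by
  obtain ⟨O', hO', rfl⟩ := isOpen_induced_iff.1 hO
  set m : ℝ → ℝ := fun s => -mink n (x.val + s • v) (x.val + s • v) with hm
  have hmc : Continuous m := by fun_prop
  have hm0 : m 0 = 1 := by simp [hm, x.2.1]
  have hpos : ∀ᶠ s in nhds 0, 0 < m s :=
    hmc.continuousAt.eventually (lt_mem_nhds (by rw [hm0]; norm_num))
  have hpos' : ∀ᶠ s in nhds (0 : ℝ), 0 < (x.val + s • v) 0 := by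
    have : Continuous fun s : ℝ => (x.val + s • v) 0 := by fun_prop
    exact this.continuousAt.eventually (lt_mem_nhds (by simpa using x.2.2))
  have hg : ContinuousAt (fun s : ℝ => (Real.sqrt (m s))⁻¹ • (x.val + s • v)) 0 := by
    have h1 : Continuous fun s => Real.sqrt (m s) := Real.continuous_sqrt.comp hmc
    have h2 : Continuous fun s : ℝ => x.val + s • v := by fun_prop
    exact (h1.continuousAt.inv₀ (by rw [hm0]; simp)).smul h2.continuousAt
  have hO'' : ∀ᶠ s in nhds 0, (Real.sqrt (m s))⁻¹ • (x.val + s • v) ∈ O' := by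
    refine hg.eventually (hO'.mem_nhds ?_)
    simpa [hm0] using hx
  filter_upwards [hpos, hpos', hO''] with s h1 h2 h3
  have hs : 0 < Real.sqrt (m s) := Real.sqrt_pos.2 h1
  refine ⟨⟨_, ?_, ?_⟩, h3, _, inv_pos.2 hs, rfl⟩
  · rw [mink_smul_left, mink_smul_right, ← mul_assoc, ← mul_inv, Real.mul_self_sqrt h1.le]
    have : mink n (x.val + s • v) (x.val + s • v) = -m s := by simp [hm]
    rw [this]
    field_simp
  · rw [PiLp.smul_apply, smul_eq_mul]
    exact mul_pos (inv_pos.2 hs) h2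

lemma interior_subset_strict {n : ℕ} {P : Set ↥(hypSet n)} {v : EuclideanSpace ℝ (Fin (n + 1))}
    (hv : 0 < mink n v v) (hP : P ⊆ hHalf n v) {x : ↥(hypSet n)} (hx : x ∈ interior P) :
    mink n v x.val < 0 := by
  refine lt_of_le_of_ne (hP (interior_subset hx)) fun h0 => ?_
  have h1 : ∀ᶠ s : ℝ in nhdsWithin 0 (Ioi 0), 0 < s := self_mem_nhdsWithin
  obtain ⟨s, ⟨p, hp, r, hr, hpr⟩, h2⟩ := (((eventually_push x v isOpen_interior hx).filter_mono
    nhdsWithin_le_nhds).and h1).exists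
  have := hP (interior_subset hp)
  rw [hHalf, mem_ofPred_eq, hpr, mink_smul_right, mink_add_right, mink_smul_right, h0] at this
  have : 0 < r * (0 + s * mink n v v) := by positivity
  linarith

lemma isOpen_strict {n : ℕ} {ι : Type*} [Finite ι] (v : ι → EuclideanSpace ℝ (Fin (n + 1))) :
    IsOpen {x : ↥(hypSet n) | ∀ i, mink n (v i) x.val < 0} := by
  rw [ofPred_forall]
  exact isOpen_iInter_of_finite fun i => isOpen_lt (by fun_prop) (by fun_prop)

namespace IsFrame

variable {e : Fin 6 → EuclideanSpace ℝ (Fin (5 + 1))} {P : Set ↥(hypSet 5)}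

lemma interior_eq (h : IsFrame e P) : interior P = {x | ∀ i, mink 5 (e i) x.val < 0} := by
  apply subset_antisymm
  · intro x hx i
    exact interior_subset_strict (by rw [h.unit]; norm_num) (fun y hy => h.mem.1 hy i) hx
  · exact interior_maximal (fun x hx => h.mem.2 fun i => (hx i).le) (isOpen_strict e)

lemma interior_nonempty (h : IsFrame e P) : (interior P).Nonempty := by
  obtain ⟨p, -, s, hs, hp⟩ := h.exists_point (t := fun _ => 1) (fun _ => zero_le_one)
    (show (0 : Fin 6) ≠ 1 by decide) one_pos one_pos
  refine ⟨p, ?_⟩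
  rw [h.interior_eq]
  intro i
  rw [hp, mink_smul_right, h.mink_dual_sum]
  linarith

/-- A vector which is orthogonal to all generators vanishes. -/
lemma eq_smul_of_dual (h : IsFrame e P) {w : EuclideanSpace ℝ (Fin (5 + 1))} {I : Finset (Fin 6)}
    (hw : ∀ k, k ∉ I → mink 5 w (h.dual k) = 0) :
    w = ∑ i ∈ I, (-mink 5 w (h.dual i)) • e i := by
  refine sub_eq_zero.1 (mink_nondegenerate fun y => ?_)
  rw [h.expand y, mink_sum_right]
  refine Finset.sum_eq_zero fun k _ => ?_
  rw [mink_smul_right, mink_sub_left, mink_sum_left]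
  simp only [mink_smul_left, h.mink_dual]
  by_cases hk : k ∈ I
  · simp [hk]
  · simp [hk, hw k hk]

/-- A hyperplane containing a face contains the generators of the face. -/
lemma dual_of_face (h : IsFrame e P) {w : EuclideanSpace ℝ (Fin (5 + 1))} {I : Set (Fin 6)}
    (hI : ∃ i j, i ≠ j ∧ i ∉ I ∧ j ∉ I)
    (hw : ∀ x ∈ P, (∀ i ∈ I, x ∈ hWall 5 (e i)) → x ∈ hWall 5 w) :
    ∀ k, k ∉ I → mink 5 w (h.dual k) = 0 := by
  classical
  intro k hk
  obtain ⟨i, j, hij, hi, hj⟩ := hI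
  have key : ∀ s : ℝ, 0 ≤ s → mink 5 w (∑ l, (if l ∈ I then 0 else if l = k then 1 + s else 1 : ℝ)
      • h.dual l) = 0 := by
    intro s hs
    obtain ⟨p, hp, r, hr, hpr⟩ := h.exists_point
      (t := fun l => (if l ∈ I then 0 else if l = k then 1 + s else 1 : ℝ))
      (fun l => by split_ifs <;> linarith) hij
      (by rw [if_neg hi]; split_ifs <;> linarith) (by rw [if_neg hj]; split_ifs <;> linarith)
    have := hw p hp fun l hl => by
      show mink 5 (e l) p.val = 0
      rw [hpr, mink_smul_right, h.mink_dual_sum, if_pos hl]; simp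
    have h2 : mink 5 w p.val = 0 := this
    rw [hpr, mink_smul_right] at h2
    exact (mul_eq_zero.1 h2).resolve_left hr.ne'
  have h0 := key 0 le_rfl
  have h1 := key 1 zero_le_one
  rw [mink_sum_right] at h0 h1
  have : ∑ l, (mink 5 w ((if l ∈ I then 0 else if l = k then 1 + 1 else 1 : ℝ) • h.dual l) -
      mink 5 w ((if l ∈ I then 0 else if l = k then 1 + 0 else 1 : ℝ) • h.dual l)) = 0 := by
    rw [Finset.sum_sub_distrib, h0, h1, sub_zero]
  rw [Finset.sum_eq_single k] at this
  · simp only [mink_smul_right, if_neg hk, if_true] at this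
    linarith
  · intro l _ hl
    simp [hl]
  · simp

lemma exists_pair_not_mem_singleton (i : Fin 6) :
    ∃ a b, a ≠ b ∧ a ∉ ({i} : Set (Fin 6)) ∧ b ∉ ({i} : Set (Fin 6)) := by
  simp only [mem_singleton_iff]
  revert i; decide

lemma exists_pair_not_mem_pair (i j : Fin 6) :
    ∃ a b, a ≠ b ∧ a ∉ ({i, j} : Set (Fin 6)) ∧ b ∉ ({i, j} : Set (Fin 6)) := by
  simp only [mem_insert_iff, mem_singleton_iff]
  revert i j; decide

/-- A unit vector whose wall contains a facet is plus or minus the corresponding normal. -/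
lemma eq_or_neg_of_facet (h : IsFrame e P) {w : EuclideanSpace ℝ (Fin (5 + 1))} {i : Fin 6}
    (hw1 : mink 5 w w = 1) (hw : P ∩ hWall 5 (e i) ⊆ hWall 5 w) : w = e i ∨ w = -e i := by
  have h1 := h.dual_of_face (w := w) (I := {i}) (exists_pair_not_mem_singleton i)
    fun x hx hx' => hw ⟨hx, hx' i rfl⟩
  have h2 := h.eq_smul_of_dual (w := w) (I := {i}) fun k hk => h1 k (by simpa using hk)
  rw [Finset.sum_singleton] at h2
  set a := -mink 5 w (h.dual i)
  rw [h2, mink_smul_left, mink_smul_right, h.unit, mul_one] at hw1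
  rcases mul_self_eq_one_iff.1 hw1 with ha | ha
  · left; rw [h2, ha, one_smul]
  · right; rw [h2, ha, neg_one_smul]

lemma hWall_neg (v : EuclideanSpace ℝ (Fin (5 + 1))) : hWall 5 (-v) = hWall 5 v := by
  ext x; simp [hWall, mink_neg_left]

lemma isFacet (h : IsFrame e P) (i : Fin 6) : hIsFacet 5 P (P ∩ hWall 5 (e i)) := by
  refine ⟨?_, e i, h.unit i, fun x hx => h.mem.1 hx i, rfl, fun w hw1 hw => ?_⟩
  · obtain ⟨a, b, hab, ha, hb⟩ := exists_pair_not_mem_singleton i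
    simp only [mem_singleton_iff] at ha hb
    obtain ⟨p, hp, s, hs, hps⟩ := h.exists_point (t := fun k => if k = i then 0 else 1)
      (fun k => by split_ifs <;> norm_num) hab (by simp [ha]) (by simp [hb])
    refine ⟨p, hp, ?_⟩
    show mink 5 (e i) p.val = 0
    rw [hps, mink_smul_right, h.mink_dual_sum]; simp
  · rcases h.eq_or_neg_of_facet hw1 hw with rfl | rfl
    · rfl
    · exact hWall_neg _

lemma facets (h : IsFrame e P) {S : Set ↥(hypSet 5)} (hS : hIsFacet 5 P S) :
    ∃ i, S = P ∩ hWall 5 (e i) := by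
  obtain ⟨⟨x, hx⟩, v, hv1, hPv, rfl, huniq⟩ := hS
  have hk : ∀ k, mink 5 v (h.dual k) ≤ 0 := by
    intro k
    have hcl : h.dual k ∈ closure (hCone 5 P) := by
      rw [h.closure_cone]
      intro i
      rw [h.mink_dual]; split_ifs <;> norm_num
    have : closure (hCone 5 P) ⊆ {y | mink 5 v y ≤ 0} := by
      refine closure_minimal ?_ (isClosed_le (by fun_prop) (by fun_prop))
      rintro _ ⟨y, hy, t, ht, rfl⟩
      have h1 : mink 5 v y.val ≤ 0 := hPv hy
      rw [mem_ofPred_eq, mink_smul_right]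
      nlinarith
    exact this hcl
  obtain ⟨i, hi⟩ : ∃ i, mink 5 v (h.dual i) < 0 := by
    by_contra! hn
    have := h.eq_smul_of_dual (w := v) (I := ∅) fun k _ => le_antisymm (hk k) (hn k)
    rw [Finset.sum_empty] at this
    rw [this] at hv1
    simp at hv1
  have hsub : P ∩ hWall 5 v ⊆ hWall 5 (e i) := by
    rintro y ⟨hy, hyv⟩
    have h1 : mink 5 v y.val = 0 := hyv
    rw [h.expand y.val, mink_sum_right] at h1
    simp only [mink_smul_right] at h1
    have h2 := (Finset.sum_eq_zero_iff_of_nonpos fun k _ =>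
      mul_nonpos_of_nonneg_of_nonpos (by linarith [h.mem.1 hy k]) (hk k)).1 h1 i (Finset.mem_univ i)
    show mink 5 (e i) y.val = 0
    have := (mul_eq_zero.1 h2).resolve_right hi.ne
    linarith
  exact ⟨i, by rw [huniq (e i) (h.unit i) hsub]⟩

lemma facet_injective (h : IsFrame e P) {i j : Fin 6}
    (hij : P ∩ hWall 5 (e i) = P ∩ hWall 5 (e j)) : i = j := by
  by_contra hne
  rcases h.eq_or_neg_of_facet (h.unit j) (by rw [hij]; exact inter_subset_right : P ∩ hWall 5 (e i) ⊆ _) with h1 | h1 <;>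
  · have h2 := h.mink_dual i i
    have h3 := h.mink_dual j i
    rw [h1] at h3
    simp [mink_neg_left, h2, Ne.symm hne] at h3

lemma wall_injective (h : IsFrame e P) {i j : Fin 6}
    (hij : hWall 5 (e i) = hWall 5 (e j)) : i = j := h.facet_injective (by rw [hij])

lemma facets_eq (h : IsFrame e P) :
    {S | hIsFacet 5 P S} = Set.range fun i => P ∩ hWall 5 (e i) := by
  ext S
  constructor
  · intro hS
    obtain ⟨i, rfl⟩ := h.facets hS
    exact ⟨i, rfl⟩
  · rintro ⟨i, rfl⟩
    exact h.isFacet i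

/-- A simplex with no null generators is compact. -/
lemma isCompact (h : IsFrame e P) (hd : ∀ i, mink 5 (h.dual i) (h.dual i) ≠ 0) : IsCompact P := by
  have hd' : ∀ i, mink 5 (h.dual i) (h.dual i) < 0 := fun i =>
    lt_of_le_of_ne (h.dual_fut i).1 (hd i)
  rw [Subtype.isCompact_iff]
  have him : (Subtype.val '' P : Set (EuclideanSpace ℝ (Fin (5 + 1)))) =
      {x | (∀ i, mink 5 (e i) x ≤ 0) ∧ mink 5 x x = -1 ∧ 0 ≤ x 0} := by
    ext x
    constructor
    · rintro ⟨y, hy, rfl⟩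
      exact ⟨h.mem.1 hy, y.2.1, y.2.2.le⟩
    · rintro ⟨h1, h2, h3⟩
      have hx0 : x ≠ 0 := by rintro rfl; simp at h2
      exact ⟨⟨x, h2, fut_pos ⟨by linarith, h3⟩ hx0⟩, h.mem.2 h1, rfl⟩
  rw [him]
  set B : Set (Fin 6 → ℝ) := Set.pi univ fun i =>
    Icc (0 : ℝ) (Real.sqrt (-mink 5 (h.dual i) (h.dual i))⁻¹)
  have hB : IsCompact B := isCompact_univ_pi fun i => isCompact_Icc
  have hB' : IsCompact ((fun t : Fin 6 → ℝ => ∑ i, t i • h.dual i) '' B) :=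
    hB.image (by fun_prop)
  refine hB'.of_isClosed_subset ?_ ?_
  · simp only [ofPred_and, ofPred_forall]
    exact (isClosed_iInter fun i => isClosed_le (by fun_prop) (by fun_prop)).inter
      ((isClosed_eq (by fun_prop) (by fun_prop)).inter (isClosed_le (by fun_prop) (by fun_prop)))
  · rintro x ⟨h1, h2, h3⟩
    refine ⟨fun i => -mink 5 (e i) x, fun i _ => ⟨by linarith [h1 i], ?_⟩, (h.expand x).symm⟩
    set t : Fin 6 → ℝ := fun i => -mink 5 (e i) x with ht
    have ht0 : ∀ i, 0 ≤ t i := fun i => by have := h1 i; simp only [ht]; linarith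
    have h4 : mink 5 x x = ∑ i, ∑ j, t i * t j * mink 5 (h.dual i) (h.dual j) := by
      conv_lhs => rw [h.expand x]
      exact h.mink_sum_dual_self t
    have h5 : ∀ a b, t a * t b * mink 5 (h.dual a) (h.dual b) ≤ 0 := fun a b =>
      mul_nonpos_of_nonneg_of_nonpos (mul_nonneg (ht0 a) (ht0 b)) (h.dual_mink_nonpos a b)
    have h6 : -1 ≤ t i * t i * mink 5 (h.dual i) (h.dual i) := by
      rw [h2] at h4
      rw [h4]
      calc _ ≤ ∑ j, t i * t j * mink 5 (h.dual i) (h.dual j) := by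
            rw [← Finset.add_sum_erase _ _ (Finset.mem_univ i)]
            linarith [Finset.sum_nonpos fun a (_ : a ∈ Finset.univ.erase i) =>
              Finset.sum_nonpos fun b (_ : b ∈ Finset.univ) => h5 a b]
        _ ≤ _ := by
            rw [← Finset.add_sum_erase _ _ (Finset.mem_univ i)]
            linarith [Finset.sum_nonpos fun a (_ : a ∈ Finset.univ.erase i) => h5 i a]
    apply Real.le_sqrt_of_sq_le
    have h7 := hd' i
    rw [← one_div, le_div_iff₀ (by linarith)]
    linarith

end IsFrame

end

/-! ## Integral data of the decomposition into twenty tiles -/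

/-- Twice the normals of the tiles, in terms of the normals of the big simplex. -/
def tileMat (τ : Fin 20) (i j : Fin 6) : ℤ :=
  (([[[2, 0, 0, 0, 0, 0], [-2, -1, -1, -1, 1, 0], [0, 2, 0, 0, 0, 0], [0, 0, 2, 0, 0, 0], [0, 0, 0, 2, 0, 0], [2, 1, 1, 1, -1, 2]],
   [[0, -1, -1, -1, 1, 0], [2, 1, 1, 1, -1, 0], [0, 2, 0, 0, 0, 0], [0, 0, 2, 0, 0, 0], [0, 0, 0, 2, 0, 0], [0, 0, 0, 0, 0, 2]],
   [[2, 0, 0, 0, 0, 0], [0, 0, 0, 0, 0, 2], [0, 2, 0, 0, 0, 0], [0, 0, 2, 0, 0, 0], [0, 0, 0, 2, 0, 0], [-2, -1, -1, -1, 1, -2]],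
   [[0, 1, 1, 1, -1, 0], [2, 0, 0, 0, 0, 0], [0, 1, -1, -1, 1, 0], [0, -1, 1, -1, 1, 0], [0, -1, -1, 1, 1, 0], [0, 0, 0, 0, 0, 2]],
   [[0, 2, 0, 0, 0, 0], [2, 0, 0, 0, 0, 0], [0, -1, 1, 1, -1, 0], [0, -1, 1, -1, 1, 0], [0, -1, -1, 1, 1, 0], [0, 0, 0, 0, 0, 2]],
   [[0, 0, 2, 0, 0, 0], [2, 0, 0, 0, 0, 0], [0, 1, -1, -1, 1, 0], [0, 1, -1, 1, -1, 0], [0, -1, -1, 1, 1, 0], [0, 0, 0, 0, 0, 2]],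
   [[0, 0, 0, 2, 0, 0], [2, 0, 0, 0, 0, 0], [0, 1, -1, -1, 1, 0], [0, -1, 1, -1, 1, 0], [0, 1, 1, -1, -1, 0], [0, 0, 0, 0, 0, 2]],
   [[0, 1, -1, 1, 1, 0], [2, 0, 0, 0, 0, 0], [0, -1, 1, 1, -1, 0], [0, -1, 1, -1, 1, 0], [0, 1, 1, -1, -1, 0], [0, 0, 0, 0, 0, 2]],
   [[0, -1, 1, 1, 1, 0], [2, 0, 0, 0, 0, 0], [0, 1, -1, -1, 1, 0], [0, 1, -1, 1, -1, 0], [0, 1, 1, -1, -1, 0], [0, 0, 0, 0, 0, 2]],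
   [[0, 1, -1, -1, -1, 0], [2, -1, 1, 1, 1, 0], [0, 0, 0, 0, 2, 0], [0, 0, 0, 2, 0, 0], [0, 0, 2, 0, 0, 0], [0, 0, 0, 0, 0, 2]],
   [[0, 0, 0, 0, 2, 0], [2, 0, 0, 0, 0, 0], [0, -1, 1, 1, -1, 0], [0, 1, -1, 1, -1, 0], [0, 1, 1, -1, -1, 0], [0, 0, 0, 0, 0, 2]],
   [[0, 1, 1, -1, 1, 0], [2, 0, 0, 0, 0, 0], [0, -1, 1, 1, -1, 0], [0, 1, -1, 1, -1, 0], [0, -1, -1, 1, 1, 0], [0, 0, 0, 0, 0, 2]],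
   [[0, -1, -1, 1, -1, 0], [2, 1, 1, -1, 1, 0], [0, 0, 2, 0, 0, 0], [0, 2, 0, 0, 0, 0], [0, 0, 0, 0, 2, 0], [0, 0, 0, 0, 0, 2]],
   [[2, 0, 0, 0, 0, 0], [-2, -1, -1, 1, -1, 0], [0, 0, 2, 0, 0, 0], [0, 2, 0, 0, 0, 0], [0, 0, 0, 0, 2, 0], [2, 1, 1, -1, 1, 2]],
   [[2, 0, 0, 0, 0, 0], [0, 0, 0, 0, 0, 2], [0, 0, 2, 0, 0, 0], [0, 2, 0, 0, 0, 0], [0, 0, 0, 0, 2, 0], [-2, -1, -1, 1, -1, -2]],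
   [[2, 0, 0, 0, 0, 0], [-2, 1, -1, -1, -1, 0], [0, 0, 0, 0, 2, 0], [0, 0, 0, 2, 0, 0], [0, 0, 2, 0, 0, 0], [2, -1, 1, 1, 1, 2]],
   [[2, 0, 0, 0, 0, 0], [0, 0, 0, 0, 0, 2], [0, 0, 0, 0, 2, 0], [0, 0, 0, 2, 0, 0], [0, 0, 2, 0, 0, 0], [-2, 1, -1, -1, -1, -2]],
   [[0, -1, 1, -1, -1, 0], [2, 1, -1, 1, 1, 0], [0, 0, 0, 2, 0, 0], [0, 0, 0, 0, 2, 0], [0, 2, 0, 0, 0, 0], [0, 0, 0, 0, 0, 2]],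
   [[2, 0, 0, 0, 0, 0], [-2, -1, 1, -1, -1, 0], [0, 0, 0, 2, 0, 0], [0, 0, 0, 0, 2, 0], [0, 2, 0, 0, 0, 0], [2, 1, -1, 1, 1, 2]],
   [[2, 0, 0, 0, 0, 0], [0, 0, 0, 0, 0, 2], [0, 0, 0, 2, 0, 0], [0, 0, 0, 0, 2, 0], [0, 2, 0, 0, 0, 0], [-2, -1, 1, -1, -1, -2]]] : List (List (List ℤ))).getD τ []).getD i [] |>.getD j 0

/-- The generators of the tiles, in terms of the generators of the big simplex. -/
def tileGen (τ : Fin 20) (i j : Fin 6) : ℤ :=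
  (([[[1, 0, 0, 0, 0, 0], [0, 0, 1, 0, 0, 0], [0, 0, 0, 1, 0, 0], [0, 0, 0, 0, 1, 0], [2, 2, 1, 1, 1, 0], [0, 1, 0, 0, 0, 1]],
   [[1, 1, 0, 0, 0, 0], [0, 0, 1, 0, 0, 0], [0, 0, 0, 1, 0, 0], [0, 0, 0, 0, 1, 0], [2, 0, 1, 1, 1, 0], [0, 0, 0, 0, 0, 1]],
   [[1, 0, 0, 0, 0, 0], [0, 0, 1, 0, 0, 0], [0, 0, 0, 1, 0, 0], [0, 0, 0, 0, 1, 0], [2, 2, 1, 1, 1, 2], [0, 1, 0, 0, 0, 0]],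
   [[0, 1, 0, 0, 0, 0], [1, 0, 1, 0, 0, 0], [1, 0, 0, 1, 0, 0], [1, 0, 0, 0, 1, 0], [1, 0, 1, 1, 1, 0], [0, 0, 0, 0, 0, 1]],
   [[0, 1, 0, 0, 0, 0], [1, 0, 0, 0, 0, 0], [1, 0, 1, 1, 0, 0], [1, 0, 1, 0, 1, 0], [1, 0, 0, 1, 1, 0], [0, 0, 0, 0, 0, 1]],
   [[0, 1, 0, 0, 0, 0], [1, 0, 1, 1, 0, 0], [1, 0, 0, 0, 0, 0], [1, 0, 0, 1, 1, 0], [1, 0, 1, 0, 1, 0], [0, 0, 0, 0, 0, 1]],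
   [[0, 1, 0, 0, 0, 0], [1, 0, 1, 0, 1, 0], [1, 0, 0, 1, 1, 0], [1, 0, 0, 0, 0, 0], [1, 0, 1, 1, 0, 0], [0, 0, 0, 0, 0, 1]],
   [[0, 1, 0, 0, 0, 0], [1, 0, 0, 0, 1, 0], [1, 0, 1, 1, 1, 0], [1, 0, 1, 0, 0, 0], [1, 0, 0, 1, 0, 0], [0, 0, 0, 0, 0, 1]],
   [[0, 1, 0, 0, 0, 0], [1, 0, 1, 1, 1, 0], [1, 0, 0, 0, 1, 0], [1, 0, 0, 1, 0, 0], [1, 0, 1, 0, 0, 0], [0, 0, 0, 0, 0, 1]],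
   [[1, 1, 0, 0, 0, 0], [2, 0, 1, 1, 1, 0], [0, 0, 0, 0, 1, 0], [0, 0, 0, 1, 0, 0], [0, 0, 1, 0, 0, 0], [0, 0, 0, 0, 0, 1]],
   [[0, 1, 0, 0, 0, 0], [1, 0, 0, 1, 1, 0], [1, 0, 1, 0, 1, 0], [1, 0, 1, 1, 0, 0], [1, 0, 0, 0, 0, 0], [0, 0, 0, 0, 0, 1]],
   [[0, 1, 0, 0, 0, 0], [1, 0, 0, 1, 0, 0], [1, 0, 1, 0, 0, 0], [1, 0, 1, 1, 1, 0], [1, 0, 0, 0, 1, 0], [0, 0, 0, 0, 0, 1]],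
   [[1, 1, 0, 0, 0, 0], [0, 0, 0, 1, 0, 0], [0, 0, 1, 0, 0, 0], [2, 0, 1, 1, 1, 0], [0, 0, 0, 0, 1, 0], [0, 0, 0, 0, 0, 1]],
   [[1, 0, 0, 0, 0, 0], [0, 0, 0, 1, 0, 0], [0, 0, 1, 0, 0, 0], [2, 2, 1, 1, 1, 0], [0, 0, 0, 0, 1, 0], [0, 1, 0, 0, 0, 1]],
   [[1, 0, 0, 0, 0, 0], [0, 0, 0, 1, 0, 0], [0, 0, 1, 0, 0, 0], [2, 2, 1, 1, 1, 2], [0, 0, 0, 0, 1, 0], [0, 1, 0, 0, 0, 0]],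
   [[1, 0, 0, 0, 0, 0], [2, 2, 1, 1, 1, 0], [0, 0, 0, 0, 1, 0], [0, 0, 0, 1, 0, 0], [0, 0, 1, 0, 0, 0], [0, 1, 0, 0, 0, 1]],
   [[1, 0, 0, 0, 0, 0], [2, 2, 1, 1, 1, 2], [0, 0, 0, 0, 1, 0], [0, 0, 0, 1, 0, 0], [0, 0, 1, 0, 0, 0], [0, 1, 0, 0, 0, 0]],
   [[1, 1, 0, 0, 0, 0], [0, 0, 0, 0, 1, 0], [2, 0, 1, 1, 1, 0], [0, 0, 1, 0, 0, 0], [0, 0, 0, 1, 0, 0], [0, 0, 0, 0, 0, 1]],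
   [[1, 0, 0, 0, 0, 0], [0, 0, 0, 0, 1, 0], [2, 2, 1, 1, 1, 0], [0, 0, 1, 0, 0, 0], [0, 0, 0, 1, 0, 0], [0, 1, 0, 0, 0, 1]],
   [[1, 0, 0, 0, 0, 0], [0, 0, 0, 0, 1, 0], [2, 2, 1, 1, 1, 2], [0, 0, 1, 0, 0, 0], [0, 0, 0, 1, 0, 0], [0, 1, 0, 0, 0, 0]]] : List (List (List ℤ))).getD τ []).getD i [] |>.getD j 0

/-- Twice the Gram matrix of the star with five leaves. -/
def starGram : Fin 6 → Fin 6 → ℤ :=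
  ![![2, -1, -1, -1, -1, -1], ![-1, 2, 0, 0, 0, 0], ![-1, 0, 2, 0, 0, 0], ![-1, 0, 0, 2, 0, 0], ![-1, 0, 0, 0, 2, 0], ![-1, 0, 0, 0, 0, 2]]

/-- Twice the Gram matrix of the fundamental simplex. -/
def baseGram : Fin 6 → Fin 6 → ℤ :=
  ![![2, -1, -1, -1, -1, 0], ![-1, 2, 0, 0, 0, -1], ![-1, 0, 2, 0, 0, 0], ![-1, 0, 0, 2, 0, 0], ![-1, 0, 0, 0, 2, 0], ![0, -1, 0, 0, 0, 2]]

/-- Coordinates of the barycentric point of a tile in terms of its normals. -/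
def tileCentre : Fin 6 → ℤ := ![42, 26, 20, 20, 20, 12]

lemma baseGram_centre : ∀ i, ∑ j, baseGram i j * tileCentre j = -2 := by decide +kernel

lemma tile_gram : ∀ τ i k,
    ∑ a, ∑ b, tileMat τ i a * tileMat τ k b * starGram a b = 4 * baseGram i k := by
  simp only [Fin.sum_univ_six]
  decide +kernel

lemma tile_inv' : ∀ τ i k, ∑ a, tileGen τ i a * tileMat τ a k = if i = k then 2 else 0 := by
  simp only [Fin.sum_univ_six]
  decide +kernel

lemma tileGen_nonneg : ∀ (τ : Fin 20) (i k : Fin 6), 0 ≤ tileGen τ i k := by decide +kernel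

lemma tile_neighbour : ∀ (τ : Fin 20) (i : Fin 6), (∃ j : Fin 6, ∀ k : Fin 6, tileMat τ i k = if k = j then 2 else 0) ∨
    ∃ σ : Fin 20, ∀ k l : Fin 6, tileMat σ k l = tileMat τ k l - baseGram k i * tileMat τ i l := by
  decide +kernel

lemma tile_dominance : ∀ τ σ, τ ≠ σ →
    (∀ k, 2 * tileCentre k ≤ ∑ a, (∑ i, tileCentre i * tileMat σ i a) * tileGen τ a k) ∧
    ∃ k, 2 * tileCentre k < ∑ a, (∑ i, tileCentre i * tileMat σ i a) * tileGen τ a k := by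
  simp only [Fin.sum_univ_six]
  decide +kernel

lemma tile_facets : ∀ τ σ : Fin 20, τ ≠ σ → ∀ i j : Fin 6,
    (∀ k : Fin 6, tileMat τ i k = tileMat σ j k) ∨ (∀ k : Fin 6, tileMat τ i k = -tileMat σ j k) →
    (∀ k l : Fin 6, tileMat σ k l = tileMat τ k l - baseGram k i * tileMat τ i l) ∨
    ∃ k : Fin 6, k ≠ i ∧ ∃ l : Fin 6, ∑ a, tileMat σ l a * tileGen τ a k < 0 := by
  simp only [Fin.sum_univ_six]
  decide +kernel

lemma tile_support : ∀ (τ : Fin 20) (i a b : Fin 6),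
    (∀ k : Fin 6, k ≠ a → k ≠ b → tileMat τ i k = 0) →
    ∃ j : Fin 6, ∀ k : Fin 6, tileMat τ i k = if k = j then 2 else 0 := by
  decide +kernel

lemma tile_count_special :
    (Finset.univ.filter fun τ => ∀ i, 0 ≤ tileMat τ i 5).card = 16 := by decide +kernel

lemma tile_count_other : ∀ k : Fin 6, k ≠ 0 → k ≠ 5 →
    (Finset.univ.filter fun τ => ∀ i, 0 ≤ tileMat τ i k).card = 1 := by decide +kernel

section

namespace IsFrame

variable {e e' : Fin 6 → EuclideanSpace ℝ (Fin (5 + 1))} {P P' : Set ↥(hypSet 5)}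

lemma ext_of_mink (h : IsFrame e P) {x y : EuclideanSpace ℝ (Fin (5 + 1))}
    (hxy : ∀ i, mink 5 (e i) x = mink 5 (e i) y) : x = y :=
  sub_eq_zero.1 (h.ker fun i => by rw [mink_sub_right, hxy, sub_self])

/-- The normals span. -/
lemma expand_normals (h : IsFrame e P) (x : EuclideanSpace ℝ (Fin (5 + 1))) :
    x = ∑ i, (-mink 5 x (h.dual i)) • e i :=
  h.eq_smul_of_dual (I := Finset.univ) fun k hk => absurd (Finset.mem_univ k) hk

/-- The linear map matching the coordinates of two frames. -/
def transfer (h : IsFrame e P) (h' : IsFrame e' P') :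
    EuclideanSpace ℝ (Fin (5 + 1)) →ₗ[ℝ] EuclideanSpace ℝ (Fin (5 + 1)) :=
  h'.coordE.symm.toLinearMap ∘ₗ h.coordE.toLinearMap

lemma mink_transfer (h : IsFrame e P) (h' : IsFrame e' P') (x : EuclideanSpace ℝ (Fin (5 + 1)))
    (i : Fin 6) : mink 5 (e' i) (h.transfer h' x) = mink 5 (e i) x := by
  have h1 := h'.coordE_apply (h.transfer h' x) i
  rw [transfer, LinearMap.comp_apply, LinearEquiv.coe_coe, LinearEquiv.coe_coe,
    LinearEquiv.apply_symm_apply, coordE_apply] at h1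
  simp only [transfer, LinearMap.comp_apply, LinearEquiv.coe_coe]
  linarith

lemma transfer_transfer (h : IsFrame e P) (h' : IsFrame e' P') (x : EuclideanSpace ℝ (Fin (5 + 1))) :
    h'.transfer h (h.transfer h' x) = x :=
  h.ext_of_mink fun i => by rw [mink_transfer, mink_transfer]

lemma transfer_normal (h : IsFrame e P) (h' : IsFrame e' P')
    (hg : ∀ i j, mink 5 (e i) (e j) = mink 5 (e' i) (e' j)) (j : Fin 6) :
    h.transfer h' (e j) = e' j :=
  h'.ext_of_mink fun i => by rw [mink_transfer, hg]

lemma mink_transfer_transfer (h : IsFrame e P) (h' : IsFrame e' P')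
    (hg : ∀ i j, mink 5 (e i) (e j) = mink 5 (e' i) (e' j))
    (x y : EuclideanSpace ℝ (Fin (5 + 1))) :
    mink 5 (h.transfer h' x) (h.transfer h' y) = mink 5 x y := by
  conv_lhs => rw [h.expand_normals x]
  conv_rhs => rw [h.expand_normals x]
  simp only [map_sum, map_smul, mink_sum_left, mink_smul_left, h.transfer_normal h' hg,
    mink_transfer]

/-- The sum of the vertex vectors. -/
lemma transfer_dual (h : IsFrame e P) (h' : IsFrame e' P') (j : Fin 6) :
    h.transfer h' (h.dual j) = h'.dual j :=
  h'.ext_of_mink fun i => by rw [mink_transfer, mink_dual, mink_dual]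

lemma transfer_mem_hypSet (h : IsFrame e P) (h' : IsFrame e' P')
    (hg : ∀ i j, mink 5 (e i) (e j) = mink 5 (e' i) (e' j))
    {x : EuclideanSpace ℝ (Fin (5 + 1))} (hx : x ∈ hypSet 5) : h.transfer h' x ∈ hypSet 5 := by
  have hx1 : mink 5 (h.transfer h' x) (h.transfer h' x) = -1 := by
    rw [h.mink_transfer_transfer h' hg, hx.1]
  refine ⟨hx1, ?_⟩
  by_contra! h0
  have hneg : -(h.transfer h' x) ∈ Fut 5 := by
    refine ⟨by rw [mink_neg_left, mink_neg_right, hx1]; norm_num, by simpa using h0⟩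
  have h2 : mink 5 (h.dual 0) x < 0 := by
    rw [mink_comm]
    exact fut_timelike_mink_neg (by rw [hx.1]; norm_num) (hypSet_fut hx) (h.dual_fut 0)
      (h.dual_ne_zero 0)
  have h3 := fut_mink_nonpos (h'.dual_fut 0) hneg
  rw [mink_neg_right, ← h.transfer_dual h', h.mink_transfer_transfer h' hg] at h3
  linarith

/-- Simplices with the same Gram matrix are congruent. -/
lemma congr (h : IsFrame e P) (h' : IsFrame e' P')
    (hg : ∀ i j, mink 5 (e i) (e j) = mink 5 (e' i) (e' j)) : hCongr 5 P P' := by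
  have hg' : ∀ i j, mink 5 (e' i) (e' j) = mink 5 (e i) (e j) := fun i j => (hg i j).symm
  have hl : Function.LeftInverse
      (fun x : ↥(hypSet 5) => (⟨h'.transfer h x.1, h'.transfer_mem_hypSet h hg' x.2⟩ : ↥(hypSet 5)))
      (fun x : ↥(hypSet 5) => (⟨h.transfer h' x.1, h.transfer_mem_hypSet h' hg x.2⟩ : ↥(hypSet 5))) :=
    fun x => Subtype.ext (h.transfer_transfer h' x.1)
  have hr : Function.RightInverse
      (fun x : ↥(hypSet 5) => (⟨h'.transfer h x.1, h'.transfer_mem_hypSet h hg' x.2⟩ : ↥(hypSet 5)))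
      (fun x : ↥(hypSet 5) => (⟨h.transfer h' x.1, h.transfer_mem_hypSet h' hg x.2⟩ : ↥(hypSet 5))) :=
    fun x => Subtype.ext (h'.transfer_transfer h x.1)
  refine ⟨_, ⟨⟨hl.injective, hr.surjective⟩, fun x y => h.mink_transfer_transfer h' hg _ _⟩, ?_⟩
  apply subset_antisymm
  · rintro _ ⟨x, hx, rfl⟩
    exact h'.mem.2 fun i => by simpa only [mink_transfer] using h.mem.1 hx i
  · intro y hy
    refine ⟨_, h.mem.2 fun i => ?_, hr y⟩
    simpa only [mink_transfer] using h'.mem.1 hy i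

end IsFrame

end

section

lemma hVol_mono {n : ℕ} {S T : Set ↥(hypSet n)} (h : S ⊆ T) : hVol n S ≤ hVol n T :=
  lintegral_mono_set (image_mono h)

/-! ## Reflections -/

lemma hReflect_mink {n : ℕ} {v : EuclideanSpace ℝ (Fin (n + 1))} (hv : mink n v v = 1)
    (x y : EuclideanSpace ℝ (Fin (n + 1))) :
    mink n (hReflect n v x) (hReflect n v y) = mink n x y := by
  simp only [hReflect, mink_sub_left, mink_sub_right, mink_smul_left, mink_smul_right, hv,
    mink_comm x v]
  ring

lemma hReflect_hReflect {n : ℕ} {v : EuclideanSpace ℝ (Fin (n + 1))} (hv : mink n v v = 1)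
    (x : EuclideanSpace ℝ (Fin (n + 1))) : hReflect n v (hReflect n v x) = x := by
  simp only [hReflect, mink_sub_right, mink_smul_right, hv]
  module

lemma IsFrame.reflect_eq {f f' : Fin 6 → EuclideanSpace ℝ (Fin (5 + 1))} {T T' : Set ↥(hypSet 5)}
    (h : IsFrame f T) (h' : IsFrame f' T') {v : EuclideanSpace ℝ (Fin (5 + 1))}
    (hv : mink 5 v v = 1) (hf : ∀ k, f' k = hReflect 5 v (f k)) :
    T' = {y | ∃ x ∈ T, (y : EuclideanSpace ℝ (Fin (5 + 1))) = hReflect 5 v x.val} := by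
  ext y
  have key : ∀ k (x : EuclideanSpace ℝ (Fin (5 + 1))),
      mink 5 (f' k) (hReflect 5 v x) = mink 5 (f k) x := fun k x => by
    rw [hf, hReflect_mink hv]
  constructor
  · rintro ⟨y, hy, rfl⟩
    have h1 : ∀ k, mink 5 (f k) (hReflect 5 v y.val) ≤ 0 := fun k => by
      rw [← key, hReflect_hReflect hv]
      exact h'.mem.1 hy k
    have h2 : mink 5 (hReflect 5 v y.val) (hReflect 5 v y.val) = -1 := by
      rw [hReflect_mink hv, y.2.1]
    refine ⟨⟨hReflect 5 v y.val, h2, fut_pos (h.fut _ h1) fun h0 => ?_⟩, h.mem.2 h1,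
      (hReflect_hReflect hv _).symm⟩
    rw [h0] at h2
    simp at h2
  · rintro ⟨x, hx, rfl⟩
    have h1 : ∀ k, mink 5 (f' k) (hReflect 5 v x.val) ≤ 0 := fun k => by
      rw [key]; exact h.mem.1 hx k
    have h2 : mink 5 (hReflect 5 v x.val) (hReflect 5 v x.val) = -1 := by
      rw [hReflect_mink hv, x.2.1]
    refine ⟨⟨hReflect 5 v x.val, h2, fut_pos (h'.fut _ h1) fun h0 => ?_⟩, h'.mem.2 h1, rfl⟩
    rw [h0] at h2
    simp at h2

/-! ## The tiles of the star-shaped simplex -/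

/-- The normals of the tiles. -/
def tileN (e : Fin 6 → EuclideanSpace ℝ (Fin (5 + 1))) (τ : Fin 20) (i : Fin 6) :
    EuclideanSpace ℝ (Fin (5 + 1)) := ∑ j, ((tileMat τ i j : ℝ) / 2) • e j

/-- The tiles. -/
def tile (e : Fin 6 → EuclideanSpace ℝ (Fin (5 + 1))) (τ : Fin 20) : Set ↥(hypSet 5) :=
  ⋂ i, hHalf 5 (tileN e τ i)

lemma baseGram_symm : ∀ i j, baseGram i j = baseGram j i := by decide

lemma baseGram_diag : ∀ i, baseGram i i = 2 := by decide

lemma baseGram_off : ∀ i j, i ≠ j → baseGram i j = 0 ∨ baseGram i j = -1 := by decide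

section Star

variable {e : Fin 6 → EuclideanSpace ℝ (Fin (5 + 1))} {P : Set ↥(hypSet 5)}

lemma mink_tileN (τ : Fin 20) (i : Fin 6) (x : EuclideanSpace ℝ (Fin (5 + 1))) :
    mink 5 (tileN e τ i) x = ∑ j, (tileMat τ i j : ℝ) / 2 * mink 5 (e j) x := by
  simp only [tileN, mink_sum_left, mink_smul_left]

lemma tileN_gram (hG : ∀ i j, 2 * mink 5 (e i) (e j) = starGram i j) (τ : Fin 20) (i k : Fin 6) :
    2 * mink 5 (tileN e τ i) (tileN e τ k) = baseGram i k := by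
  have h1 : 4 * (2 * mink 5 (tileN e τ i) (tileN e τ k)) =
      ∑ a, ∑ b, (tileMat τ i a : ℝ) * tileMat τ k b * starGram a b := by
    rw [mink_tileN]
    simp only [tileN, mink_sum_right, mink_smul_right, Finset.mul_sum, ← hG]
    exact Finset.sum_congr rfl fun a _ => Finset.sum_congr rfl fun b _ => by ring
  have h2 := tile_gram τ i k
  have h3 : ∑ a, ∑ b, (tileMat τ i a : ℝ) * tileMat τ k b * starGram a b = 4 * baseGram i k := by
    exact_mod_cast h2
  linarith

lemma normal_eq_sum_tileN (τ : Fin 20) (i : Fin 6) :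
    e i = ∑ a, (tileGen τ i a : ℝ) • tileN e τ a := by
  have h : ∀ k, ∑ a, (tileGen τ i a : ℝ) * ((tileMat τ a k : ℝ) / 2) = if i = k then 1 else 0 := by
    intro k
    have h1 := tile_inv' τ i k
    have h2 : ∑ a, (tileGen τ i a : ℝ) * tileMat τ a k = if i = k then 2 else 0 := by
      exact_mod_cast h1
    simp only [mul_div_assoc', ← Finset.sum_div, h2]
    split_ifs <;> norm_num
  simp only [tileN, Finset.smul_sum, smul_smul]
  rw [Finset.sum_comm]
  simp only [← Finset.sum_smul, h]
  simp

lemma mink_normal (τ : Fin 20) (i : Fin 6) (x : EuclideanSpace ℝ (Fin (5 + 1))) :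
    mink 5 (e i) x = ∑ a, (tileGen τ i a : ℝ) * mink 5 (tileN e τ a) x := by
  conv_lhs => rw [normal_eq_sum_tileN (e := e) τ i]
  simp only [mink_sum_left, mink_smul_left]

lemma mink_normal_nonpos (τ : Fin 20) {x : EuclideanSpace ℝ (Fin (5 + 1))}
    (hx : ∀ a, mink 5 (tileN e τ a) x ≤ 0) (i : Fin 6) : mink 5 (e i) x ≤ 0 := by
  rw [mink_normal τ]
  exact Finset.sum_nonpos fun a _ => mul_nonpos_of_nonneg_of_nonpos
    (by exact_mod_cast tileGen_nonneg τ i a) (hx a)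

lemma IsFrame.tile (h : IsFrame e P) (hG : ∀ i j, 2 * mink 5 (e i) (e j) = starGram i j)
    (τ : Fin 20) : IsFrame (tileN e τ) (tile e τ) where
  unit i := by
    have := tileN_gram hG τ i i
    rw [baseGram_diag] at this
    norm_num at this
    exact this
  eq := rfl
  fut x hx := h.fut x (mink_normal_nonpos τ hx)

lemma tile_subset (h : IsFrame e P) (hG : ∀ i j, 2 * mink 5 (e i) (e j) = starGram i j)
    (τ : Fin 20) : tile e τ ⊆ P := fun _ hx =>
  h.mem.2 (mink_normal_nonpos τ ((h.tile hG τ).mem.1 hx))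

lemma tileN_eq_of_row {τ : Fin 20} {i j : Fin 6}
    (hj : ∀ k : Fin 6, tileMat τ i k = if k = j then 2 else 0) : tileN e τ i = e j := by
  have h : ∀ k : Fin 6, ((tileMat τ i k : ℤ) : ℝ) / 2 = if k = j then 1 else 0 := fun k => by
    rw [hj k]; split_ifs <;> norm_num
  simp [tileN, h]

lemma tileN_eq_reflect {τ σ : Fin 20} {i : Fin 6}
    (hσ : ∀ k l : Fin 6, tileMat σ k l = tileMat τ k l - baseGram k i * tileMat τ i l) (k : Fin 6) :
    tileN e σ k = tileN e τ k - (baseGram k i : ℝ) • tileN e τ i := by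
  simp only [tileN, Finset.smul_sum, ← Finset.sum_sub_distrib, smul_smul, ← sub_smul, hσ]
  refine Finset.sum_congr rfl fun l _ => ?_
  congr 1
  push_cast
  ring

/-- The height function which orders the tiles. -/
def height (e : Fin 6 → EuclideanSpace ℝ (Fin (5 + 1))) (τ : Fin 20)
    (x : EuclideanSpace ℝ (Fin (5 + 1))) : ℝ :=
  ∑ i, (tileCentre i : ℝ) * mink 5 (tileN e τ i) x

lemma subset_iUnion_tile (h : IsFrame e P) (hG : ∀ i j, 2 * mink 5 (e i) (e j) = starGram i j) :
    P ⊆ ⋃ τ, tile e τ := by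
  intro x hx
  obtain ⟨τ, hτ⟩ := Finite.exists_max fun τ => height e τ x.val
  refine mem_iUnion.2 ⟨τ, (h.tile hG τ).mem.2 fun i => ?_⟩
  by_contra! hi
  rcases tile_neighbour τ i with ⟨j, hj⟩ | ⟨σ, hσ⟩
  · rw [tileN_eq_of_row hj] at hi
    exact absurd (h.mem.1 hx j) (not_le.2 hi)
  · have h1 : height e σ x.val = height e τ x.val + 2 * mink 5 (tileN e τ i) x.val := by
      have h2 : ∑ k, (baseGram i k : ℝ) * tileCentre k = -2 := by
        exact_mod_cast baseGram_centre i
      have h3 : height e σ x.val = height e τ x.val -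
          (∑ k, (baseGram i k : ℝ) * tileCentre k) * mink 5 (tileN e τ i) x.val := by
        simp only [height, tileN_eq_reflect hσ, mink_sub_left, mink_smul_left, Finset.sum_mul,
          ← Finset.sum_sub_distrib]
        refine Finset.sum_congr rfl fun k _ => ?_
        rw [baseGram_symm i k]
        ring
      rw [h3, h2]; ring
    linarith [hτ σ]

lemma height_lt {τ σ : Fin 20} (hne : τ ≠ σ) {x : EuclideanSpace ℝ (Fin (5 + 1))}
    (hx : ∀ i, mink 5 (tileN e τ i) x < 0) : height e σ x < height e τ x := by
  obtain ⟨h1, k₀, h2⟩ := tile_dominance τ σ hne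
  set D : Fin 6 → ℤ := fun k => ∑ a, (∑ i, tileCentre i * tileMat σ i a) * tileGen τ a k with hD
  have h3 : 2 * height e σ x = ∑ k, (D k : ℝ) * mink 5 (tileN e τ k) x := by
    have : ∀ k, (D k : ℝ) = ∑ a, (∑ i, (tileCentre i : ℝ) * tileMat σ i a) * tileGen τ a k := by
      intro k; simp only [hD]; push_cast; rfl
    simp only [height, mink_tileN (τ := σ), this, mink_normal (e := e) τ, Finset.mul_sum,
      Finset.sum_mul]
    rw [Finset.sum_comm' (t' := Finset.univ) (s' := fun _ => Finset.univ) (by simp)]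
    conv_rhs => rw [Finset.sum_comm]
    refine Finset.sum_congr rfl fun a _ => ?_
    rw [Finset.sum_comm]
    refine Finset.sum_congr rfl fun k _ => Finset.sum_congr rfl fun i _ => by ring
  have h4 : ∑ k, (D k : ℝ) * mink 5 (tileN e τ k) x <
      ∑ k, (2 * tileCentre k : ℝ) * mink 5 (tileN e τ k) x := by
    refine Finset.sum_lt_sum (fun k _ => ?_) ⟨k₀, Finset.mem_univ _, ?_⟩
    · have : (2 * tileCentre k : ℝ) ≤ D k := by exact_mod_cast h1 k
      exact mul_le_mul_of_nonpos_right this (hx k).le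
    · have : (2 * tileCentre k₀ : ℝ) < D k₀ := by exact_mod_cast h2
      exact mul_lt_mul_of_neg_right this (hx k₀)
  have h5 : ∑ k, (2 * tileCentre k : ℝ) * mink 5 (tileN e τ k) x = 2 * height e τ x := by
    simp only [height, Finset.mul_sum, mul_assoc]
  linarith

lemma interior_tile_disjoint (h : IsFrame e P)
    (hG : ∀ i j, 2 * mink 5 (e i) (e j) = starGram i j) {τ σ : Fin 20} (hne : τ ≠ σ) :
    interior (tile e τ) ∩ interior (tile e σ) = ∅ := by
  rw [(h.tile hG τ).interior_eq, (h.tile hG σ).interior_eq]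
  ext x
  simp only [mem_inter_iff, mem_ofPred_eq, mem_empty_iff_false, iff_false, not_and]
  exact fun h1 h2 => lt_asymm (height_lt hne h1) (height_lt hne.symm h2)

lemma tile_injective (h : IsFrame e P) (hG : ∀ i j, 2 * mink 5 (e i) (e j) = starGram i j) :
    Function.Injective (tile e) := by
  intro τ σ hτσ
  by_contra hne
  have h1 := interior_tile_disjoint h hG hne
  rw [← hτσ, inter_self] at h1
  exact (h.tile hG τ).interior_nonempty.ne_empty h1

lemma tile_isCoxPoly (h : IsFrame e P) (hG : ∀ i j, 2 * mink 5 (e i) (e j) = starGram i j)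
    (hfin : hVol 5 P < ⊤) (τ : Fin 20) : hIsCoxPoly 5 (tile e τ) := by
  refine ⟨6, tileN e τ, (h.tile hG τ).unit, rfl, (h.tile hG τ).interior_nonempty,
    (hVol_mono (tile_subset h hG τ)).trans_lt hfin, fun i j hij _ => ?_⟩
  have hij' : i ≠ j := fun h => hij (by rw [h])
  have h1 := tileN_gram hG τ i j
  rcases baseGram_off i j hij' with h2 | h2
  · refine ⟨2, le_rfl, ?_⟩
    rw [h2] at h1
    push_cast at h1 ⊢
    rw [Real.cos_pi_div_two]; linarith
  · refine ⟨3, by norm_num, ?_⟩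
    rw [h2] at h1
    push_cast at h1 ⊢
    rw [Real.cos_pi_div_three]; linarith

lemma mink_tileN_dual (h : IsFrame e P) (τ : Fin 20) (i k : Fin 6) :
    mink 5 (tileN e τ i) (h.dual k) = -(tileMat τ i k : ℝ) / 2 := by
  rw [mink_tileN]
  simp only [h.mink_dual, mul_ite, mul_neg, mul_one, mul_zero, Finset.sum_ite_eq',
    Finset.mem_univ, if_true]
  ring

lemma tile_reflect (h : IsFrame e P) (hG : ∀ i j, 2 * mink 5 (e i) (e j) = starGram i j)
    {τ σ : Fin 20} (hne : τ ≠ σ) {S : Set ↥(hypSet 5)} (hS : hIsFacet 5 (tile e τ) S)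
    (hS' : hIsFacet 5 (tile e σ) S) : ∃ v, mink 5 v v = 1 ∧ S ⊆ hWall 5 v ∧
      tile e σ = {y | ∃ x ∈ tile e τ, (y : EuclideanSpace ℝ (Fin (5 + 1))) = hReflect 5 v x.val} := by
  have hτ := h.tile hG τ
  have hσ := h.tile hG σ
  obtain ⟨i, hi⟩ := hτ.facets hS
  obtain ⟨j, hj⟩ := hσ.facets hS'
  have hw := hτ.eq_or_neg_of_facet (i := i) (hσ.unit j)
    (by rw [← hi, hj]; exact inter_subset_right)
  have hrows : (∀ k : Fin 6, tileMat τ i k = tileMat σ j k) ∨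
      (∀ k : Fin 6, tileMat τ i k = -tileMat σ j k) := by
    refine hw.imp (fun hw k => ?_) fun hw k => ?_
    · have h1 := mink_tileN_dual h σ j k
      rw [hw, mink_tileN_dual h τ i k] at h1
      have : (tileMat τ i k : ℝ) = tileMat σ j k := by linarith
      exact_mod_cast this
    · have h1 := mink_tileN_dual h σ j k
      rw [hw, mink_neg_left, mink_tileN_dual h τ i k] at h1
      have : (tileMat τ i k : ℝ) = -tileMat σ j k := by linarith
      exact_mod_cast this
  rcases tile_facets τ σ hne i j hrows with h1 | ⟨k, hki, l, hl⟩
  · refine ⟨tileN e τ i, hτ.unit i, by rw [hi]; exact inter_subset_right,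
      hτ.reflect_eq hσ (hτ.unit i) fun k => ?_⟩
    rw [tileN_eq_reflect h1 k, hReflect, tileN_gram hG, baseGram_symm]
  · exfalso
    have h1 : hτ.dual k ∈ closure (hCone 5 S) := by
      rw [hi, hτ.closure_cone_facet]
      refine ⟨fun a => ?_, by rw [hτ.mink_dual, if_neg hki.symm]⟩
      rw [hτ.mink_dual]; split_ifs <;> norm_num
    have h2 : hτ.dual k ∈ closure (hCone 5 (tile e σ)) := by
      refine closure_mono ?_ h1
      rintro _ ⟨x, hx, t, ht, rfl⟩
      rw [hj] at hx
      exact ⟨x, hx.1, t, ht, rfl⟩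
    rw [hσ.closure_cone] at h2
    have h3 := h2 l
    rw [mink_tileN] at h3
    have h4 : ∀ a, mink 5 (e a) (hτ.dual k) = -(tileGen τ a k : ℝ) := fun a => by
      rw [mink_normal τ]
      simp [hτ.mink_dual]
    simp only [h4] at h3
    have h5 : (∑ a, (tileMat σ l a : ℝ) * tileGen τ a k) < 0 := by exact_mod_cast hl
    have h6 : ∑ a, (tileMat σ l a : ℝ) / 2 * -(tileGen τ a k : ℝ) =
        -(1 / 2) * ∑ a, (tileMat σ l a : ℝ) * tileGen τ a k := by
      rw [Finset.mul_sum]; exact Finset.sum_congr rfl fun a _ => by ring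
    linarith

lemma tile_secondType (h : IsFrame e P) (hG : ∀ i j, 2 * mink 5 (e i) (e j) = starGram i j) :
    hSecondType 5 P (Set.range (tile e)) := by
  rintro α β hα hβ - - ⟨v, ⟨hv1, ⟨_, ⟨τ, rfl⟩, S, hS, hSv⟩, hno⟩, hαβ⟩
  obtain ⟨a, rfl⟩ := h.facets hα
  obtain ⟨b, rfl⟩ := h.facets hβ
  obtain ⟨i, rfl⟩ := (h.tile hG τ).facets hS
  have h1 := h.dual_of_face (w := v) (I := {a, b}) (IsFrame.exists_pair_not_mem_pair a b)
    fun x hx hx' => hαβ ⟨⟨hx, hx' a (by simp)⟩, ⟨hx, hx' b (by simp)⟩⟩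
  have h2 := (h.tile hG τ).eq_or_neg_of_facet hv1 hSv
  obtain ⟨j, hj⟩ := tile_support τ i a b fun k ha hb => by
    have h3 := h1 k (by simp [ha, hb])
    have h4 := mink_tileN_dual h τ i k
    have h5 : mink 5 (tileN e τ i) (h.dual k) = 0 := by
      rcases h2 with h2 | h2
      · rw [← h2, h3]
      · rw [h2, mink_neg_left] at h3; linarith
    rw [h5] at h4
    have h6 : (tileMat τ i k : ℝ) = 0 := by linarith
    exact_mod_cast h6
  rw [tileN_eq_of_row hj] at h2
  refine hno ⟨_, h.isFacet j, ?_⟩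
  rcases h2 with rfl | rfl
  · exact inter_subset_right
  · rw [IsFrame.hWall_neg]; exact inter_subset_right

lemma tilesAt_dual (h : IsFrame e P) (hG : ∀ i j, 2 * mink 5 (e i) (e j) = starGram i j)
    (k : Fin 6) {s : ℝ} (hs : 0 < s) :
    hTilesAt 5 (Set.range (tile e)) (s • h.dual k) =
      (Finset.univ.filter fun τ => ∀ i, 0 ≤ tileMat τ i k).card := by
  have h1 : {T | T ∈ Set.range (tile e) ∧ s • h.dual k ∈ closure (hCone 5 T)} =
      tile e '' ((Finset.univ.filter fun τ => ∀ i, 0 ≤ tileMat τ i k : Finset (Fin 20)) :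
        Set (Fin 20)) := by
    have key : ∀ τ, s • h.dual k ∈ closure (hCone 5 (tile e τ)) ↔ ∀ i, 0 ≤ tileMat τ i k := by
      intro τ
      rw [(h.tile hG τ).closure_cone]
      refine forall_congr' fun i => ?_
      rw [mink_smul_right, mink_tileN_dual]
      constructor
      · intro h1
        have : -(tileMat τ i k : ℝ) / 2 ≤ 0 := by nlinarith
        have : (0 : ℝ) ≤ tileMat τ i k := by linarith
        exact_mod_cast this
      · intro h1
        have : (0 : ℝ) ≤ tileMat τ i k := by exact_mod_cast h1
        nlinarith
    ext T
    simp only [mem_ofPred_eq, mem_image, Finset.coe_filter, Finset.mem_univ, true_and]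
    constructor
    · rintro ⟨⟨τ, rfl⟩, hT⟩
      exact ⟨τ, (key τ).1 hT, rfl⟩
    · rintro ⟨τ, hτ, rfl⟩
      exact ⟨⟨τ, rfl⟩, (key τ).2 hτ⟩
  rw [hTilesAt, h1, ncard_image_of_injective _ (tile_injective h hG), ncard_coe_finset]

lemma star_dual_zero (h : IsFrame e P) (hG : ∀ i j, 2 * mink 5 (e i) (e j) = starGram i j) :
    mink 5 (h.dual 0) (h.dual 0) = -4 := by
  have h1 : h.dual 0 = (4 : ℝ) • e 0 + (2 : ℝ) • e 1 + (2 : ℝ) • e 2 + (2 : ℝ) • e 3 +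
      (2 : ℝ) • e 4 + (2 : ℝ) • e 5 := by
    refine h.ext_of_mink fun i => ?_
    have hG' : ∀ i j, mink 5 (e i) (e j) = starGram i j / 2 := fun i j => by rw [← hG]; ring
    simp only [mink_add_right, mink_smul_right, hG', h.mink_dual]
    fin_cases i <;> simp [starGram] <;> norm_num
  conv_lhs => arg 2; rw [h1]
  simp only [mink_add_left, mink_smul_left, h.mink_dual]
  simp

lemma star_dual_five (h : IsFrame e P) (hG : ∀ i j, 2 * mink 5 (e i) (e j) = starGram i j) :
    mink 5 (h.dual 5) (h.dual 5) = 0 := by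
  have h1 : h.dual 5 = (2 : ℝ) • e 0 + e 1 + e 2 + e 3 + e 4 := by
    refine h.ext_of_mink fun i => ?_
    have hG' : ∀ i j, mink 5 (e i) (e j) = starGram i j / 2 := fun i j => by rw [← hG]; ring
    simp only [mink_add_right, mink_smul_right, hG', h.mink_dual]
    fin_cases i <;> simp [starGram] <;> norm_num
  conv_lhs => arg 2; rw [h1]
  simp only [mink_add_left, mink_smul_left, h.mink_dual]
  simp

lemma star_link (i j : Fin 5) (hij : i ≠ j) :
    (cmD4t i j = 2 ∧ starGram i.castSucc j.castSucc = 0) ∨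
      (cmD4t i j = 3 ∧ starGram i.castSucc j.castSucc = -1) := by
  fin_cases i <;> fin_cases j <;> first | exact absurd rfl hij | decide

lemma star_idealLink (h : IsFrame e P) (hG : ∀ i j, 2 * mink 5 (e i) (e j) = starGram i j)
    {s : ℝ} (hs : 0 < s) : hIdealLink 5 P (s • h.dual 5) cmD4t := by
  refine ⟨fun i => e i.castSucc, fun i => h.unit _, fun i => ?_, fun i j hij => ?_,
    fun i j hij hw => hij (Fin.castSucc_injective _ (h.wall_injective hw)), ?_⟩
  · rw [mink_smul_right, h.mink_dual, if_neg (show i.castSucc ≠ 5 from (Fin.castSucc_lt_last i).ne), mul_zero]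
  · have h1 := hG i.castSucc j.castSucc
    rcases star_link i j hij with ⟨h2, h3⟩ | ⟨h2, h3⟩
    · rw [h2]; rw [h3] at h1; push_cast at h1 ⊢
      rw [Real.cos_pi_div_two]; linarith
    · rw [h2]; rw [h3] at h1; push_cast at h1 ⊢
      rw [Real.cos_pi_div_three]; linarith
  · ext S
    simp only [mem_ofPred_eq, mem_range]
    constructor
    · rintro ⟨hS, hw⟩
      obtain ⟨i, rfl⟩ := h.facets hS
      rw [h.closure_cone_facet] at hw
      have h1 := hw.2
      rw [mink_smul_right, h.mink_dual] at h1
      refine Fin.lastCases (fun h1 => ?_) (fun i _ => ⟨i, rfl⟩) i h1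
      simp [show Fin.last 5 = 5 from rfl] at h1
      exact absurd h1 hs.ne'
    · rintro ⟨i, rfl⟩
      refine ⟨h.isFacet _, ?_⟩
      rw [h.closure_cone_facet]
      refine ⟨fun j => ?_, ?_⟩
      · rw [mink_smul_right, h.mink_dual]
        split_ifs <;> nlinarith
      · rw [mink_smul_right, h.mink_dual, if_neg (show i.castSucc ≠ 5 from (Fin.castSucc_lt_last i).ne), mul_zero]

/-- The simplex whose diagram is a star with five leaves is decomposed into twenty copies of the
simplex with Gram matrix `baseGram / 2`. -/
theorem star_decomposition {b : Fin 6 → EuclideanSpace ℝ (Fin (5 + 1))} {F : Set ↥(hypSet 5)}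
    (h : IsFrame e P) (hG : ∀ i j, 2 * mink 5 (e i) (e j) = starGram i j) (hfin : hVol 5 P < ⊤)
    (hF : IsFrame b F) (hB : ∀ i j, 2 * mink 5 (b i) (b j) = baseGram i j) :
    ∃ 𝒯, hSTDecomp 5 P F 𝒯 ∧ 𝒯.ncard = 20 ∧
      ∃ w ∈ hIdealVerts 5 P, hIdealLink 5 P w cmD4t ∧ hTilesAt 5 𝒯 w = 16 ∧
        ∀ w' ∈ hIdealVerts 5 P, w' ≠ w → hTilesAt 5 𝒯 w' = 1 := by
  have hs : ∀ k, 0 < (h.dual k 0)⁻¹ := fun k =>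
    inv_pos.2 (fut_pos (h.dual_fut k) (h.dual_ne_zero k))
  refine ⟨Set.range (tile e), ⟨⟨finite_range _, range_nonempty _, ?_, ?_, ?_, ?_⟩, ?_, ?_⟩, ?_,
    (h.dual 5 0)⁻¹ • h.dual 5, ?_, star_idealLink h hG (hs 5), ?_, ?_⟩
  · rintro _ ⟨τ, rfl⟩
    exact tile_isCoxPoly h hG hfin τ
  · rw [sUnion_range]
    exact subset_antisymm (iUnion_subset fun τ => tile_subset h hG τ) (subset_iUnion_tile h hG)
  · rintro _ ⟨τ, rfl⟩ _ ⟨σ, rfl⟩ hne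
    exact interior_tile_disjoint h hG fun h => hne (by rw [h])
  · rintro _ ⟨τ, rfl⟩ _ ⟨σ, rfl⟩ hne S hS hS'
    exact tile_reflect h hG (fun h => hne (by rw [h])) hS hS'
  · rintro _ ⟨τ, rfl⟩
    refine hF.congr (h.tile hG τ) fun i j => ?_
    linarith [hB i j, tileN_gram hG τ i j]
  · exact tile_secondType h hG
  · rw [← image_univ, ncard_image_of_injective _ (tile_injective h hG), ncard_univ, Nat.card_fin]
  · rw [h.idealVerts]
    exact ⟨5, star_dual_five h hG, rfl⟩
  · rw [tilesAt_dual h hG 5 (hs 5), tile_count_special]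
  · intro w' hw' hne
    rw [h.idealVerts] at hw'
    obtain ⟨k, hk, rfl⟩ := hw'
    rw [tilesAt_dual h hG k (hs k)]
    refine tile_count_other k ?_ ?_
    · rintro rfl
      rw [star_dual_zero h hG] at hk
      norm_num at hk
    · rintro rfl
      exact hne rfl

end Star

end

section

section Volume

open scoped Pointwise

variable {n : ℕ}

/-- The part of a cone lying under the future hyperboloid sheet. -/
def coneCap (n : ℕ) (D : Set (EuclideanSpace ℝ (Fin (n + 1)))) :
    Set (EuclideanSpace ℝ (Fin (n + 1))) :=
  {x | x ∈ D ∧ 0 < x 0 ∧ mink n x x < 0 ∧ -1 ≤ mink n x x}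

lemma mink_cons (r : ℝ) (z : Fin n → ℝ) :
    mink n (WithLp.toLp 2 (Fin.cons r z)) (WithLp.toLp 2 (Fin.cons r z)) =
      -r ^ 2 + ∑ i, z i ^ 2 := by
  simp [mink, sq]

lemma volume_eq_lintegral_slices {A : Set (EuclideanSpace ℝ (Fin (n + 1)))}
    (hA : MeasurableSet A) :
    volume A = ∫⁻ r : ℝ, volume {z : Fin n → ℝ | WithLp.toLp 2 (Fin.cons r z) ∈ A} := by
  have h1 := (EuclideanSpace.volume_preserving_symm_measurableEquiv_toLp
    (Fin (n + 1))).symm.measure_preimage_equiv A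
  have h2 := (volume_preserving_piFinSuccAbove (fun _ : Fin (n + 1) => ℝ)
    0).symm.measure_preimage_equiv
      ((MeasurableEquiv.toLp 2 (Fin (n + 1) → ℝ)) ⁻¹' A)
  have hm : MeasurableSet ((MeasurableEquiv.piFinSuccAbove (fun _ : Fin (n + 1) => ℝ) 0).symm ⁻¹'
      ((MeasurableEquiv.toLp 2 (Fin (n + 1) → ℝ)) ⁻¹' A)) :=
    (MeasurableEquiv.measurable _) ((MeasurableEquiv.measurable _) hA)
  rw [← h1]
  refine h2.symm.trans ?_
  rw [Measure.volume_eq_prod, Measure.prod_apply hm]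
  refine lintegral_congr fun r => congrArg _ (Set.ext fun z => ?_)
  simp [Fin.consEquiv]

lemma measurableSet_coneCap {D : Set (EuclideanSpace ℝ (Fin (n + 1)))} (hD : MeasurableSet D) :
    MeasurableSet (coneCap n D) := by
  have h0 : Continuous fun x : EuclideanSpace ℝ (Fin (n + 1)) => x 0 := by fun_prop
  have h1 : Continuous fun x : EuclideanSpace ℝ (Fin (n + 1)) => mink n x x := by fun_prop
  exact hD.inter ((isOpen_lt continuous_const h0).measurableSet.inter
    ((isOpen_lt h1 continuous_const).measurableSet.inter
      (isClosed_le continuous_const h1).measurableSet))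

lemma klein_image {D : Set (EuclideanSpace ℝ (Fin (n + 1)))}
    (hc : ∀ x, ∀ t : ℝ, 0 < t → x ∈ D → t • x ∈ D) :
    klein n '' {x | x.val ∈ D} =
      {y | WithLp.toLp 2 (Fin.cons 1 y) ∈ D ∧ ∑ i, y i ^ 2 < 1} := by
  ext y
  constructor
  · rintro ⟨x, hx, rfl⟩
    have h0 := x.2.2
    have hxe : WithLp.toLp 2 (Fin.cons 1 (klein n x)) = (x.val 0)⁻¹ • x.val := by
      ext i
      refine Fin.cases ?_ (fun i => ?_) i
      · simp [h0.ne']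
      · simp [klein, div_eq_inv_mul]
    have hm := mink_cons 1 (klein n x)
    refine ⟨hxe ▸ hc _ _ (inv_pos.2 h0) hx, ?_⟩
    rw [hxe, mink_smul_left, mink_smul_right, x.2.1] at hm
    have : 0 < (x.val 0)⁻¹ * (x.val 0)⁻¹ := by positivity
    linarith
  · rintro ⟨hy, hlt⟩
    have hm := mink_cons 1 y
    have hneg : mink n (WithLp.toLp 2 (Fin.cons 1 y)) (WithLp.toLp 2 (Fin.cons 1 y)) < 0 := by
      rw [hm]; linarith
    obtain ⟨p, t, ht, hp⟩ := exists_hyp_smul (n := n) (x := WithLp.toLp 2 (Fin.cons 1 y))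
      ⟨hneg.le, by simp⟩ hneg
    refine ⟨p, ?_, ?_⟩
    · simp only [mem_ofPred_eq, hp]; exact hc _ _ ht hy
    · funext i
      simp [klein, hp, ht.ne']

lemma lintegral_pow_Ioc (n : ℕ) {R : ℝ} (hR : 0 ≤ R) :
    ∫⁻ r in Ioc 0 R, ENNReal.ofReal (r ^ n) = ENNReal.ofReal (R ^ (n + 1) / (n + 1)) := by
  rw [← ofReal_integral_eq_lintegral_ofReal]
  · rw [← intervalIntegral.integral_of_le hR, integral_pow]; simp
  · exact (continuous_pow n).integrableOn_Ioc
  · filter_upwards [ae_restrict_mem measurableSet_Ioc] with r hr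
    exact pow_nonneg hr.1.le n

theorem hVol_eq_volume_coneCap {D : Set (EuclideanSpace ℝ (Fin (n + 1)))}
    (hD : MeasurableSet D) (hc : ∀ x, ∀ t : ℝ, 0 < t → x ∈ D → t • x ∈ D) :
    hVol n {x | x.val ∈ D} = (n + 1 : ℝ≥0∞) * volume (coneCap n D) := by
  set K : Set (Fin n → ℝ) := {y | WithLp.toLp 2 (Fin.cons 1 y) ∈ D ∧ ∑ i, y i ^ 2 < 1} with hKdef
  have hcont : Continuous fun y : Fin n → ℝ =>
      (WithLp.toLp 2 (Fin.cons 1 y) : EuclideanSpace ℝ (Fin (n + 1))) := by fun_prop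
  have hsq : Continuous fun y : Fin n → ℝ => ∑ i, y i ^ 2 := by fun_prop
  have hK : MeasurableSet K := (hcont.measurable hD).inter
    (isOpen_lt hsq continuous_const).measurableSet
  have hslice : ∀ r : ℝ, volume {z : Fin n → ℝ | WithLp.toLp 2 (Fin.cons r z) ∈ coneCap n D} =
      ∫⁻ y in K, (Ioi (0 : ℝ) ∩ {r | r ^ 2 * (1 - ∑ i, y i ^ 2) ≤ 1}).indicator
        (fun r => ENNReal.ofReal (r ^ n)) r := by
    intro r
    rcases le_or_gt r 0 with hr | hr
    · have : {z : Fin n → ℝ | WithLp.toLp 2 (Fin.cons r z) ∈ coneCap n D} = ∅ := by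
        ext z
        simp only [coneCap, mem_ofPred_eq, mem_empty_iff_false, iff_false]
        rintro ⟨-, h, -⟩
        simp at h
        linarith
      rw [this]
      simp [hr.not_gt]
    · have hset : {z : Fin n → ℝ | WithLp.toLp 2 (Fin.cons r z) ∈ coneCap n D} =
          r • (K ∩ {y | r ^ 2 * (1 - ∑ i, y i ^ 2) ≤ 1}) := by
        ext z
        rw [mem_smul_set_iff_inv_smul_mem₀ hr.ne']
        have hz : (WithLp.toLp 2 (Fin.cons 1 (r⁻¹ • z)) : EuclideanSpace ℝ (Fin (n + 1))) =
            r⁻¹ • WithLp.toLp 2 (Fin.cons r z) := by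
          ext i
          refine Fin.cases ?_ (fun i => ?_) i <;> simp [hr.ne']
        have hs : ∑ i, (r⁻¹ • z) i ^ 2 = (∑ i, z i ^ 2) / r ^ 2 := by
          simp only [Pi.smul_apply, smul_eq_mul, mul_pow, ← Finset.mul_sum]
          field_simp
        have hD' : r⁻¹ • (WithLp.toLp 2 (Fin.cons r z) : EuclideanSpace ℝ (Fin (n + 1))) ∈ D ↔
            (WithLp.toLp 2 (Fin.cons r z) : EuclideanSpace ℝ (Fin (n + 1))) ∈ D := by
          refine ⟨fun h => ?_, hc _ _ (inv_pos.2 hr)⟩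
          have := hc _ r hr h
          rwa [smul_inv_smul₀ hr.ne'] at this
        have hr2 : 0 < r ^ 2 := by positivity
        have e1 : (∑ i, z i ^ 2) / r ^ 2 < 1 ↔ -r ^ 2 + ∑ i, z i ^ 2 < 0 := by
          rw [div_lt_one hr2]; constructor <;> intro h <;> linarith
        have e2 : r ^ 2 * (1 - (∑ i, z i ^ 2) / r ^ 2) ≤ 1 ↔ -1 ≤ -r ^ 2 + ∑ i, z i ^ 2 := by
          have : r ^ 2 * (1 - (∑ i, z i ^ 2) / r ^ 2) = r ^ 2 - ∑ i, z i ^ 2 := by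
            field_simp
          rw [this]; constructor <;> intro h <;> linarith
        simp only [coneCap, mem_ofPred_eq, mem_inter_iff, hKdef, hz, hs, hD', mink_cons, e1, e2]
        simp only [Fin.cons_zero, hr, true_and, and_assoc]
      have hm2 : MeasurableSet {y : Fin n → ℝ | r ^ 2 * (1 - ∑ i, y i ^ 2) ≤ 1} :=
        (isClosed_le (by fun_prop) continuous_const).measurableSet
      rw [hset, Measure.addHaar_smul, abs_of_pos (by positivity), Module.finrank_fin_fun,
        inter_comm, ← Measure.restrict_apply hm2, ← lintegral_indicator_const hm2]
      refine lintegral_congr fun y => ?_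
      simp [indicator_apply, hr]
  have hmeas : Measurable (Function.uncurry fun (r : ℝ) (y : Fin n → ℝ) =>
      (Ioi (0 : ℝ) ∩ {r | r ^ 2 * (1 - ∑ i, y i ^ 2) ≤ 1}).indicator
        (fun r => ENNReal.ofReal (r ^ n)) r) := by
    have : (Function.uncurry fun (r : ℝ) (y : Fin n → ℝ) =>
      (Ioi (0 : ℝ) ∩ {r | r ^ 2 * (1 - ∑ i, y i ^ 2) ≤ 1}).indicator
        (fun r => ENNReal.ofReal (r ^ n)) r) =
        ({q : ℝ × (Fin n → ℝ) | 0 < q.1} ∩ {q | q.1 ^ 2 * (1 - ∑ i, q.2 i ^ 2) ≤ 1}).indicator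
          (fun q => ENNReal.ofReal (q.1 ^ n)) := by
      ext ⟨r, y⟩
      simp [Function.uncurry, indicator_apply]
    rw [this]
    refine Measurable.indicator (by fun_prop) ?_
    exact (isOpen_lt (by fun_prop) (by fun_prop)).measurableSet.inter
      (isClosed_le (by fun_prop) (by fun_prop)).measurableSet
  rw [volume_eq_lintegral_slices (measurableSet_coneCap hD), lintegral_congr hslice,
    lintegral_lintegral_swap hmeas.aemeasurable, hVol, klein_image hc,
    ← lintegral_const_mul' _ _ (by finiteness)]
  refine setLIntegral_congr_fun hK fun y hy => ?_
  have hpos : 0 < 1 - ∑ i, y i ^ 2 := by linarith [hy.2]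
  set u := 1 - ∑ i, y i ^ 2
  have hI : Ioi (0 : ℝ) ∩ {r | r ^ 2 * u ≤ 1} = Ioc 0 (u ^ (-(1 / 2) : ℝ)) := by
    ext r
    simp only [mem_inter_iff, mem_Ioi, mem_ofPred_eq, mem_Ioc]
    refine and_congr_right fun hr => ?_
    rw [Real.rpow_neg hpos.le, ← Real.sqrt_eq_rpow, le_inv_comm₀ hr (Real.sqrt_pos.2 hpos),
      Real.sqrt_le_left (by positivity), inv_pow, ← one_div, le_div_iff₀ (by positivity), mul_comm]
  have hms : MeasurableSet (Ioi (0 : ℝ) ∩ {r | r ^ 2 * u ≤ 1}) := hI ▸ measurableSet_Ioc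
  rw [lintegral_indicator hms, hI, lintegral_pow_Ioc n (by positivity)]
  have : (n + 1 : ℝ≥0∞) = ENNReal.ofReal (n + 1) := by
    rw [ENNReal.ofReal_add (by positivity) zero_le_one]; simp
  rw [this, ← ENNReal.ofReal_mul (by positivity)]
  congr 1
  rw [← Real.rpow_natCast, ← Real.rpow_mul hpos.le, mul_div_cancel₀ _ (by positivity)]
  congr 1
  push_cast; ring

end Volume

end

section

section Determinant

variable {n : ℕ}

/-- The Gram matrix of a family of vectors with respect to the Minkowski form. -/
def minkGram (w : Fin (n + 1) → EuclideanSpace ℝ (Fin (n + 1))) :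
    Matrix (Fin (n + 1)) (Fin (n + 1)) ℝ :=
  Matrix.of fun i j => mink n (w i) (w j)

lemma minkGram_eq (w : Fin (n + 1) → EuclideanSpace ℝ (Fin (n + 1))) :
    minkGram w = (Matrix.of fun i j => w i j) * Matrix.diagonal (Fin.cons (-1) fun _ => 1) *
      (Matrix.of fun i j => w i j).transpose := by
  ext i j
  rw [Matrix.mul_apply, Fin.sum_univ_succ]
  simp [minkGram, mink, Matrix.mul_diagonal]

lemma abs_det_minkGram (w : Fin (n + 1) → EuclideanSpace ℝ (Fin (n + 1))) :
    |(minkGram w).det| = (Matrix.of fun i j => w i j).det ^ 2 := by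
  rw [minkGram_eq, Matrix.det_mul, Matrix.det_mul, Matrix.det_transpose, Matrix.det_diagonal,
    Fin.prod_univ_succ]
  simp [abs_mul, sq]

/-- The volume of the image of a set of coordinates under a linear parametrization. -/
theorem volume_image_sum_smul (w : Fin (n + 1) → EuclideanSpace ℝ (Fin (n + 1)))
    (S : Set (Fin (n + 1) → ℝ)) :
    volume ((fun a : Fin (n + 1) → ℝ => ∑ i, a i • w i) '' S) =
      ENNReal.ofReal (Real.sqrt |(minkGram w).det|) * volume S := by
  set M : Matrix (Fin (n + 1)) (Fin (n + 1)) ℝ := Matrix.of fun i j => w i j with hM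
  have h1 : (fun a : Fin (n + 1) → ℝ => ∑ i, a i • w i) '' S =
      (MeasurableEquiv.toLp 2 (Fin (n + 1) → ℝ)).symm ⁻¹'
        ((Matrix.toLin' M.transpose) '' S) := by
    ext x
    simp only [mem_image, mem_preimage]
    refine exists_congr fun a => and_congr_right fun _ => ?_
    have : Matrix.toLin' M.transpose a = (MeasurableEquiv.toLp 2 (Fin (n + 1) → ℝ)).symm
        (∑ i, a i • w i) := by
      ext j
      simp [Matrix.toLin'_apply, Matrix.mulVec, dotProduct, hM, mul_comm]
    rw [this]
    exact (EquivLike.injective (MeasurableEquiv.toLp 2 (Fin (n + 1) → ℝ)).symm).eq_iff.symm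
  rw [h1, (EuclideanSpace.volume_preserving_symm_measurableEquiv_toLp
    (Fin (n + 1))).measure_preimage_equiv, Measure.addHaar_image_linearMap, LinearMap.det_toLin',
    Matrix.det_transpose, abs_det_minkGram, Real.sqrt_sq_eq_abs]

theorem volume_image_of_mink_eq
    (g : EuclideanSpace ℝ (Fin (n + 1)) →ₗ[ℝ] EuclideanSpace ℝ (Fin (n + 1)))
    (hg : ∀ x y, mink n (g x) (g y) = mink n x y) (S : Set (EuclideanSpace ℝ (Fin (n + 1)))) :
    volume (g '' S) = volume S := by
  set b : Fin (n + 1) → EuclideanSpace ℝ (Fin (n + 1)) := fun i => EuclideanSpace.single i 1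
  have hb : ∀ a : Fin (n + 1) → ℝ, ∑ i, a i • b i = WithLp.toLp 2 a := by
    intro a
    ext j
    simp [b, Finset.sum_apply, Pi.single_apply]
  have hgram : minkGram (fun i => g (b i)) = minkGram b := by
    ext i j; simp [minkGram, hg]
  have h1 := volume_image_sum_smul b (WithLp.toLp 2 ⁻¹' S)
  have h2 := volume_image_sum_smul (fun i => g (b i)) (WithLp.toLp 2 ⁻¹' S)
  rw [hgram, ← h1] at h2
  have hsurj : Function.Surjective
      (WithLp.toLp 2 : (Fin (n + 1) → ℝ) → EuclideanSpace ℝ (Fin (n + 1))) :=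
    fun x => ⟨WithLp.ofLp x, rfl⟩
  have e1 : (fun a : Fin (n + 1) → ℝ => ∑ i, a i • b i) '' (WithLp.toLp 2 ⁻¹' S) = S := by
    simp only [hb]
    exact image_preimage_eq S hsurj
  have e2 : (fun a : Fin (n + 1) → ℝ => ∑ i, a i • g (b i)) '' (WithLp.toLp 2 ⁻¹' S) =
      g '' S := by
    have : (fun a : Fin (n + 1) → ℝ => ∑ i, a i • g (b i)) =
        g ∘ fun a => WithLp.toLp 2 a := by
      funext a
      simp [← hb, map_sum]
    rw [this, image_comp, image_preimage_eq S hsurj]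
  rwa [e1, e2] at h2

end Determinant

end

section

/-! ## Polyhedra of finite volume are causal -/

section Boost

variable {n : ℕ}

/-- The boost scaling the null vector `z` by `l` and the opposite null vector `z'` by `l⁻¹`. -/
def boost (z z' : EuclideanSpace ℝ (Fin (n + 1))) (l : ℝ) :
    EuclideanSpace ℝ (Fin (n + 1)) →ₗ[ℝ] EuclideanSpace ℝ (Fin (n + 1)) :=
  LinearMap.id - ((l - 1) • (minkB n z').smulRight z + (l⁻¹ - 1) • (minkB n z).smulRight z')

lemma boost_apply (z z' x : EuclideanSpace ℝ (Fin (n + 1))) (l : ℝ) :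
    boost z z' l x = x - (((l - 1) * mink n z' x) • z + ((l⁻¹ - 1) * mink n z x) • z') := by
  simp [boost, minkB_apply, mul_smul]

variable {z z' : EuclideanSpace ℝ (Fin (n + 1))}

lemma mink_boost (hz : mink n z z = 0) (hz' : mink n z' z' = 0) (hzz : mink n z z' = -1)
    {l : ℝ} (hl : l ≠ 0) (x y : EuclideanSpace ℝ (Fin (n + 1))) :
    mink n (boost z z' l x) (boost z z' l y) = mink n x y := by
  simp only [boost_apply, mink_sub_left, mink_sub_right, mink_add_left, mink_add_right,
    mink_smul_left, mink_smul_right, hz, hz', hzz, mink_comm z' z, mink_comm x z,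
    mink_comm x z']
  field_simp
  ring

lemma mink_boost_right (hz' : mink n z' z' = 0) (hzz : mink n z z' = -1)
    (l : ℝ) (x : EuclideanSpace ℝ (Fin (n + 1))) :
    mink n z' (boost z z' l x) = l * mink n z' x := by
  simp only [boost_apply, mink_sub_right, mink_add_right, mink_smul_right, hz', mink_comm z' z,
    hzz]
  ring

/-- A box on which large boosts enter every half-space containing `z` in its interior. -/
def boostBox (z z' : EuclideanSpace ℝ (Fin (n + 1))) : Set (EuclideanSpace ℝ (Fin (n + 1))) :=
  Metric.ball ((3 / 2 : ℝ) • z + (1 / 6 : ℝ) • z') 1 ∩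
    {x | -2 < mink n z' x ∧ mink n z' x < -1 ∧ -1 < mink n x x ∧ mink n x x < 0}

lemma isOpen_boostBox (z z' : EuclideanSpace ℝ (Fin (n + 1))) : IsOpen (boostBox z z') := by
  have h1 : Continuous fun x => mink n z' x := by fun_prop
  have h2 : Continuous fun x : EuclideanSpace ℝ (Fin (n + 1)) => mink n x x := by fun_prop
  exact Metric.isOpen_ball.inter
    ((isOpen_lt continuous_const h1).inter ((isOpen_lt h1 continuous_const).inter
      ((isOpen_lt continuous_const h2).inter (isOpen_lt h2 continuous_const))))

lemma boostBox_nonempty (hz : mink n z z = 0) (hz' : mink n z' z' = 0)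
    (hzz : mink n z z' = -1) : (boostBox z z').Nonempty := by
  refine ⟨(3 / 2 : ℝ) • z + (1 / 6 : ℝ) • z', Metric.mem_ball_self one_pos, ?_⟩
  simp only [mem_ofPred_eq, mink_add_left, mink_add_right, mink_smul_left, mink_smul_right,
    hz, hz', hzz, mink_comm z' z]
  norm_num

lemma eventually_boost_neg (L : EuclideanSpace ℝ (Fin (n + 1)) →L[ℝ] ℝ) (hL : L z < 0) :
    ∀ᶠ l : ℝ in Filter.atTop, ∀ x ∈ boostBox z z', L (boost z z' l x) < 0 := by
  obtain ⟨C, hC⟩ := (isCompact_closedBall ((3 / 2 : ℝ) • z + (1 / 6 : ℝ) • z')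
    1).exists_bound_of_continuousOn (f := fun x => |L x| + |mink n z x * L z'|)
    (by fun_prop)
  have h1 : ∀ᶠ l : ℝ in Filter.atTop, 1 ≤ l := Filter.eventually_ge_atTop 1
  have h2 : ∀ᶠ l : ℝ in Filter.atTop, C / (-L z) + 1 < l := Filter.eventually_gt_atTop _
  filter_upwards [h1, h2] with l hl hl2 x hx
  have hb := hC x (Metric.ball_subset_closedBall hx.1)
  rw [Real.norm_of_nonneg (by positivity)] at hb
  have h3 : C < (l - 1) * (-L z) := by
    rw [← div_lt_iff₀ (by linarith)]; linarith
  simp only [boost_apply, map_sub, map_add, map_smul, smul_eq_mul]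
  have h4 : (l - 1) * (-L z) ≤ (l - 1) * (mink n z' x * L z) :=
    mul_le_mul_of_nonneg_left (by nlinarith [hx.2.2.1]) (by linarith)
  have h5 : -(l⁻¹ - 1) * (mink n z x * L z') ≤ |mink n z x * L z'| := by
    have hi : 0 < l⁻¹ := by positivity
    have hi1 : l⁻¹ ≤ 1 := inv_le_one_of_one_le₀ hl
    calc -(l⁻¹ - 1) * (mink n z x * L z') ≤ |-(l⁻¹ - 1) * (mink n z x * L z')| := le_abs_self _
      _ = (1 - l⁻¹) * |mink n z x * L z'| := by
          rw [abs_mul, neg_sub, abs_of_nonneg (by linarith)]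
      _ ≤ 1 * |mink n z x * L z'| := by
          apply mul_le_mul_of_nonneg_right _ (abs_nonneg _); linarith
      _ = _ := one_mul _
  nlinarith [le_abs_self (L x)]

/-- The linear functional `mink n v`, as a continuous linear map. -/
def minkL (v : EuclideanSpace ℝ (Fin (n + 1))) : EuclideanSpace ℝ (Fin (n + 1)) →L[ℝ] ℝ :=
  LinearMap.toContinuousLinearMap (minkB n v)

/-- A polyhedral cone with a null vector in its interior has infinite volume. -/
theorem hVol_eq_top_of_null {ι : Type*} [Finite ι] (v : ι → EuclideanSpace ℝ (Fin (n + 1)))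
    (hz : mink n z z = 0) (hz' : mink n z' z' = 0) (hzz : mink n z z' = -1) (hz0 : 0 < z 0)
    (hv : ∀ i, mink n (v i) z < 0) :
    hVol n {x | ∀ i, mink n (v i) x.val ≤ 0} = ⊤ := by
  have hclosed : IsClosed {x | ∀ i, mink n (v i) x ≤ 0} := by
    have : {x | ∀ i, mink n (v i) x ≤ 0} = ⋂ i, {x | mink n (v i) x ≤ 0} := by ext; simp
    rw [this]
    exact isClosed_iInter fun i => isClosed_le (by fun_prop) continuous_const
  have hvol := hVol_eq_volume_coneCap (n := n) (D := {x | ∀ i, mink n (v i) x ≤ 0})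
    hclosed.measurableSet (fun x t ht hx i => by
      rw [mink_smul_right]; exact mul_nonpos_of_nonneg_of_nonpos ht.le (hx i))
  simp only [mem_ofPred_eq] at hvol
  rw [hvol]
  refine ENNReal.mul_eq_top.2 (Or.inl ⟨by positivity, ?_⟩)
  have hev : ∀ᶠ l : ℝ in Filter.atTop, 1 ≤ l ∧ (∀ x ∈ boostBox z z', 0 < boost z z' l x 0) ∧
      ∀ i, ∀ x ∈ boostBox z z', mink n (v i) (boost z z' l x) < 0 := by
    refine (Filter.eventually_ge_atTop 1).and (Filter.Eventually.and ?_ ?_)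
    · have := eventually_boost_neg (z := z) (z' := z')
        (-(EuclideanSpace.proj (𝕜 := ℝ) (0 : Fin (n + 1)))) (by simpa using hz0)
      filter_upwards [this] with l hl x hx
      simpa using hl x hx
    · rw [Filter.eventually_all]
      exact fun i => eventually_boost_neg (minkL (v i)) (hv i)
  obtain ⟨l₀, hl₀⟩ := Filter.eventually_atTop.1 hev
  set l₁ := max l₀ 1
  have hl₁ : 1 ≤ l₁ := le_max_right _ _
  set l : ℕ → ℝ := fun k => l₁ * 2 ^ k
  have hl : ∀ k, l₀ ≤ l k := fun k =>
    (le_max_left l₀ 1).trans (le_mul_of_one_le_right (by linarith) (one_le_pow₀ one_le_two))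
  have hlpos : ∀ k, 0 < l k := fun k => by positivity
  have hsub : ∀ k, boost z z' (l k) '' boostBox z z' ⊆
      coneCap n {x | ∀ i, mink n (v i) x ≤ 0} := by
    rintro k - ⟨x, hx, rfl⟩
    obtain ⟨-, h0, h1⟩ := hl₀ (l k) (hl k)
    refine ⟨fun i => (h1 i x hx).le, h0 x hx, ?_, ?_⟩ <;>
      rw [mink_boost hz hz' hzz (hlpos k).ne']
    exacts [hx.2.2.2.2, hx.2.2.2.1.le]
  have hdisj : Pairwise (Function.onFun Disjoint fun k => boost z z' (l k) '' boostBox z z') := by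
    have key : ∀ j k, j < k → Disjoint (boost z z' (l j) '' boostBox z z')
        (boost z z' (l k) '' boostBox z z') := by
      intro j k hjk
      rw [Set.disjoint_left]
      rintro - ⟨x, hx, rfl⟩ ⟨y, hy, hxy⟩
      have h := congrArg (mink n z') hxy
      rw [mink_boost_right hz' hzz, mink_boost_right hz' hzz] at h
      have hjk2 : 2 * l j ≤ l k := by
        have : (2 : ℝ) ^ (j + 1) ≤ 2 ^ k := pow_le_pow_right₀ one_le_two hjk
        calc 2 * l j = l₁ * 2 ^ (j + 1) := by simp only [l]; ring
          _ ≤ l k := mul_le_mul_of_nonneg_left this (by linarith)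
      nlinarith [hx.2.1, hy.2.2.1, hlpos j, hlpos k]
    intro j k hjk
    rcases lt_or_gt_of_ne hjk with h | h
    · exact key j k h
    · exact (key k j h).symm
  have hopen : ∀ k, IsOpen (boost z z' (l k) '' boostBox z z') := by
    intro k
    have hinj : Function.Injective (boost z z' (l k)) := by
      refine (injective_iff_map_eq_zero _).2 fun x hx => mink_nondegenerate fun y => ?_
      rw [← mink_boost hz hz' hzz (hlpos k).ne', hx, mink_zero_left]
    exact LinearMap.isOpenMap_of_finiteDimensional _ (LinearMap.injective_iff_surjective.1 hinj)
      _ (isOpen_boostBox z z')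
  have hle := tsum_meas_le_meas_iUnion_of_disjoint volume
    (fun k => (hopen k).measurableSet) hdisj
  have hconst : ∀ k, volume (boost z z' (l k) '' boostBox z z') = volume (boostBox z z') :=
    fun k => volume_image_of_mink_eq _ (fun x y => mink_boost hz hz' hzz (hlpos k).ne' x y) _
  simp only [hconst] at hle
  rw [ENNReal.tsum_const_eq_top_of_ne_zero
    ((isOpen_boostBox z z').measure_pos volume (boostBox_nonempty hz hz' hzz)).ne'] at hle
  exact top_le_iff.1 (hle.trans (measure_mono (iUnion_subset hsub)))

end Boost

end

section

section Causality

variable {n : ℕ} {ι : Type*} [Finite ι] {v : ι → EuclideanSpace ℝ (Fin (n + 1))}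

lemma mink_nonpos_of_finite_volume {p : ↥(hypSet n)} (hp : ∀ i, mink n (v i) p.val < 0)
    (hfin : hVol n {x | ∀ i, mink n (v i) x.val ≤ 0} < ⊤) {y : EuclideanSpace ℝ (Fin (n + 1))}
    (hy : ∀ i, mink n (v i) y ≤ 0) : mink n y y ≤ 0 := by
  by_contra! hc
  set c := mink n y y
  set b := mink n p.val y
  set d := Real.sqrt (b ^ 2 + c)
  have hd : d ^ 2 = b ^ 2 + c := Real.sq_sqrt (by positivity)
  have hbd : b < d := by
    refine lt_of_le_of_lt (le_abs_self b) (abs_lt_of_sq_lt_sq ?_ (Real.sqrt_nonneg _))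
    linarith
  set s := (d - b) / c
  have hs : 0 < s := div_pos (by linarith) hc
  have hsc : s * c = d - b := div_mul_cancel₀ _ hc.ne'
  have hroot : -1 + 2 * s * b + s ^ 2 * c = 0 := by
    have : c * (-1 + 2 * s * b + s ^ 2 * c) = 0 := by
      calc c * (-1 + 2 * s * b + s ^ 2 * c) = -c + 2 * (s * c) * b + (s * c) ^ 2 := by ring
        _ = 0 := by rw [hsc]; linear_combination hd
    rcases mul_eq_zero.1 this with h | h
    · exact absurd h hc.ne'
    · exact h
  set z := p.val + s • y with hzdef
  have hpp : mink n p.val p.val = -1 := p.2.1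
  have hz : mink n z z = 0 := by
    simp only [hzdef, mink_add_left, mink_add_right, mink_smul_left, mink_smul_right, hpp,
      mink_comm y p.val]
    linear_combination hroot
  have hm : mink n p.val z = -1 + s * b := by
    simp only [hzdef, mink_add_right, mink_smul_right, hpp]; rfl
  have hmneg : mink n p.val z < 0 := by
    rw [hm]; nlinarith [mul_pos (pow_pos hs 2) hc]
  have hz0 : 0 < z 0 := by
    by_contra! h0
    have : mink n p.val (-z) ≤ 0 := fut_mink_nonpos (hypSet_fut p.2)
      ⟨by rw [mink_neg_left, mink_neg_right, hz]; simp, by simpa using h0⟩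
    rw [mink_neg_right] at this
    linarith
  obtain ⟨m, hmdef⟩ : ∃ m, mink n p.val z = m := ⟨_, rfl⟩
  rw [hmdef] at hmneg
  have hm0 := hmneg.ne
  set z' := (-(1 / m)) • p.val + (-(1 / (2 * m ^ 2))) • z with hz'def
  have hzz : mink n z z' = -1 := by
    simp only [hz'def, mink_add_right, mink_smul_right, hz, mink_comm z p.val,
      hmdef]
    field_simp; ring
  have hz' : mink n z' z' = 0 := by
    simp only [hz'def, mink_add_left, mink_add_right, mink_smul_left, mink_smul_right, hz, hpp,
      mink_comm z p.val, hmdef]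
    field_simp; ring
  refine hfin.ne (hVol_eq_top_of_null v hz hz' hzz hz0 fun i => ?_)
  rw [hzdef, mink_add_right, mink_smul_right]
  nlinarith [hp i, hy i]

/-- A polyhedral cone whose trace on hyperbolic space has finite volume and nonempty interior
consists of future causal vectors. -/
theorem fut_of_finite_volume [NeZero n] {p : ↥(hypSet n)} (hp : ∀ i, mink n (v i) p.val < 0)
    (hfin : hVol n {x | ∀ i, mink n (v i) x.val ≤ 0} < ⊤) {x : EuclideanSpace ℝ (Fin (n + 1))}
    (hx : ∀ i, mink n (v i) x ≤ 0) : x ∈ Fut n := by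
  refine ⟨mink_nonpos_of_finite_volume hp hfin hx, ?_⟩
  by_contra! h0
  rcases isEmpty_or_nonempty ι with hι | ⟨⟨i⟩⟩
  · have := mink_nonpos_of_finite_volume hp hfin
      (y := EuclideanSpace.single (Fin.succ (0 : Fin n)) (1 : ℝ)) (fun i => hι.elim i)
    have h2 : ∀ j : Fin n, mink n (EuclideanSpace.single j.succ (1 : ℝ))
        (EuclideanSpace.single j.succ 1) = 1 := fun j => by
      rw [mink, Finset.sum_eq_single j] <;> simp +contextual [Fin.succ_inj]
    linarith [h2 0]
  · set s := p.val 0 / (-x 0)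
    have hs : 0 < s := div_pos p.2.2 (by linarith)
    have hy : ∀ i, mink n (v i) (p.val + s • x) < 0 := fun i => by
      rw [mink_add_right, mink_smul_right]; nlinarith [hp i, hx i]
    have hy0 : (p.val + s • x) 0 = 0 := by
      have : s * (-x 0) = p.val 0 := div_mul_cancel₀ _ (by linarith)
      simp only [PiLp.add_apply, PiLp.smul_apply, smul_eq_mul]; linarith
    have h := eq_zero_of_spatial (mink_nonpos_of_finite_volume hp hfin fun i => (hy i).le) hy0
    have := hy i
    rw [h, mink_zero_right] at this
    exact this.false

end Causality

end

section

/-! ## From Coxeter simplices to frames -/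

/-- A finite irredundant family of half-spaces with a common interior point. -/
structure Irredundant {ι : Type*} (v : ι → EuclideanSpace ℝ (Fin (5 + 1))) (p : ↥(hypSet 5)) :
    Prop where
  unit : ∀ i, mink 5 (v i) (v i) = 1
  neg : ∀ i, mink 5 (v i) p.val < 0
  witness : ∀ i, ∃ y : ↥(hypSet 5), (∀ j, j ≠ i → mink 5 (v j) y.val ≤ 0) ∧
    0 < mink 5 (v i) y.val

namespace Irredundant

variable {ι : Type*} {v : ι → EuclideanSpace ℝ (Fin (5 + 1))} {p : ↥(hypSet 5)}

lemma exists_facet_point (h : Irredundant v p) (i : ι) :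
    ∃ q : ↥(hypSet 5), mink 5 (v i) q.val = 0 ∧ ∀ j, j ≠ i → mink 5 (v j) q.val < 0 := by
  obtain ⟨y, hy, hyi⟩ := h.witness i
  set τ := mink 5 (v i) y.val / -mink 5 (v i) p.val with hτ
  have hpi := h.neg i
  have hτ0 : 0 < τ := div_pos hyi (by linarith)
  have hτ1 : τ * mink 5 (v i) p.val = -mink 5 (v i) y.val := by
    rw [hτ, div_neg, neg_mul, div_mul_cancel₀ _ hpi.ne]
  have hf : y.val + τ • p.val ∈ Fut 5 := fut_add (hypSet_fut y.2) (fut_smul (hypSet_fut p.2) hτ0.le)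
  have ht : mink 5 (y.val + τ • p.val) (y.val + τ • p.val) < 0 := by
    simp only [mink_add_left, mink_add_right, mink_smul_left, mink_smul_right]
    have h1 := y.2.1
    have h2 := p.2.1
    have h3 := fut_mink_nonpos (hypSet_fut y.2) (hypSet_fut p.2)
    have h4 := fut_mink_nonpos (hypSet_fut p.2) (hypSet_fut y.2)
    rw [h1, h2]
    nlinarith [mul_pos hτ0 hτ0]
  obtain ⟨q, t, ht, hq⟩ := exists_hyp_smul hf ht
  refine ⟨q, ?_, fun j hj => ?_⟩
  · rw [hq, mink_smul_right, mink_add_right, mink_smul_right, hτ1]; ring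
  · rw [hq, mink_smul_right, mink_add_right, mink_smul_right]
    have h1 := hy j hj
    have h2 := h.neg j
    exact mul_neg_of_pos_of_neg ht (by nlinarith)

lemma mem_iff {x : ↥(hypSet 5)} : x ∈ ⋂ i, hHalf 5 (v i) ↔ ∀ i, mink 5 (v i) x.val ≤ 0 := by
  simp [hHalf]

lemma eq_or_neg [Finite ι] (h : Irredundant v p) {i : ι} {w : EuclideanSpace ℝ (Fin (5 + 1))}
    (hw1 : mink 5 w w = 1) (hw : (⋂ i, hHalf 5 (v i)) ∩ hWall 5 (v i) ⊆ hWall 5 w) :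
    w = v i ∨ w = -v i := by
  obtain ⟨q, hq, hqj⟩ := h.exists_facet_point i
  have hqw : mink 5 w q.val = 0 :=
    hw ⟨mem_iff.2 fun j => by
      by_cases hj : j = i
      · rw [hj, hq]
      · exact (hqj j hj).le, hq⟩
  have key : ∀ z, mink 5 (v i) z = 0 → mink 5 w z = 0 := by
    intro z hz
    have hO : IsOpen {x : ↥(hypSet 5) | ∀ j : {j // j ≠ i}, mink 5 (v j) x.val < 0} :=
      isOpen_strict fun j : {j // j ≠ i} => v j
    have h1 : ∀ᶠ s : ℝ in nhdsWithin 0 (Ioi 0), 0 < s := self_mem_nhdsWithin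
    obtain ⟨s, ⟨x, hx, r, hr, hxr⟩, hs⟩ := (((eventually_push q z hO
      (fun j => hqj j j.2)).filter_mono nhdsWithin_le_nhds).and h1).exists
    have hxi : mink 5 (v i) x.val = 0 := by
      rw [hxr, mink_smul_right, mink_add_right, mink_smul_right, hq, hz]; ring
    have hxw : mink 5 w x.val = 0 :=
      hw ⟨mem_iff.2 fun j => by
        by_cases hj : j = i
        · rw [hj, hxi]
        · exact (hx ⟨j, hj⟩).le, hxi⟩
    rw [hxr, mink_smul_right, mink_add_right, mink_smul_right, hqw, zero_add] at hxw
    exact (mul_eq_zero.1 ((mul_eq_zero.1 hxw).resolve_left hr.ne')).resolve_left hs.ne'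
  set c := mink 5 w (v i)
  have hwc : w = c • v i := by
    refine sub_eq_zero.1 (mink_nondegenerate fun y => ?_)
    have := key (y - mink 5 (v i) y • v i) (by
      rw [mink_sub_right, mink_smul_right, h.unit]; ring)
    rw [mink_sub_right, mink_smul_right] at this
    rw [mink_sub_left, mink_smul_left]
    linarith
  rw [hwc, mink_smul_left, mink_smul_right, h.unit, mul_one] at hw1
  rcases mul_self_eq_one_iff.1 hw1 with ha | ha
  · left; rw [hwc, ha, one_smul]
  · right; rw [hwc, ha, neg_one_smul]

lemma isFacet [Finite ι] (h : Irredundant v p) (i : ι) :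
    hIsFacet 5 (⋂ i, hHalf 5 (v i)) ((⋂ i, hHalf 5 (v i)) ∩ hWall 5 (v i)) := by
  refine ⟨?_, v i, h.unit i, iInter_subset _ i, rfl, fun u hu1 hu => ?_⟩
  · obtain ⟨q, hq, hqj⟩ := h.exists_facet_point i
    refine ⟨q, mem_iff.2 fun j => ?_, hq⟩
    by_cases hj : j = i
    · rw [hj, hq]
    · exact (hqj j hj).le
  · rcases h.eq_or_neg hu1 hu with rfl | rfl
    · rfl
    · exact IsFrame.hWall_neg _

lemma facet_injective (h : Irredundant v p) :
    Function.Injective fun i => (⋂ i, hHalf 5 (v i)) ∩ hWall 5 (v i) := by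
  intro i j hij
  by_contra hne
  obtain ⟨q, hq, hqj⟩ := h.exists_facet_point i
  have : q ∈ (⋂ i, hHalf 5 (v i)) ∩ hWall 5 (v i) := ⟨mem_iff.2 fun k => by
      by_cases hk : k = i
      · rw [hk, hq]
      · exact (hqj k hk).le, hq⟩
  have h2 : q ∈ (⋂ i, hHalf 5 (v i)) ∩ hWall 5 (v j) := by
    have h3 : (⋂ i, hHalf 5 (v i)) ∩ hWall 5 (v i) = (⋂ i, hHalf 5 (v i)) ∩ hWall 5 (v j) := hij
    rwa [← h3]
  have h3 : mink 5 (v j) q.val = 0 := h2.2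
  linarith [hqj j (Ne.symm hne)]

lemma facets [Finite ι] [Nonempty ι] (h : Irredundant v p) {S : Set ↥(hypSet 5)}
    (hS : hIsFacet 5 (⋂ i, hHalf 5 (v i)) S) :
    ∃ i, S = (⋂ i, hHalf 5 (v i)) ∩ hWall 5 (v i) := by
  obtain ⟨⟨x0, hx0⟩, u, hu1, hPu, rfl, huniq⟩ := hS
  by_cases hc : ∃ i, (⋂ i, hHalf 5 (v i)) ∩ hWall 5 u ⊆ hWall 5 (v i)
  · obtain ⟨i, hi⟩ := hc
    exact ⟨i, by rw [huniq (v i) (h.unit i) hi]⟩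
  exfalso
  push Not at hc
  have := Fintype.ofFinite ι
  have hx : ∀ i, ∃ x : ↥(hypSet 5), (∀ j, mink 5 (v j) x.val ≤ 0) ∧ mink 5 u x.val = 0 ∧
      mink 5 (v i) x.val < 0 := by
    intro i
    obtain ⟨x, hx, hxi⟩ := Set.not_subset.1 (hc i)
    refine ⟨x, mem_iff.1 hx.1, hx.2, lt_of_le_of_ne (mem_iff.1 hx.1 i) hxi⟩
  choose x hx1 hx2 hx3 using hx
  have hf : ∑ i, (x i).val ∈ Fut 5 := fut_sum _ fun i _ => hypSet_fut (x i).2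
  have hneg : ∀ j, mink 5 (v j) (∑ i, (x i).val) < 0 := fun j => by
    rw [mink_sum_right]
    exact Finset.sum_neg' (fun i _ => hx1 i j) ⟨j, Finset.mem_univ j, hx3 j⟩
  have ht : mink 5 (∑ i, (x i).val) (∑ i, (x i).val) < 0 := by
    rw [mink_sum_left]
    refine Finset.sum_neg (fun i _ => ?_) Finset.univ_nonempty
    rw [mink_sum_right]
    refine Finset.sum_neg' (fun j _ => fut_mink_nonpos (hypSet_fut (x i).2) (hypSet_fut (x j).2))
      ⟨i, Finset.mem_univ i, ?_⟩
    rw [(x i).2.1]; norm_num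
  obtain ⟨q, t, ht, hq⟩ := exists_hyp_smul hf ht
  have hqi : q ∈ interior (⋂ i, hHalf 5 (v i)) :=
    interior_maximal (fun y hy => mem_iff.2 fun i => (hy i).le) (isOpen_strict v) (fun i => by
      rw [hq, mink_smul_right]
      exact mul_neg_of_pos_of_neg ht (hneg i))
  have h1 := interior_subset_strict (by rw [hu1]; norm_num) hPu hqi
  rw [hq, mink_smul_right, mink_sum_right, Finset.sum_eq_zero fun i _ => hx2 i] at h1
  simp at h1

lemma facets_eq [Finite ι] [Nonempty ι] (h : Irredundant v p) :
    {S | hIsFacet 5 (⋂ i, hHalf 5 (v i)) S} =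
      Set.range fun i => (⋂ i, hHalf 5 (v i)) ∩ hWall 5 (v i) := by
  ext S
  constructor
  · intro hS
    obtain ⟨i, rfl⟩ := h.facets hS
    exact ⟨i, rfl⟩
  · rintro ⟨i, rfl⟩
    exact h.isFacet i

end Irredundant

lemma exists_irredundant {k : ℕ} {v : Fin k → EuclideanSpace ℝ (Fin (5 + 1))} {p : ↥(hypSet 5)}
    (hv : ∀ i, mink 5 (v i) (v i) = 1) (hp : ∀ i, mink 5 (v i) p.val < 0) :
    ∃ I : Finset (Fin k), (⋂ i, hHalf 5 (v i)) = ⋂ i : I, hHalf 5 (v i) ∧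
      Irredundant (fun i : I => v i) p := by
  classical
  obtain ⟨I, hI, hmin⟩ := Finset.exists_min_image
    (Finset.univ.filter fun I : Finset (Fin k) => (⋂ i, hHalf 5 (v i)) = ⋂ i : I, hHalf 5 (v i))
    Finset.card ⟨Finset.univ, by
      rw [Finset.mem_filter]
      refine ⟨Finset.mem_univ _, ?_⟩
      ext x; simp⟩
  rw [Finset.mem_filter] at hI
  refine ⟨I, hI.2, fun i => hv i, fun i => hp i, fun i => ?_⟩
  by_contra! hn
  have hmem : I.erase i.1 ∈ Finset.univ.filter fun I : Finset (Fin k) =>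
      (⋂ i, hHalf 5 (v i)) = ⋂ i : I, hHalf 5 (v i) := by
    rw [Finset.mem_filter]
    refine ⟨Finset.mem_univ _, subset_antisymm ?_ ?_⟩
    · exact fun x hx => mem_iInter.2 fun j => mem_iInter.1 hx j.1
    · rw [hI.2]
      intro x hx
      have hx' : ∀ j : I, j ≠ i → mink 5 (v j) x.val ≤ 0 := fun j hj =>
        mem_iInter.1 hx ⟨j.1, Finset.mem_erase.2 ⟨fun h => hj (Subtype.ext h), j.2⟩⟩
      refine mem_iInter.2 fun j => ?_
      by_cases hj : j = i
      · rw [hj]; exact hn x hx'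
      · exact hx' j hj
  have h1 := hmin _ hmem
  have h2 := Finset.card_erase_lt_of_mem i.2
  omega

/-- A Coxeter simplex of finite volume has a frame with Coxeter angles. -/
theorem exists_frame {P : Set ↥(hypSet 5)} (hP : hCoxSimplex 5 P) :
    ∃ e, IsFrame e P ∧ hVol 5 P < ⊤ ∧ ∀ i j, i ≠ j →
      ∃ m : ℕ, 2 ≤ m ∧ mink 5 (e i) (e j) = -Real.cos (Real.pi / (m : ℝ)) := by
  obtain ⟨⟨k, v, hv, rfl, ⟨p, hp⟩, hfin, hang⟩, -, hcard⟩ := hP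
  have hp' : ∀ i, mink 5 (v i) p.val < 0 := fun i =>
    interior_subset_strict (by rw [hv]; norm_num) (iInter_subset _ i) hp
  obtain ⟨I, hI, hirr⟩ := exists_irredundant hv hp'
  have hne : Nonempty I := by
    by_contra hem
    rw [not_nonempty_iff] at hem
    rw [hI] at hcard
    have h0 : {S | hIsFacet 5 (⋂ i : I, hHalf 5 (v i)) S} = ∅ := by
      rw [eq_empty_iff_forall_notMem]
      rintro S ⟨⟨x, hx⟩, u, hu1, hPu, rfl, -⟩
      rw [iInter_of_empty] at hPu
      have h1 := interior_subset_strict (x := x) (by rw [hu1]; norm_num) hPu (by simp)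
      exact h1.ne hx.2
    rw [h0] at hcard
    simp at hcard
  rw [hI, hirr.facets_eq, ← Set.image_univ, Set.ncard_image_of_injective _ hirr.facet_injective,
    Set.ncard_univ, Nat.card_eq_fintype_card] at hcard
  set σ : Fin 6 ≃ I := (Fintype.equivFinOfCardEq hcard).symm
  have hfr : IsFrame (fun i => v (σ i)) (⋂ i, hHalf 5 (v i)) := by
    have heq : (⋂ i, hHalf 5 (v i)) = ⋂ i, hHalf 5 (v (σ i)) := by
      rw [hI]; exact (σ.surjective.iInter_comp fun i : I => hHalf 5 (v i)).symm
    refine ⟨fun i => hv _, heq, fun x hx => ?_⟩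
    refine fut_of_finite_volume (v := fun i => v (σ i)) (p := p) (fun i => hp' _) ?_ hx
    convert hfin
    rw [heq]
    ext x; simp [hHalf]
  refine ⟨_, hfr, hfin, fun i j hij => hang _ _ (fun hw => hij (hfr.wall_injective hw)) ?_⟩
  obtain ⟨a, b, hab, ha, hb⟩ := IsFrame.exists_pair_not_mem_pair i j
  simp only [mem_insert_iff, mem_singleton_iff, not_or] at ha hb
  obtain ⟨q, hq, s, hs, hqs⟩ := hfr.exists_point (t := fun l => if l = i ∨ l = j then 0 else 1)
    (fun l => by split_ifs <;> norm_num) hab (by simp [ha]) (by simp [hb])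
  refine ⟨q, hq, ?_, ?_⟩
  · show mink 5 (v (σ i)) q.val = 0
    rw [hqs, mink_smul_right, hfr.mink_dual_sum]; simp
  · show mink 5 (v (σ j)) q.val = 0
    rw [hqs, mink_smul_right, hfr.mink_dual_sum]; simp

end

section

/-! ## Volumes in simplicial coordinates -/

/-- The truncated positive cone of a quadratic form. -/
def capSet (M : Matrix (Fin 6) (Fin 6) ℝ) : Set (Fin 6 → ℝ) :=
  {a | (∀ i, 0 < a i) ∧ -1 ≤ ∑ i, ∑ j, a i * a j * M i j}

/-- The normalized volume of the truncated cone. -/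
def capVol (M : Matrix (Fin 6) (Fin 6) ℝ) : ℝ≥0∞ :=
  ENNReal.ofReal (Real.sqrt |M.det|) * volume (capSet M)

lemma measurableSet_capSet (M : Matrix (Fin 6) (Fin 6) ℝ) : MeasurableSet (capSet M) := by
  unfold capSet
  simp only [ofPred_and, ofPred_forall]
  refine (MeasurableSet.iInter fun i => measurableSet_lt measurable_const (by fun_prop)).inter
    (measurableSet_le measurable_const (by fun_prop))

lemma addHaar_ker_eq_zero {E : Type*} [NormedAddCommGroup E] [NormedSpace ℝ E] [MeasurableSpace E]
    [BorelSpace E] [FiniteDimensional ℝ E] {μ : Measure E} [μ.IsAddHaarMeasure] {f : E →ₗ[ℝ] ℝ}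
    {x : E} (hx : f x ≠ 0) : μ {y | f y = 0} = 0 :=
  Measure.addHaar_submodule μ (LinearMap.ker f) fun h =>
    hx (LinearMap.mem_ker.1 (h ▸ Submodule.mem_top))

namespace IsFrame

variable {e : Fin 6 → EuclideanSpace ℝ (Fin (5 + 1))} {P : Set ↥(hypSet 5)}

theorem hVol_eq (h : IsFrame e P) : hVol 5 P = 6 * capVol (minkGram h.dual) := by
  set D : Set (EuclideanSpace ℝ (Fin (5 + 1))) := {x | ∀ i, mink 5 (e i) x ≤ 0} with hD
  have hDm : MeasurableSet D := by
    rw [hD]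
    simp only [ofPred_forall]
    exact MeasurableSet.iInter fun i =>
      (isClosed_le (by fun_prop) continuous_const : IsClosed {x | mink 5 (e i) x ≤ 0}).measurableSet
  have hP : P = {x | x.val ∈ D} := by
    ext x
    exact h.mem
  rw [(congrArg (hVol 5) hP : hVol 5 P = _), hVol_eq_volume_coneCap hDm fun x t ht hx i => by
    rw [mink_smul_right]; exact mul_nonpos_of_nonneg_of_nonpos ht.le (hx i)]
  rw [capVol, ← volume_image_sum_smul h.dual]
  congr 1
  · norm_num
  apply measure_congr
  refine Filter.EventuallyLE.antisymm ?_ ?_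
  · rw [ae_le_set]
    refine measure_mono_null (t := ⋃ i, {x | minkB 5 (e i) x = 0}) ?_
      (measure_iUnion_null fun i => addHaar_ker_eq_zero (x := h.dual i) fun h0 => ?_)
    · rintro x ⟨⟨hx1, hx0, hxt, hx2⟩, hx3⟩
      by_contra hn
      simp only [mem_iUnion, mem_ofPred_eq, not_exists] at hn
      refine hx3 ⟨fun i => -mink 5 (e i) x, ⟨fun i => ?_, ?_⟩, (h.expand x).symm⟩
      · have := lt_of_le_of_ne (hx1 i) (hn i)
        linarith
      · refine hx2.trans_eq ?_
        conv_lhs => rw [h.expand x]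
        rw [h.mink_sum_dual_self]
        rfl
    · rw [minkB_apply, h.mink_dual, if_pos rfl] at h0
      norm_num at h0
  · refine LE.le.eventuallyLE ?_
    rintro _ ⟨a, ⟨ha, ha2⟩, rfl⟩
    have ht := h.sum_timelike (t := a) (fun i => (ha i).le) (show (0 : Fin 6) ≠ 1 by decide)
      (ha 0) (ha 1)
    have hf := h.sum_mem_fut (t := a) fun i => (ha i).le
    refine ⟨fun i => ?_, fut_pos hf ?_, ht, ?_⟩
    · rw [h.mink_dual_sum]; linarith [ha i]
    · intro h0
      simp only [] at h0
      rw [h0] at ht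
      simp at ht
    · simp only []
      rw [h.mink_sum_dual_self]
      exact ha2

end IsFrame

/-- Monotonicity of the normalized volume, up to rescaling of the generators. -/
theorem capVol_le_of_le {M M' : Matrix (Fin 6) (Fin 6) ℝ} {l : Fin 6 → ℝ} (hl : ∀ i, 0 < l i)
    (hle : ∀ i j, l i * l j * M i j ≤ M' i j) {c : ℝ} (hc : 0 ≤ c)
    (hdet : (c * ∏ i, l i) ^ 2 * |M.det| ≤ |M'.det|) :
    ENNReal.ofReal c * capVol M ≤ capVol M' := by
  have hl' : 0 < ∏ i, l i := Finset.prod_pos fun i _ => hl i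
  set f := Matrix.toLin' (Matrix.diagonal l) with hf
  have hfa : ∀ b i, f b i = l i * b i := fun b i => by
    rw [hf, Matrix.toLin'_apply, Matrix.mulVec_diagonal]
  have hsub : capSet M ⊆ f '' capSet M' := by
    rintro a ⟨ha, ha2⟩
    refine ⟨fun i => a i / l i, ⟨fun i => div_pos (ha i) (hl i), ha2.trans ?_⟩, ?_⟩
    · refine Finset.sum_le_sum fun i _ => Finset.sum_le_sum fun j _ => ?_
      have h1 := hl i
      have h2 := hl j
      calc a i * a j * M i j = (a i / l i) * (a j / l j) * (l i * l j * M i j) := by field_simp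
        _ ≤ _ := mul_le_mul_of_nonneg_left (hle i j)
          (mul_pos (div_pos (ha i) (hl i)) (div_pos (ha j) (hl j))).le
    · ext i
      rw [hfa]
      have h1 := hl i
      field_simp
  have hvol : volume (capSet M) ≤ ENNReal.ofReal (∏ i, l i) * volume (capSet M') := by
    refine (measure_mono hsub).trans_eq ?_
    rw [Measure.addHaar_image_linearMap, LinearMap.det_toLin', Matrix.det_diagonal,
      abs_of_pos hl']
  have hs : c * ∏ i, l i ≤ Real.sqrt |M'.det| / Real.sqrt |M.det| ∨ M.det = 0 := by
    by_cases h0 : M.det = 0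
    · exact Or.inr h0
    · left
      have h1 : 0 < |M.det| := abs_pos.2 h0
      rw [← Real.sqrt_div' _ h1.le]
      apply Real.le_sqrt_of_sq_le
      rwa [le_div_iff₀ h1]
  rcases hs with hs | hs
  · by_cases h0 : M.det = 0
    · simp [capVol, h0]
    have h1 : 0 < Real.sqrt |M.det| := Real.sqrt_pos.2 (abs_pos.2 h0)
    rw [le_div_iff₀ h1] at hs
    calc ENNReal.ofReal c * capVol M
        ≤ ENNReal.ofReal c * (ENNReal.ofReal (Real.sqrt |M.det|) *
          (ENNReal.ofReal (∏ i, l i) * volume (capSet M'))) := by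
          unfold capVol; gcongr
      _ = ENNReal.ofReal (c * (∏ i, l i) * Real.sqrt |M.det|) * volume (capSet M') := by
          rw [ENNReal.ofReal_mul (by positivity), ENNReal.ofReal_mul hc]
          ring
      _ ≤ _ := by unfold capVol; gcongr
  · simp [capVol, hs]

/-- The difference of two coordinates. -/
def coordDiff (i j : Fin 6) : (Fin 6 → ℝ) →ₗ[ℝ] ℝ :=
  LinearMap.proj (R := ℝ) (φ := fun _ => ℝ) i - LinearMap.proj (R := ℝ) (φ := fun _ => ℝ) j

lemma coordDiff_apply (i j : Fin 6) (a : Fin 6 → ℝ) : coordDiff i j a = a i - a j := rfl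

/-- Folding a set symmetric under the permutations of some of its coordinates. -/
theorem volume_eq_factorial_mul {k : ℕ} (ι : Fin k ↪ Fin 6) {H : Set (Fin 6 → ℝ)}
    (hH : MeasurableSet H)
    (hinv : ∀ σ : Equiv.Perm (Fin 6), (∀ i, i ∉ Set.range ι → σ i = i) →
      ∀ a, a ∈ H → a ∘ σ ∈ H) :
    volume H = (k.factorial : ℝ≥0∞) * volume (H ∩ {a | StrictAnti (a ∘ ι)}) := by
  classical
  set S : Set (Fin 6 → ℝ) := {a | StrictAnti (a ∘ ι)} with hS
  have hSm : MeasurableSet S := by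
    have : S = ⋂ i, ⋂ j, ⋂ _ : i < j, {a | a (ι j) < a (ι i)} := by
      ext a; simp [hS, StrictAnti]
    rw [this]
    refine MeasurableSet.iInter fun i => MeasurableSet.iInter fun j => MeasurableSet.iInter fun _ =>
      measurableSet_lt (by fun_prop) (by fun_prop)
  set R : Equiv.Perm (Fin k) → (Fin 6 → ℝ) → (Fin 6 → ℝ) :=
    fun σ a => a ∘ σ.viaFintypeEmbedding ι with hR
  have hRι : ∀ σ a, R σ a ∘ ι = (a ∘ ι) ∘ σ := by
    intro σ a
    ext i
    simp [hR, Equiv.Perm.viaFintypeEmbedding_apply_image]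
  have hRp : ∀ σ, MeasurePreserving (R σ) volume volume := by
    intro σ
    have := volume_measurePreserving_piCongrLeft (fun _ : Fin 6 => ℝ)
      (σ.viaFintypeEmbedding ι).symm
    convert this using 1
    ext a i
    have := Equiv.piCongrLeft_apply (fun _ : Fin 6 => ℝ) (σ.viaFintypeEmbedding ι).symm a i
    rw [MeasurableEquiv.coe_piCongrLeft, this]
    exact (eq_rec_constant _ _).symm
  have hRH : ∀ σ a, R σ a ∈ H ↔ a ∈ H := by
    intro σ a
    constructor
    · intro h
      have := hinv (σ.viaFintypeEmbedding ι).symm (fun i hi => by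
        rw [Equiv.symm_apply_eq, Equiv.Perm.viaFintypeEmbedding_apply_notMem_range _ _ hi]) _ h
      convert this using 1
      ext i
      simp [hR]
    · exact hinv _ (fun i hi => Equiv.Perm.viaFintypeEmbedding_apply_notMem_range _ _ hi) a
  have hdisj : Pairwise (Function.onFun Disjoint fun σ => R σ ⁻¹' (H ∩ S)) := by
    intro σ τ hst
    rw [Function.onFun, Set.disjoint_left]
    rintro a ⟨-, h1⟩ ⟨-, h2⟩
    rw [hS, mem_ofPred_eq, hRι] at h1 h2
    apply hst
    have h3 := Tuple.unique_antitone h1.antitone h2.antitone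
    have h4 : Function.Injective (a ∘ ι) := by
      have := h1.injective.comp σ.symm.injective
      rwa [Function.comp_assoc, Equiv.self_comp_symm, Function.comp_id] at this
    ext i
    rw [h4 (congrFun h3 i)]
  have hcov : H =ᵐ[volume] ⋃ σ, R σ ⁻¹' (H ∩ S) := by
    refine Filter.EventuallyLE.antisymm ?_ ?_
    · rw [ae_le_set]
      refine measure_mono_null (t := ⋃ i : Fin k, ⋃ j : Fin k, ⋃ _ : i ≠ j,
        {a | coordDiff (ι i) (ι j) a = 0}) ?_
        (measure_iUnion_null fun i => measure_iUnion_null fun j =>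
          measure_iUnion_null fun hij =>
            addHaar_ker_eq_zero (x := Pi.single (ι i) (1 : ℝ)) (μ := volume)
              (f := coordDiff (ι i) (ι j)) fun h0 => ?_)
      · rintro a ⟨haH, ha⟩
        by_contra hn
        simp only [mem_iUnion, mem_ofPred_eq, coordDiff_apply,
          sub_eq_zero, not_exists] at hn
        apply ha
        have hinj : Function.Injective (a ∘ ι) := fun i j hij => by
          by_contra hne
          exact hn i j hne hij
        have h1 := Tuple.monotone_sort (-(a ∘ ι))
        refine mem_iUnion.2 ⟨Tuple.sort (-(a ∘ ι)), (hRH _ _).2 haH, ?_⟩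
        rw [hS, mem_ofPred_eq, hRι]
        refine Antitone.strictAnti_of_injective (fun i j hij => ?_)
          (hinj.comp (Equiv.injective _))
        have := h1 hij
        simpa using this
      · have hne : ι j ≠ ι i := fun h => hij (ι.injective h).symm
        simp [hne, coordDiff_apply] at h0
    · refine LE.le.eventuallyLE (iUnion_subset fun σ a ha => (hRH σ a).1 ha.1)
  rw [measure_congr hcov, measure_iUnion hdisj fun σ =>
    (hRp σ).measurable (hH.inter hSm), tsum_fintype]
  rw [Finset.sum_congr rfl fun σ _ =>
    (hRp σ).measure_preimage (hH.inter hSm).nullMeasurableSet]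
  rw [Finset.sum_const, Finset.card_univ, Fintype.card_perm, Fintype.card_fin, nsmul_eq_mul]

/-- A unipotent change of generators carries truncated cones to truncated subcones. -/
lemma image_capSet (M T : Matrix (Fin 6) (Fin 6) ℝ) :
    Matrix.toLin' T '' capSet (T.transpose * M * T) =
      (Matrix.toLin' T '' {b | ∀ i, 0 < b i}) ∩ {a | -1 ≤ ∑ i, ∑ j, a i * a j * M i j} := by
  have key : ∀ b : Fin 6 → ℝ, ∑ i, ∑ j, b i * b j * (T.transpose * M * T) i j =
      ∑ i, ∑ j, Matrix.toLin' T b i * Matrix.toLin' T b j * M i j := by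
    have hq : ∀ (N : Matrix (Fin 6) (Fin 6) ℝ) (b : Fin 6 → ℝ),
        ∑ i, ∑ j, b i * b j * N i j = dotProduct b (N.mulVec b) := by
      intro N b
      simp only [dotProduct, Matrix.mulVec, Finset.mul_sum]
      exact Finset.sum_congr rfl fun i _ => Finset.sum_congr rfl fun j _ => by ring
    intro b
    rw [hq, hq, Matrix.toLin'_apply, ← Matrix.mulVec_mulVec, ← Matrix.mulVec_mulVec,
      Matrix.dotProduct_transpose_mulVec, dotProduct_comm]
  ext a
  constructor
  · rintro ⟨b, ⟨hb, hb2⟩, rfl⟩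
    exact ⟨⟨b, hb, rfl⟩, hb2.trans_eq (key b)⟩
  · rintro ⟨⟨b, hb, rfl⟩, hb2⟩
    exact ⟨b, ⟨hb, le_of_le_of_eq hb2 (key b).symm⟩, rfl⟩

end

/-! ## The twelve diagrams -/

/-- The Coxeter matrices of the non-compact hyperbolic Coxeter simplices of dimension five. -/
def simplexDiagram : Fin 12 → Matrix (Fin 6) (Fin 6) ℕ :=
  ![cmOfEdges 6 [(0, 4, 4), (0, 5, 3), (1, 2, 3), (2, 3, 3), (3, 4, 3)],
    cmOfEdges 6 [(0, 4, 3), (0, 5, 3), (1, 2, 3), (2, 3, 3), (3, 4, 4)],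
    cmOfEdges 6 [(0, 3, 3), (1, 2, 3), (2, 3, 3), (3, 4, 3), (4, 5, 4)],
    cmOfEdges 6 [(0, 4, 4), (0, 5, 3), (1, 3, 4), (2, 3, 3), (2, 4, 3)],
    cmOfEdges 6 [(0, 4, 4), (0, 5, 3), (1, 2, 3), (2, 3, 3), (2, 4, 3)],
    cmOfEdges 6 [(0, 3, 3), (0, 5, 4), (1, 2, 4), (2, 3, 3), (3, 4, 3)],
    cmOfEdges 6 [(0, 2, 3), (0, 3, 3), (0, 4, 3), (0, 5, 3), (1, 2, 4)],
    cmOfEdges 6 [(0, 4, 3), (0, 5, 3), (1, 2, 3), (1, 5, 3), (2, 3, 3), (3, 4, 4)],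
    cmOfEdges 6 [(0, 1, 3), (0, 5, 4), (1, 2, 3), (2, 3, 4), (3, 4, 3), (4, 5, 3)],
    cmOfEdges 6 [(0, 2, 3), (0, 5, 3), (1, 2, 3), (2, 3, 3), (3, 4, 3), (4, 5, 3)],
    cmOfEdges 6 [(0, 1, 3), (0, 2, 3), (0, 3, 3), (0, 4, 3), (1, 5, 3)],
    cmOfEdges 6 [(0, 1, 3), (0, 2, 3), (0, 3, 3), (0, 4, 3), (0, 5, 3)]]

/-- The number `-2 cos (π / m)` for `m ≤ 4`. -/
def weight : ℕ → ℤ√2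
  | 1 => 2
  | 3 => -1
  | 4 => ⟨0, -1⟩
  | _ => 0

/-- The Gram matrices, multiplied by two. -/
def simplexGram (t : Fin 12) (i j : Fin 6) : ℤ√2 := weight (simplexDiagram t i j)

/-- The determinants of the doubled Gram matrices. -/
def simplexDet : Fin 12 → ℤ√2 :=
  ![⟨-1, 0⟩, ⟨-2, 0⟩, ⟨-2, 0⟩, ⟨-2, 0⟩, ⟨-4, 0⟩, ⟨-4, 0⟩, ⟨-8, 0⟩, ⟨-3, -2⟩, ⟨-8, 0⟩, ⟨-5, 0⟩, ⟨-4, 0⟩, ⟨-16, 0⟩]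

/-- The adjugates of the doubled Gram matrices. -/
def simplexAdj : Fin 12 → Fin 6 → Fin 6 → ℤ√2 :=
  ![![![⟨10, 0⟩, ⟨0, 2⟩, ⟨0, 4⟩, ⟨0, 6⟩, ⟨0, 8⟩, ⟨5, 0⟩],
      ![⟨0, 2⟩, ⟨0, 0⟩, ⟨1, 0⟩, ⟨2, 0⟩, ⟨3, 0⟩, ⟨0, 1⟩],
      ![⟨0, 4⟩, ⟨1, 0⟩, ⟨2, 0⟩, ⟨4, 0⟩, ⟨6, 0⟩, ⟨0, 2⟩],
      ![⟨0, 6⟩, ⟨2, 0⟩, ⟨4, 0⟩, ⟨6, 0⟩, ⟨9, 0⟩, ⟨0, 3⟩],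
      ![⟨0, 8⟩, ⟨3, 0⟩, ⟨6, 0⟩, ⟨9, 0⟩, ⟨12, 0⟩, ⟨0, 4⟩],
      ![⟨5, 0⟩, ⟨0, 1⟩, ⟨0, 2⟩, ⟨0, 3⟩, ⟨0, 4⟩, ⟨2, 0⟩]],
    ![![⟨4, 0⟩, ⟨0, 2⟩, ⟨0, 4⟩, ⟨0, 6⟩, ⟨8, 0⟩, ⟨2, 0⟩],
      ![⟨0, 2⟩, ⟨0, 0⟩, ⟨2, 0⟩, ⟨4, 0⟩, ⟨0, 3⟩, ⟨0, 1⟩],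
      ![⟨0, 4⟩, ⟨2, 0⟩, ⟨4, 0⟩, ⟨8, 0⟩, ⟨0, 6⟩, ⟨0, 2⟩],
      ![⟨0, 6⟩, ⟨4, 0⟩, ⟨8, 0⟩, ⟨12, 0⟩, ⟨0, 9⟩, ⟨0, 3⟩],
      ![⟨8, 0⟩, ⟨0, 3⟩, ⟨0, 6⟩, ⟨0, 9⟩, ⟨12, 0⟩, ⟨4, 0⟩],
      ![⟨2, 0⟩, ⟨0, 1⟩, ⟨0, 2⟩, ⟨0, 3⟩, ⟨4, 0⟩, ⟨0, 0⟩]],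
    ![![⟨2, 0⟩, ⟨2, 0⟩, ⟨4, 0⟩, ⟨6, 0⟩, ⟨6, 0⟩, ⟨0, 3⟩],
      ![⟨2, 0⟩, ⟨0, 0⟩, ⟨2, 0⟩, ⟨4, 0⟩, ⟨4, 0⟩, ⟨0, 2⟩],
      ![⟨4, 0⟩, ⟨2, 0⟩, ⟨4, 0⟩, ⟨8, 0⟩, ⟨8, 0⟩, ⟨0, 4⟩],
      ![⟨6, 0⟩, ⟨4, 0⟩, ⟨8, 0⟩, ⟨12, 0⟩, ⟨12, 0⟩, ⟨0, 6⟩],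
      ![⟨6, 0⟩, ⟨4, 0⟩, ⟨8, 0⟩, ⟨12, 0⟩, ⟨10, 0⟩, ⟨0, 5⟩],
      ![⟨0, 3⟩, ⟨0, 2⟩, ⟨0, 4⟩, ⟨0, 6⟩, ⟨0, 5⟩, ⟨4, 0⟩]],
    ![![⟨4, 0⟩, ⟨4, 0⟩, ⟨0, 4⟩, ⟨0, 4⟩, ⟨0, 4⟩, ⟨2, 0⟩],
      ![⟨4, 0⟩, ⟨0, 0⟩, ⟨0, 2⟩, ⟨0, 1⟩, ⟨0, 3⟩, ⟨2, 0⟩],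
      ![⟨0, 4⟩, ⟨0, 2⟩, ⟨4, 0⟩, ⟨4, 0⟩, ⟨6, 0⟩, ⟨0, 2⟩],
      ![⟨0, 4⟩, ⟨0, 1⟩, ⟨4, 0⟩, ⟨2, 0⟩, ⟨6, 0⟩, ⟨0, 2⟩],
      ![⟨0, 4⟩, ⟨0, 3⟩, ⟨6, 0⟩, ⟨6, 0⟩, ⟨6, 0⟩, ⟨0, 2⟩],
      ![⟨2, 0⟩, ⟨2, 0⟩, ⟨0, 2⟩, ⟨0, 2⟩, ⟨0, 2⟩, ⟨0, 0⟩]],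
    ![![⟨8, 0⟩, ⟨0, 4⟩, ⟨0, 8⟩, ⟨0, 4⟩, ⟨0, 8⟩, ⟨4, 0⟩],
      ![⟨0, 4⟩, ⟨0, 0⟩, ⟨4, 0⟩, ⟨2, 0⟩, ⟨6, 0⟩, ⟨0, 2⟩],
      ![⟨0, 8⟩, ⟨4, 0⟩, ⟨8, 0⟩, ⟨4, 0⟩, ⟨12, 0⟩, ⟨0, 4⟩],
      ![⟨0, 4⟩, ⟨2, 0⟩, ⟨4, 0⟩, ⟨0, 0⟩, ⟨6, 0⟩, ⟨0, 2⟩],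
      ![⟨0, 8⟩, ⟨6, 0⟩, ⟨12, 0⟩, ⟨6, 0⟩, ⟨12, 0⟩, ⟨0, 4⟩],
      ![⟨4, 0⟩, ⟨0, 2⟩, ⟨0, 4⟩, ⟨0, 2⟩, ⟨0, 4⟩, ⟨0, 0⟩]],
    ![![⟨4, 0⟩, ⟨0, 4⟩, ⟨8, 0⟩, ⟨8, 0⟩, ⟨4, 0⟩, ⟨0, 2⟩],
      ![⟨0, 4⟩, ⟨0, 0⟩, ⟨0, 2⟩, ⟨0, 4⟩, ⟨0, 2⟩, ⟨4, 0⟩],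
      ![⟨8, 0⟩, ⟨0, 2⟩, ⟨4, 0⟩, ⟨8, 0⟩, ⟨4, 0⟩, ⟨0, 4⟩],
      ![⟨8, 0⟩, ⟨0, 4⟩, ⟨8, 0⟩, ⟨8, 0⟩, ⟨4, 0⟩, ⟨0, 4⟩],
      ![⟨4, 0⟩, ⟨0, 2⟩, ⟨4, 0⟩, ⟨4, 0⟩, ⟨0, 0⟩, ⟨0, 2⟩],
      ![⟨0, 2⟩, ⟨4, 0⟩, ⟨0, 4⟩, ⟨0, 4⟩, ⟨0, 2⟩, ⟨0, 0⟩]],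
    ![![⟨16, 0⟩, ⟨0, 8⟩, ⟨16, 0⟩, ⟨8, 0⟩, ⟨8, 0⟩, ⟨8, 0⟩],
      ![⟨0, 8⟩, ⟨0, 0⟩, ⟨0, 4⟩, ⟨0, 4⟩, ⟨0, 4⟩, ⟨0, 4⟩],
      ![⟨16, 0⟩, ⟨0, 4⟩, ⟨8, 0⟩, ⟨8, 0⟩, ⟨8, 0⟩, ⟨8, 0⟩],
      ![⟨8, 0⟩, ⟨0, 4⟩, ⟨8, 0⟩, ⟨0, 0⟩, ⟨4, 0⟩, ⟨4, 0⟩],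
      ![⟨8, 0⟩, ⟨0, 4⟩, ⟨8, 0⟩, ⟨4, 0⟩, ⟨0, 0⟩, ⟨4, 0⟩],
      ![⟨8, 0⟩, ⟨0, 4⟩, ⟨8, 0⟩, ⟨4, 0⟩, ⟨4, 0⟩, ⟨0, 0⟩]],
    ![![⟨2, 0⟩, ⟨2, 2⟩, ⟨2, 3⟩, ⟨2, 4⟩, ⟨5, 1⟩, ⟨2, 1⟩],
      ![⟨2, 2⟩, ⟨0, 0⟩, ⟨2, 1⟩, ⟨4, 2⟩, ⟨3, 3⟩, ⟨1, 1⟩],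
      ![⟨2, 3⟩, ⟨2, 1⟩, ⟨2, 0⟩, ⟨5, 1⟩, ⟨2, 4⟩, ⟨2, 2⟩],
      ![⟨2, 4⟩, ⟨4, 2⟩, ⟨5, 1⟩, ⟨6, 0⟩, ⟨1, 5⟩, ⟨3, 3⟩],
      ![⟨5, 1⟩, ⟨3, 3⟩, ⟨2, 4⟩, ⟨1, 5⟩, ⟨6, 0⟩, ⟨4, 2⟩],
      ![⟨2, 1⟩, ⟨1, 1⟩, ⟨2, 2⟩, ⟨3, 3⟩, ⟨4, 2⟩, ⟨0, 0⟩]],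
    ![![⟨0, 0⟩, ⟨4, 0⟩, ⟨8, 0⟩, ⟨0, 6⟩, ⟨0, 4⟩, ⟨0, 2⟩],
      ![⟨4, 0⟩, ⟨0, 0⟩, ⟨4, 0⟩, ⟨0, 4⟩, ⟨0, 4⟩, ⟨0, 4⟩],
      ![⟨8, 0⟩, ⟨4, 0⟩, ⟨0, 0⟩, ⟨0, 2⟩, ⟨0, 4⟩, ⟨0, 6⟩],
      ![⟨0, 6⟩, ⟨0, 4⟩, ⟨0, 2⟩, ⟨0, 0⟩, ⟨4, 0⟩, ⟨8, 0⟩],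
      ![⟨0, 4⟩, ⟨0, 4⟩, ⟨0, 4⟩, ⟨4, 0⟩, ⟨0, 0⟩, ⟨4, 0⟩],
      ![⟨0, 2⟩, ⟨0, 4⟩, ⟨0, 6⟩, ⟨8, 0⟩, ⟨4, 0⟩, ⟨0, 0⟩]],
    ![![⟨6, 0⟩, ⟨5, 0⟩, ⟨10, 0⟩, ⟨9, 0⟩, ⟨8, 0⟩, ⟨7, 0⟩],
      ![⟨5, 0⟩, ⟨0, 0⟩, ⟨5, 0⟩, ⟨5, 0⟩, ⟨5, 0⟩, ⟨5, 0⟩],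
      ![⟨10, 0⟩, ⟨5, 0⟩, ⟨10, 0⟩, ⟨10, 0⟩, ⟨10, 0⟩, ⟨10, 0⟩],
      ![⟨9, 0⟩, ⟨5, 0⟩, ⟨10, 0⟩, ⟨6, 0⟩, ⟨7, 0⟩, ⟨8, 0⟩],
      ![⟨8, 0⟩, ⟨5, 0⟩, ⟨10, 0⟩, ⟨7, 0⟩, ⟨4, 0⟩, ⟨6, 0⟩],
      ![⟨7, 0⟩, ⟨5, 0⟩, ⟨10, 0⟩, ⟨8, 0⟩, ⟨6, 0⟩, ⟨4, 0⟩]],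
    ![![⟨24, 0⟩, ⟨16, 0⟩, ⟨12, 0⟩, ⟨12, 0⟩, ⟨12, 0⟩, ⟨8, 0⟩],
      ![⟨16, 0⟩, ⟨8, 0⟩, ⟨8, 0⟩, ⟨8, 0⟩, ⟨8, 0⟩, ⟨4, 0⟩],
      ![⟨12, 0⟩, ⟨8, 0⟩, ⟨4, 0⟩, ⟨6, 0⟩, ⟨6, 0⟩, ⟨4, 0⟩],
      ![⟨12, 0⟩, ⟨8, 0⟩, ⟨6, 0⟩, ⟨4, 0⟩, ⟨6, 0⟩, ⟨4, 0⟩],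
      ![⟨12, 0⟩, ⟨8, 0⟩, ⟨6, 0⟩, ⟨6, 0⟩, ⟨4, 0⟩, ⟨4, 0⟩],
      ![⟨8, 0⟩, ⟨4, 0⟩, ⟨4, 0⟩, ⟨4, 0⟩, ⟨4, 0⟩, ⟨0, 0⟩]],
    ![![⟨32, 0⟩, ⟨16, 0⟩, ⟨16, 0⟩, ⟨16, 0⟩, ⟨16, 0⟩, ⟨16, 0⟩],
      ![⟨16, 0⟩, ⟨0, 0⟩, ⟨8, 0⟩, ⟨8, 0⟩, ⟨8, 0⟩, ⟨8, 0⟩],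
      ![⟨16, 0⟩, ⟨8, 0⟩, ⟨0, 0⟩, ⟨8, 0⟩, ⟨8, 0⟩, ⟨8, 0⟩],
      ![⟨16, 0⟩, ⟨8, 0⟩, ⟨8, 0⟩, ⟨0, 0⟩, ⟨8, 0⟩, ⟨8, 0⟩],
      ![⟨16, 0⟩, ⟨8, 0⟩, ⟨8, 0⟩, ⟨8, 0⟩, ⟨0, 0⟩, ⟨8, 0⟩],
      ![⟨16, 0⟩, ⟨8, 0⟩, ⟨8, 0⟩, ⟨8, 0⟩, ⟨8, 0⟩, ⟨0, 0⟩]]]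

/-- Multipliers comparing the volumes of simplices. -/
def stretch : Fin 10 → Fin 6 → ℕ :=
  ![![501, 708, 708, 708, 708, 501],
    ![1001, 708, 708, 708, 1001, 1001],
    ![1415, 708, 708, 708, 1096, 517],
    ![1001, 2001, 1415, 943, 708, 1001],
    ![1001, 1415, 1415, 472, 708, 1001],
    ![817, 1733, 1225, 817, 307, 1155],
    ![1001, 1415, 1001, 501, 334, 1001],
    ![616, 1347, 871, 871, 616, 953],
    ![578, 1155, 867, 613, 409, 1225],
    ![849, 1415, 1415, 708, 472, 378]]

/-- Sparse Laplace expansion along the first row. -/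
def laplaceDet : (n : ℕ) → (Fin n → Fin n → ℤ√2) → ℤ√2
  | 0, _ => 1
  | n + 1, M => ∑ j : Fin (n + 1), if M 0 j = 0 then 0 else
      (-1) ^ (j : ℕ) * M 0 j * laplaceDet n fun a b => M a.succ (j.succAbove b)

lemma laplaceDet_eq (n : ℕ) (M : Fin n → Fin n → ℤ√2) :
    laplaceDet n M = (Matrix.of M).det := by
  induction n with
  | zero => simp [laplaceDet]
  | succ n ih =>
    rw [Matrix.det_succ_row_zero]
    refine Finset.sum_congr rfl fun j _ => ?_
    split_ifs with h
    · simp [h]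
    · rw [ih]; rfl

lemma laplaceDet_simplexGram : ∀ t, laplaceDet 6 (simplexGram t) = simplexDet t := by
  decide +kernel

lemma simplexGram_mul_adj : ∀ t i j,
    ∑ k, simplexGram t i k * simplexAdj t k j = if i = j then simplexDet t else 0 := by
  decide +kernel

/-- The embedding of `ℤ[√2]` into the real numbers. -/
def rootTwo : ℤ√2 →+* ℝ := Zsqrtd.toReal (by norm_num)

lemma rootTwo_apply (x : ℤ√2) : rootTwo x = x.re + x.im * √2 := by
  simp [rootTwo, Zsqrtd.toReal]

/-- A decidable sufficient condition for an element of `ℤ[√2]` to be nonnegative. -/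
def nonnegTest (x : ℤ√2) : Bool :=
  decide (0 ≤ 10000 * x.re + 14142 * x.im) && decide (0 ≤ 10000 * x.re + 14143 * x.im)

lemma rootTwo_nonneg {x : ℤ√2} (h : nonnegTest x = true) : 0 ≤ rootTwo x := by
  simp only [nonnegTest, Bool.and_eq_true, decide_eq_true_eq] at h
  obtain ⟨h1, h2⟩ := h
  have h1' : (0 : ℝ) ≤ 10000 * x.re + 14142 * x.im := by exact_mod_cast h1
  have h2' : (0 : ℝ) ≤ 10000 * x.re + 14143 * x.im := by exact_mod_cast h2
  have s1 : (1.4142 : ℝ) ≤ √2 := Real.le_sqrt_of_sq_le (by norm_num)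
  have s2 : √2 ≤ (1.4143 : ℝ) := Real.sqrt_le_iff.2 (by norm_num)
  rw [rootTwo_apply]
  rcases le_total 0 (x.im : ℝ) with h | h
  · nlinarith
  · nlinarith

lemma simplexDet_neg (t : Fin 12) : rootTwo (simplexDet t) < 0 := by
  have h : ∀ t, nonnegTest (-simplexDet t - 1) = true := by decide +kernel
  have := rootTwo_nonneg (h t)
  simp only [map_sub, map_neg, map_one] at this
  linarith

/-! ## Comparing volumes -/

/-- The Gram matrix of the generators of a simplex, from the adjugate `A` and the determinant `D`
of the doubled Gram matrix of its normals. -/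
def gramOfAdj (A : Fin 6 → Fin 6 → ℤ√2) (D : ℤ√2) : Matrix (Fin 6) (Fin 6) ℝ :=
  Matrix.of fun i j => 2 * rootTwo (A i j) / rootTwo D

lemma det_gramOfAdj (t : Fin 12) :
    (gramOfAdj (simplexAdj t) (simplexDet t)).det = 64 / rootTwo (simplexDet t) := by
  set D := rootTwo (simplexDet t) with hD
  have hD0 : D ≠ 0 := (simplexDet_neg t).ne
  have h1 : ((Matrix.of (simplexGram t)).map rootTwo).det = D := by
    rw [← RingHom.mapMatrix_apply, ← RingHom.map_det, ← laplaceDet_eq, laplaceDet_simplexGram]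
  have h2 : (Matrix.of (simplexGram t)).map rootTwo *
      gramOfAdj (simplexAdj t) (simplexDet t) = (2 : ℝ) • (1 : Matrix (Fin 6) (Fin 6) ℝ) := by
    ext i j
    have := congrArg rootTwo (simplexGram_mul_adj t i j)
    rw [map_sum] at this
    simp only [map_mul] at this
    simp only [Matrix.mul_apply, Matrix.map_apply, Matrix.of_apply, gramOfAdj, Matrix.smul_apply,
      Matrix.one_apply, smul_eq_mul]
    have h3 : ∀ k, rootTwo (simplexGram t i k) * (2 * rootTwo (simplexAdj t k j) / D)
        = 2 / D * (rootTwo (simplexGram t i k) * rootTwo (simplexAdj t k j)) := fun k => by ring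
    rw [← hD]
    simp only [h3, ← Finset.mul_sum]
    rw [this]
    split_ifs
    · rw [← hD]; field_simp
    · simp
  have h3 := congrArg Matrix.det h2
  rw [Matrix.det_mul, h1, Matrix.det_smul, Matrix.det_one] at h3
  rw [eq_div_iff hD0, mul_comm, h3]
  norm_num

/-- A decidable sufficient condition for `p / q` times the volume of a simplex to be bounded by
the volume of another one. -/
def volTest (A A' : Fin 6 → Fin 6 → ℤ√2) (D D' : ℤ√2) (l : Fin 6 → ℕ) (p q : ℕ) : Bool :=
  decide (∀ i j, nonnegTest (10 ^ 6 * A' i j * D - l i * l j * A i j * D') = true) &&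
    (nonnegTest (((p * ∏ i, l i) ^ 2 : ℕ) * D' - ((q * 10 ^ 18) ^ 2 : ℕ) * D) &&
      decide (∀ i, 0 < l i))

lemma capVol_le_of_volTest {A A' : Fin 6 → Fin 6 → ℤ√2} {D D' : ℤ√2} {l : Fin 6 → ℕ} {p q : ℕ}
    (hq : 0 < q) (hD : rootTwo D < 0) (hD' : rootTwo D' < 0)
    (hA : (gramOfAdj A D).det = 64 / rootTwo D) (hA' : (gramOfAdj A' D').det = 64 / rootTwo D')
    (h : volTest A A' D D' l p q = true) :
    ENNReal.ofReal (p / q) * capVol (gramOfAdj A D) ≤ capVol (gramOfAdj A' D') := by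
  simp only [volTest, Bool.and_eq_true, decide_eq_true_eq] at h
  obtain ⟨h1, h2, h3⟩ := h
  have hq' : (0 : ℝ) < q := by exact_mod_cast hq
  refine capVol_le_of_le (l := fun i => (l i : ℝ) / 1000) (fun i => ?_) (fun i j => ?_)
    (by positivity) ?_
  · have := h3 i; positivity
  · have := rootTwo_nonneg (h1 i j)
    simp only [map_sub, map_mul, map_pow, map_natCast, map_ofNat] at this
    simp only [gramOfAdj, Matrix.of_apply]
    have hp : 0 < rootTwo D * rootTwo D' := mul_pos_of_neg_of_neg hD hD'
    rw [← sub_nonneg]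
    have e : 2 * rootTwo (A' i j) / rootTwo D' -
        (l i : ℝ) / 1000 * ((l j : ℝ) / 1000) * (2 * rootTwo (A i j) / rootTwo D) =
        2 / 10 ^ 6 * ((10 ^ 6 * rootTwo (A' i j) * rootTwo D - l i * l j * rootTwo (A i j) *
          rootTwo D') / (rootTwo D * rootTwo D')) := by
      have := hD.ne; have := hD'.ne
      field_simp
      ring
    rw [e]
    exact mul_nonneg (by positivity) (div_nonneg (this.trans_eq (by norm_num)) hp.le)
  · have := rootTwo_nonneg h2
    simp only [map_sub, map_mul, map_natCast] at this
    push_cast at this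
    rw [hA, hA', abs_div, abs_div, abs_of_neg hD, abs_of_neg hD',
      Finset.prod_div_distrib, Finset.prod_const, Finset.card_univ, Fintype.card_fin]
    have hp : 0 < rootTwo D * rootTwo D' := mul_pos_of_neg_of_neg hD hD'
    rw [← sub_nonneg]
    have e : |(64 : ℝ)| / -rootTwo D' - (((p : ℝ) / q) * ((∏ i, (l i : ℝ)) / 1000 ^ 6)) ^ 2 *
        (|(64 : ℝ)| / -rootTwo D) = 64 / (q * 10 ^ 18) ^ 2 * ((((p : ℝ) * ∏ i, (l i : ℝ)) ^ 2 *
          rootTwo D' - (q * 10 ^ 18) ^ 2 * rootTwo D) / (rootTwo D * rootTwo D')) := by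
      have := hD.ne; have := hD'.ne
      rw [abs_of_pos (by norm_num : (0:ℝ) < 64)]
      field_simp
      ring
    rw [e]
    exact mul_nonneg (by positivity) (div_nonneg (this.trans_eq (by norm_num)) hp.le)

/-! ### The star and its symmetries -/

/-- The change of coordinates onto the chamber in which the coordinates `1, …, k` decrease. -/
def chamberMat (k : ℕ) (i j : Fin 6) : ℤ√2 :=
  if i = j ∨ (1 ≤ (i : ℕ) ∧ i ≤ j ∧ (j : ℕ) ≤ k) then 1 else 0

/-- The adjugate matrix of the star in the coordinates of a chamber. -/
def chamberAdj (k : ℕ) (i j : Fin 6) : ℤ√2 :=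
  ∑ p, ∑ q, chamberMat k p i * simplexAdj 11 p q * chamberMat k q j

lemma volTest_small : ∀ t : Fin 3, volTest (simplexAdj (t.castLE (by norm_num))) (chamberAdj 4)
    (simplexDet (t.castLE (by norm_num))) (simplexDet 11) (stretch (t.castLE (by norm_num))) 9 10
    = true := by
  decide +kernel

lemma volTest_large : ∀ t : Fin 9, 3 ≤ t → volTest (chamberAdj 4)
    (simplexAdj (t.castLE (by norm_num))) (simplexDet 11) (simplexDet (t.castLE (by norm_num)))
    (stretch (t.castLE (by norm_num))) 5 4 = true := by
  decide +kernel

lemma volTest_pentagon : volTest (chamberAdj 5) (simplexAdj 9) (simplexDet 11) (simplexDet 9)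
    (stretch 9) 13 2 = true := by
  decide +kernel

section

/-- The normals of a frame realize one of the twelve diagrams. -/
def HasDiagram (e : Fin 6 → EuclideanSpace ℝ (Fin (5 + 1))) (t : Fin 12) : Prop :=
  ∀ i j, 2 * mink 5 (e i) (e j) = rootTwo (simplexGram t i j)

variable {e : Fin 6 → EuclideanSpace ℝ (Fin (5 + 1))} {P : Set ↥(hypSet 5)} {t : Fin 12}

lemma IsFrame.minkGram_dual (h : IsFrame e P) (ht : HasDiagram e t) :
    minkGram h.dual = gramOfAdj (simplexAdj t) (simplexDet t) := by
  have hD := (simplexDet_neg t).ne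
  have hu : ∀ j, h.dual j =
      ∑ k, (-(2 * rootTwo (simplexAdj t k j) / rootTwo (simplexDet t))) • e k := fun j => by
    rw [← sub_eq_zero]
    refine h.ker fun i => ?_
    have h1 := congrArg rootTwo (simplexGram_mul_adj t i j)
    rw [map_sum] at h1
    simp only [map_mul] at h1
    rw [mink_sub_right, h.mink_dual, mink_sum_right]
    have h2 : ∀ k, mink 5 (e i)
        ((-(2 * rootTwo (simplexAdj t k j) / rootTwo (simplexDet t))) • e k) =
        -(1 / rootTwo (simplexDet t)) *
          (rootTwo (simplexGram t i k) * rootTwo (simplexAdj t k j)) := fun k => by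
      rw [mink_smul_right, ← ht i k]; ring
    simp only [h2, ← Finset.mul_sum, h1]
    split_ifs
    · field_simp; ring
    · simp
  ext i j
  simp only [minkGram, Matrix.of_apply, gramOfAdj]
  conv_lhs => rw [hu j]
  rw [mink_sum_right, Finset.sum_eq_single i]
  · rw [mink_smul_right, mink_comm, h.mink_dual]; simp
  · intro k _ hk
    rw [mink_smul_right, mink_comm, h.mink_dual, if_neg hk, mul_zero]
  · simp

lemma IsFrame.hVol_eq_of_hasDiagram (h : IsFrame e P) (ht : HasDiagram e t) :
    hVol 5 P = 6 * capVol (gramOfAdj (simplexAdj t) (simplexDet t)) := by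
  rw [h.hVol_eq, h.minkGram_dual ht]

lemma IsFrame.ncard_idealVerts (h : IsFrame e P) (ht : HasDiagram e t) :
    (hIdealVerts 5 P).ncard = (Finset.univ.filter fun i => simplexAdj t i i = 0).card := by
  have hinj : Function.Injective rootTwo := Zsqrtd.toReal_injective _ fun n => by
    rcases le_or_gt (|n|) 1 with h | h
    · have := abs_le.1 h
      obtain ⟨h1, h2⟩ := this
      interval_cases n <;> norm_num
    · have := abs_mul_abs_self n
      nlinarith
  have h0 : ∀ i, mink 5 (h.dual i) (h.dual i) = 0 ↔ simplexAdj t i i = 0 := fun i => by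
    have := congrFun (congrFun (h.minkGram_dual ht) i) i
    simp only [minkGram, Matrix.of_apply, gramOfAdj] at this
    rw [this, div_eq_zero_iff, or_iff_left (simplexDet_neg t).ne, mul_eq_zero,
      or_iff_right two_ne_zero, map_eq_zero_iff _ hinj]
  have hpos : ∀ i, (h.dual i) 0 ≠ 0 := fun i => (fut_pos (h.dual_fut i) (h.dual_ne_zero i)).ne'
  rw [h.idealVerts, ← Set.ncard_coe_finset]
  refine (Set.ncard_congr (fun i _ => ((h.dual i) 0)⁻¹ • h.dual i) ?_ ?_ ?_).symm
  · intro i hi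
    exact ⟨i, (h0 i).2 (by simpa using hi), rfl⟩
  · intro i j _ _ hij
    by_contra hne
    have := congrArg (mink 5 (e i)) hij
    simp only [mink_smul_right, h.mink_dual, if_neg hne, if_true, mul_zero] at this
    exact hpos i (by simpa using this)
  · rintro w ⟨i, hi, rfl⟩
    exact ⟨i, by simpa using (h0 i).1 hi, rfl⟩

lemma eq_eleven_of_card : ∀ t : Fin 12,
    (Finset.univ.filter fun i => simplexAdj t i i = 0).card = 5 → t = 11 := by
  decide +kernel

end

/-- The coordinates `1, …, k`. -/
def leafEmb (k : ℕ) (hk : k ≤ 5) : Fin k ↪ Fin 6 :=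
  ⟨fun i => ⟨i + 1, by omega⟩, fun i j h => by simpa [Fin.ext_iff] using h⟩

/-- The real matrix of the change of coordinates onto a chamber. -/
def chamberReal (k : ℕ) : Matrix (Fin 6) (Fin 6) ℝ := (Matrix.of (chamberMat k)).map rootTwo

lemma chamberReal_apply (k : ℕ) (i j : Fin 6) : chamberReal k i j =
    if i = j ∨ (1 ≤ (i : ℕ) ∧ i ≤ j ∧ (j : ℕ) ≤ k) then 1 else 0 := by
  simp only [chamberReal, Matrix.map_apply, Matrix.of_apply, chamberMat]
  split_ifs <;> simp

lemma det_chamberReal (k : ℕ) : (chamberReal k).det = 1 := by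
  rw [Matrix.det_of_isUpperTriangular]
  · simp [chamberReal_apply]
  · intro i j hij
    have hij : j < i := hij
    rw [chamberReal_apply, if_neg]
    rintro (h | h)
    · exact hij.ne' h
    · exact absurd h.2.1 (not_le.2 hij)

lemma gramOfAdj_chamberAdj (k : ℕ) : gramOfAdj (chamberAdj k) (simplexDet 11) =
    (chamberReal k).transpose * gramOfAdj (simplexAdj 11) (simplexDet 11) * chamberReal k := by
  ext i j
  simp only [gramOfAdj, Matrix.of_apply, chamberAdj, map_sum, map_mul, Matrix.mul_apply,
    Matrix.transpose_apply, Finset.sum_mul, Finset.mul_sum, Finset.sum_div]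
  rw [Finset.sum_comm]
  refine Finset.sum_congr rfl fun p _ => Finset.sum_congr rfl fun q _ => ?_
  simp only [chamberReal, Matrix.map_apply, Matrix.of_apply]
  ring

lemma det_gramOfAdj_chamberAdj (k : ℕ) :
    (gramOfAdj (chamberAdj k) (simplexDet 11)).det = 64 / rootTwo (simplexDet 11) := by
  rw [gramOfAdj_chamberAdj, Matrix.det_mul, Matrix.det_mul, Matrix.det_transpose,
    det_chamberReal, det_gramOfAdj, one_mul, mul_one]

lemma capSet_star_comp {σ : Equiv.Perm (Fin 6)} (hσ : σ 0 = 0) {a : Fin 6 → ℝ}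
    (ha : a ∈ capSet (gramOfAdj (simplexAdj 11) (simplexDet 11))) :
    a ∘ σ ∈ capSet (gramOfAdj (simplexAdj 11) (simplexDet 11)) := by
  have hform : ∀ i j : Fin 6, simplexAdj 11 i j =
      if i = 0 then if j = 0 then simplexAdj 11 0 0 else simplexAdj 11 0 1
      else if j = 0 then simplexAdj 11 0 1 else if i = j then simplexAdj 11 1 1
        else simplexAdj 11 1 2 := by decide +kernel
  have h0 : ∀ i, σ i = 0 ↔ i = 0 := fun i => by
    conv_lhs => rw [← hσ]
    exact σ.injective.eq_iff
  have hinv : ∀ i j, simplexAdj 11 (σ i) (σ j) = simplexAdj 11 i j := fun i j => by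
    rw [hform (σ i) (σ j), hform i j]
    simp only [h0, σ.injective.eq_iff]
  refine ⟨fun i => ha.1 _, ha.2.trans_eq ?_⟩
  rw [← Equiv.sum_comp σ]
  refine Finset.sum_congr rfl fun i _ => ?_
  rw [← Equiv.sum_comp σ]
  refine Finset.sum_congr rfl fun j _ => ?_
  simp only [gramOfAdj, Matrix.of_apply, hinv, Function.comp_apply]

lemma capVol_star_of_image {k : ℕ} (hk : k ≤ 5)
    (himg : Matrix.toLin' (chamberReal k) '' {b | ∀ i, 0 < b i} =
      {a | ∀ i, 0 < a i} ∩ {a | StrictAnti (a ∘ leafEmb k hk)}) :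
    capVol (gramOfAdj (simplexAdj 11) (simplexDet 11)) =
      (k.factorial : ℝ≥0∞) * capVol (gramOfAdj (chamberAdj k) (simplexDet 11)) := by
  set M := gramOfAdj (simplexAdj 11) (simplexDet 11) with hM
  have h1 := volume_eq_factorial_mul (leafEmb k hk) (measurableSet_capSet M) fun σ hσ a ha =>
    capSet_star_comp (hσ 0 fun ⟨_, hi⟩ => Nat.succ_ne_zero _ (congrArg Fin.val hi)) ha
  have h2 : capSet M ∩ {a | StrictAnti (a ∘ leafEmb k hk)} = Matrix.toLin' (chamberReal k) ''
      capSet (gramOfAdj (chamberAdj k) (simplexDet 11)) := by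
    rw [gramOfAdj_chamberAdj, image_capSet, himg, inter_right_comm]
    rfl
  have h3 : volume (Matrix.toLin' (chamberReal k) ''
      capSet (gramOfAdj (chamberAdj k) (simplexDet 11))) =
      volume (capSet (gramOfAdj (chamberAdj k) (simplexDet 11))) := by
    rw [Measure.addHaar_image_linearMap, LinearMap.det_toLin', det_chamberReal]
    simp
  rw [capVol, capVol, h1, h2, h3, det_gramOfAdj_chamberAdj, hM, det_gramOfAdj]
  ring

lemma chamberReal_apply_vec (k : ℕ) (b : Fin 6 → ℝ) (i : Fin 6) :
    Matrix.toLin' (chamberReal k) b i =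
      ∑ j, if i = j ∨ (1 ≤ (i : ℕ) ∧ i ≤ j ∧ (j : ℕ) ≤ k) then b j else 0 := by
  simp [Matrix.mulVec, dotProduct, chamberReal_apply]

lemma chamberReal_four (b : Fin 6 → ℝ) : Matrix.toLin' (chamberReal 4) b =
    ![b 0, b 1 + b 2 + b 3 + b 4, b 2 + b 3 + b 4, b 3 + b 4, b 4, b 5] := by
  ext i
  rw [chamberReal_apply_vec, Fin.sum_univ_six]
  fin_cases i <;> simp [Fin.ext_iff, Fin.le_def]

lemma chamberReal_five (b : Fin 6 → ℝ) : Matrix.toLin' (chamberReal 5) b =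
    ![b 0, b 1 + b 2 + b 3 + b 4 + b 5, b 2 + b 3 + b 4 + b 5, b 3 + b 4 + b 5, b 4 + b 5,
      b 5] := by
  ext i
  rw [chamberReal_apply_vec, Fin.sum_univ_six]
  fin_cases i <;> simp [Fin.ext_iff, Fin.le_def]

lemma strictAnti_leafEmb {k : ℕ} (hk : k + 1 ≤ 5) (a : Fin 6 → ℝ) :
    StrictAnti (a ∘ leafEmb (k + 1) hk) ↔
      ∀ i : Fin k, a ⟨i + 2, by omega⟩ < a ⟨i + 1, by omega⟩ :=
  Fin.strictAnti_iff_succ_lt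

lemma capVol_star_four : capVol (gramOfAdj (simplexAdj 11) (simplexDet 11)) =
    24 * capVol (gramOfAdj (chamberAdj 4) (simplexDet 11)) := by
  rw [capVol_star_of_image (k := 4) (by norm_num)]
  · norm_num [Nat.factorial]
  ext a
  rw [mem_inter_iff, mem_ofPred_eq, mem_ofPred_eq, strictAnti_leafEmb, mem_image]
  constructor
  · rintro ⟨b, h, rfl⟩
    have h : ∀ i, 0 < b i := h
    rw [chamberReal_four]
    have := h 0; have := h 1; have := h 2; have := h 3; have := h 4; have := h 5
    refine ⟨fun i => ?_, fun i => ?_⟩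
    · fin_cases i <;> simp <;> linarith
    · fin_cases i <;> simp <;> linarith
  · rintro ⟨h, h'⟩
    have := h 0; have := h 4; have := h 5
    have h1 : a 2 < a 1 := h' 0
    have h2 : a 3 < a 2 := h' 1
    have h3 : a 4 < a 3 := h' 2
    refine ⟨![a 0, a 1 - a 2, a 2 - a 3, a 3 - a 4, a 4, a 5], fun i => ?_, ?_⟩
    · fin_cases i <;> simp <;> linarith
    · rw [chamberReal_four]
      ext i
      fin_cases i <;> simp

lemma capVol_star_five : capVol (gramOfAdj (simplexAdj 11) (simplexDet 11)) =
    120 * capVol (gramOfAdj (chamberAdj 5) (simplexDet 11)) := by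
  rw [capVol_star_of_image (k := 5) (by norm_num)]
  · norm_num [Nat.factorial]
  ext a
  rw [mem_inter_iff, mem_ofPred_eq, mem_ofPred_eq, strictAnti_leafEmb, mem_image]
  constructor
  · rintro ⟨b, h, rfl⟩
    have h : ∀ i, 0 < b i := h
    rw [chamberReal_five]
    have := h 0; have := h 1; have := h 2; have := h 3; have := h 4; have := h 5
    refine ⟨fun i => ?_, fun i => ?_⟩
    · fin_cases i <;> simp <;> linarith
    · fin_cases i <;> simp <;> linarith
  · rintro ⟨h, h'⟩
    have := h 0; have := h 5
    have h1 : a 2 < a 1 := h' 0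
    have h2 : a 3 < a 2 := h' 1
    have h3 : a 4 < a 3 := h' 2
    have h4 : a 5 < a 4 := h' 3
    refine ⟨![a 0, a 1 - a 2, a 2 - a 3, a 3 - a 4, a 4 - a 5, a 5], fun i => ?_, ?_⟩
    · fin_cases i <;> simp <;> linarith
    · rw [chamberReal_five]
      ext i
      fin_cases i <;> simp

/-- Among the twelve diagrams, only one can have a twentieth of the volume of the star. -/
theorem eq_ten_of_hVol_eq {e e' : Fin 6 → EuclideanSpace ℝ (Fin (5 + 1))}
    {P F : Set ↥(hypSet 5)} {t : Fin 12} (h : IsFrame e P) (ht : HasDiagram e 11)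
    (hF : IsFrame e' F) (htF : HasDiagram e' t) (hvol : hVol 5 P = 20 * hVol 5 F)
    (h0 : hVol 5 F ≠ 0) (hfin : hVol 5 F ≠ ⊤) : t = 10 := by
  rw [h.hVol_eq_of_hasDiagram ht] at hvol
  rw [hF.hVol_eq_of_hasDiagram htF] at hvol h0 hfin
  set x := capVol (gramOfAdj (simplexAdj 11) (simplexDet 11)) with hx
  set y := capVol (gramOfAdj (simplexAdj t) (simplexDet t)) with hy
  have hy0 : y ≠ 0 := fun h => h0 (by rw [h, mul_zero])
  have hyt : y ≠ ⊤ := fun h => hfin (by rw [h, ENNReal.mul_top (by norm_num)])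
  have hxy : x = 20 * y := by
    rw [← ENNReal.mul_right_inj (a := 6) (by norm_num) (by norm_num), hvol]; ring
  have hyr : 0 < y.toReal := ENNReal.toReal_pos hy0 hyt
  have conv : ∀ {c : ℝ} {u v : ℝ≥0∞}, 0 ≤ c → v ≠ ⊤ → ENNReal.ofReal c * u ≤ v →
      c * u.toReal ≤ v.toReal := fun {c u v} hc hv huv => by
    have := ENNReal.toReal_mono hv huv
    rwa [ENNReal.toReal_mul, ENNReal.toReal_ofReal hc] at this
  have hx20 : x.toReal = 20 * y.toReal := by rw [hxy]; simp
  have hxt : x ≠ ⊤ := by rw [hxy]; exact ENNReal.mul_ne_top (by norm_num) hyt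
  set z := capVol (gramOfAdj (chamberAdj 4) (simplexDet 11)) with hz
  have hxz : x = 24 * z := capVol_star_four
  have hzt : z ≠ ⊤ := fun h => hxt (by rw [hxz, h, ENNReal.mul_top (by norm_num)])
  have hxzr : x.toReal = 24 * z.toReal := by rw [hxz]; simp
  set w := capVol (gramOfAdj (chamberAdj 5) (simplexDet 11)) with hw
  have hxwr : x.toReal = 120 * w.toReal := by rw [hx, capVol_star_five, ← hw]; simp
  have hsmall : t < 3 → False := fun h3 => by
    have := capVol_le_of_volTest (by norm_num) (simplexDet_neg _) (simplexDet_neg _)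
      (det_gramOfAdj _) (det_gramOfAdj_chamberAdj 4) (volTest_small ⟨t, h3⟩)
    have := conv (by positivity) hzt this
    change _ * y.toReal ≤ _ at this
    norm_num at this
    linarith
  have hlarge : 3 ≤ t → t < 9 → False := fun h3 h9 => by
    have := capVol_le_of_volTest (by norm_num) (simplexDet_neg _) (simplexDet_neg _)
      (det_gramOfAdj_chamberAdj 4) (det_gramOfAdj _) (volTest_large ⟨t, h9⟩ h3)
    have := conv (by positivity) hyt this
    norm_num at this
    linarith
  have hpent : t ≠ 9 := by
    rintro rfl
    have := capVol_le_of_volTest (by norm_num) (simplexDet_neg _) (simplexDet_neg _)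
      (det_gramOfAdj_chamberAdj 5) (det_gramOfAdj _) volTest_pentagon
    have := conv (by positivity) hyt this
    norm_num at this
    linarith
  have hstar : t ≠ 11 := by
    rintro rfl
    have : x.toReal = y.toReal := rfl
    linarith
  rcases lt_or_ge t 3 with h3 | h3
  · exact (hsmall h3).elim
  rcases lt_or_ge t 9 with h9 | h9
  · exact (hlarge h3 h9).elim
  omega

/-! ## Growing diagrams node by node -/

/-- A diagram, vectors certifying that some of its one-node extensions are impossible, and the
identification of the remaining extensions with larger diagrams of the list. -/
structure GrowthStep where
  edges : List (ℕ × ℕ × ℕ)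
  certs : List (Fin 6 → ℤ√2)
  leaves : List (ℕ × (Fin 6 → Fin 6))

/-- The connected diagrams on a given number of nodes which occur in the search. -/
def growth : ℕ → List GrowthStep
  | 1 => [
    ⟨[],
      [],
      [(0, ![0, 1, 2, 3, 4, 5]), (1, ![0, 1, 2, 3, 4, 5]), (2, ![0, 1, 2, 3, 4, 5]),
       (3, ![0, 1, 2, 3, 4, 5])]⟩]
  | 2 => [
    ⟨[(0, 1, 3)],
      [![1, 1, 1, 0, 0, 0]],
      [(0, ![0, 1, 2, 3, 4, 5]), (1, ![0, 1, 2, 3, 4, 5]), (2, ![0, 1, 2, 3, 4, 5]),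
       (0, ![1, 0, 2, 3, 4, 5]), (1, ![1, 0, 2, 3, 4, 5]), (2, ![1, 0, 2, 3, 4, 5])]⟩,
    ⟨[(0, 1, 4)],
      [![1, ⟨0, 1⟩, 1, 0, 0, 0], ![⟨0, 1⟩, 1, 1, 0, 0, 0]],
      [(1, ![2, 1, 0, 3, 4, 5]), (1, ![2, 0, 1, 3, 4, 5])]⟩,
    ⟨[(0, 1, 5)],
      [![1, 1, 1, 0, 0, 0]],
      [(2, ![2, 1, 0, 3, 4, 5]), (2, ![2, 0, 1, 3, 4, 5])]⟩,
    ⟨[(0, 1, 6)], [], []⟩]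
  | 3 => [
    ⟨[(0, 1, 3), (1, 2, 3)],
      [![0, 1, 1, 1, 0, 0], ![1, 2, 1, ⟨0, 1⟩, 0, 0], ![1, 1, 1, 1, 0, 0]],
      [(0, ![0, 1, 2, 3, 4, 5]), (1, ![0, 1, 2, 3, 4, 5]), (3, ![0, 1, 2, 3, 4, 5]),
       (4, ![1, 0, 2, 3, 4, 5]), (0, ![2, 1, 0, 3, 4, 5]), (1, ![2, 1, 0, 3, 4, 5]),
       (3, ![2, 1, 0, 3, 4, 5])]⟩,
    ⟨[(0, 1, 3), (1, 2, 4)],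
      [![0, 1, ⟨0, 1⟩, 1, 0, 0], ![1, 2, ⟨0, 1⟩, 1, 0, 0], ![⟨0, 1⟩, ⟨0, 1⟩, 1, 1, 0, 0]],
      [(2, ![0, 1, 2, 3, 4, 5]), (1, ![3, 0, 1, 2, 4, 5])]⟩,
    ⟨[(0, 1, 3), (1, 2, 5)],
      [![1, ⟨0, 1⟩, ⟨0, 1⟩, 1, 0, 0]],
      [(3, ![3, 0, 1, 2, 4, 5])]⟩]
  | 4 => [
    ⟨[(0, 1, 3), (1, 2, 3), (2, 3, 3)],
      [![1, 2, ⟨0, 2⟩, 4, ⟨0, 2⟩, 0], ![0, 1, 2, 1, ⟨0, 1⟩, 0], ![0, 1, 1, 1, 1, 0],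
       ![1, 2, 1, 0, ⟨0, 1⟩, 0], ![1, 1, 1, 0, 1, 0], ![1, 1, 1, 1, 1, 0],
       ![4, ⟨0, 2⟩, 2, 1, ⟨0, 2⟩, 0]],
      [(0, ![0, 1, 2, 3, 4, 5]), (1, ![0, 1, 2, 3, 4, 5]), (2, ![2, 3, 4, 1, 0, 5]),
       (2, ![1, 0, 4, 2, 3, 5]), (0, ![3, 2, 1, 0, 4, 5]), (3, ![0, 1, 2, 3, 4, 5]),
       (1, ![3, 2, 1, 0, 4, 5])]⟩,
    ⟨[(0, 1, 3), (1, 2, 3), (2, 3, 4)],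
      [![0, 0, 1, ⟨0, 1⟩, 1, 0], ![0, 1, 2, ⟨0, 1⟩, 1, 0], ![1, 2, 1, 0, ⟨0, 1⟩, 0],
       ![1, 1, 1, 1, 1, 0], ![⟨0, 1⟩, 1, 1, 1, 1, 0]],
      [(7, ![0, 1, 2, 3, 4, 5]), (4, ![1, 0, 4, 2, 3, 5]), (1, ![4, 0, 1, 2, 3, 5]),
       (5, ![3, 2, 1, 0, 4, 5])]⟩,
    ⟨[(0, 1, 3), (1, 2, 4), (2, 3, 3)],
      [![0, 1, ⟨0, 1⟩, ⟨0, 1⟩, 1, 0], ![0, ⟨0, 1⟩, 2, 1, 1, 0], ![1, 2, ⟨0, 1⟩, 0, 1, 0],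
       ![1, 1, 1, 1, 1, 0], ![⟨0, 1⟩, ⟨0, 1⟩, 1, 0, 1, 0]],
      [(7, ![4, 3, 2, 1, 0, 5]), (7, ![4, 0, 1, 2, 3, 5])]⟩,
    ⟨[(0, 1, 3), (1, 2, 3), (2, 3, 5)],
      [![0, 1, ⟨0, 1⟩, ⟨0, 1⟩, 1, 0], ![1, ⟨0, 1⟩, ⟨0, 1⟩, 1, 1, 0], ![2, ⟨0, 2⟩, 4, ⟨0, 2⟩, 1, 0]],
      []⟩,
    ⟨[(0, 1, 3), (0, 2, 3), (0, 3, 3)],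
      [![⟨0, 1⟩, 1, 1, ⟨0, 1⟩, 1, 0], ![⟨0, 1⟩, 1, ⟨0, 1⟩, 1, 1, 0],
       ![⟨0, 1⟩, ⟨0, 1⟩, 1, 1, 1, 0], ![2, 1, 1, 0, ⟨0, 1⟩, 0]],
      [(2, ![0, 1, 2, 3, 4, 5]), (4, ![0, 1, 2, 3, 4, 5]), (2, ![0, 1, 3, 2, 4, 5]),
       (4, ![0, 1, 3, 2, 4, 5]), (2, ![0, 2, 3, 1, 4, 5]), (4, ![0, 2, 3, 1, 4, 5]),
       (6, ![0, 1, 2, 3, 4, 5])]⟩]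
  | 5 => [
    ⟨[(0, 1, 3), (1, 2, 3), (2, 3, 3), (3, 4, 3)], [], []⟩,
    ⟨[(0, 1, 3), (1, 2, 3), (2, 3, 3), (3, 4, 4)], [], []⟩,
    ⟨[(0, 1, 3), (0, 2, 3), (0, 3, 3), (3, 4, 3)], [], []⟩,
    ⟨[(0, 1, 3), (1, 2, 3), (2, 3, 3), (3, 4, 3), (0, 4, 3)],
      [![1, 0, 0, 1, 2, ⟨0, 1⟩], ![0, 0, 1, 2, 1, ⟨0, 1⟩], ![0, 0, 1, 1, 1, 1],
       ![0, 1, 2, 1, 0, ⟨0, 1⟩], ![1, 1, 0, 0, 1, 1], ![0, 1, 1, 1, 0, 1],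
       ![1, 2, 1, 0, 0, ⟨0, 1⟩], ![1, 0, 0, 1, 1, 1], ![1, 1, 1, 0, 0, 1],
       ![2, 1, 0, 0, 1, ⟨0, 1⟩]],
      [(9, ![0, 5, 4, 3, 2, 1]), (9, ![2, 5, 3, 4, 0, 1]), (9, ![1, 5, 2, 3, 4, 0]),
       (9, ![0, 5, 1, 2, 3, 4]), (9, ![1, 5, 0, 4, 3, 2])]⟩,
    ⟨[(0, 1, 3), (0, 2, 3), (0, 3, 3), (3, 4, 4)],
      [![0, 0, 0, 1, ⟨0, 1⟩, 1], ![1, 0, 0, 2, ⟨0, 1⟩, 1], ![1, 0, 1, 1, 1, 1],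
       ![⟨0, 1⟩, 1, ⟨0, 1⟩, 1, 0, 1], ![1, 1, 0, 1, 1, 1], ![⟨0, 1⟩, ⟨0, 1⟩, 1, 1, 0, 1],
       ![2, 1, 1, 0, 0, ⟨0, 1⟩]],
      [(4, ![4, 1, 0, 2, 3, 5]), (2, ![1, 5, 2, 0, 3, 4]), (5, ![2, 4, 3, 0, 1, 5]),
       (2, ![2, 5, 1, 0, 3, 4]), (5, ![1, 4, 3, 0, 2, 5]), (6, ![0, 4, 3, 1, 2, 5])]⟩,
    ⟨[(0, 1, 4), (1, 2, 3), (2, 3, 3), (3, 4, 4)],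
      [![0, 0, 0, 1, ⟨0, 1⟩, 1], ![0, 0, 1, 2, ⟨0, 1⟩, 1], ![1, ⟨0, 1⟩, ⟨0, 1⟩, 0, 0, 1],
       ![⟨0, 1⟩, 2, 1, 0, 0, 1]],
      [(3, ![4, 0, 2, 1, 3, 5]), (5, ![1, 4, 3, 2, 5, 0]), (3, ![0, 4, 2, 3, 1, 5]),
       (8, ![0, 5, 4, 3, 2, 1])]⟩,
    ⟨[(0, 1, 3), (0, 2, 3), (0, 3, 3), (0, 4, 3)],
      [![⟨0, 1⟩, 1, 1, 0, ⟨0, 1⟩, 1], ![1, 0, 0, 1, 1, 1], ![⟨0, 1⟩, 1, 1, ⟨0, 1⟩, 0, 1],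
       ![⟨0, 1⟩, 1, ⟨0, 1⟩, 1, 0, 1], ![⟨0, 1⟩, ⟨0, 1⟩, 1, 1, 0, 1], ![2, 1, 1, 0, 0, ⟨0, 1⟩]],
      [(10, ![0, 4, 1, 2, 3, 5]), (6, ![0, 5, 4, 1, 2, 3]), (10, ![0, 3, 1, 2, 4, 5]),
       (6, ![0, 5, 3, 1, 2, 4]), (10, ![0, 2, 1, 3, 4, 5]), (6, ![0, 5, 2, 1, 3, 4]),
       (10, ![0, 1, 2, 3, 4, 5]), (6, ![0, 5, 1, 2, 3, 4]), (11, ![0, 1, 2, 3, 4, 5])]⟩,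
    ⟨[(0, 1, 3), (1, 2, 3), (2, 3, 4), (3, 4, 3)],
      [![0, 0, 1, ⟨0, 1⟩, ⟨0, 1⟩, 1], ![0, 0, ⟨0, 1⟩, 2, 1, 1], ![0, 1, 2, ⟨0, 1⟩, 0, 1],
       ![0, 1, 1, 1, 1, 1], ![1, 2, 1, 0, 0, ⟨0, 1⟩], ![⟨0, 1⟩, 1, 1, 1, 0, 1]],
      [(1, ![1, 5, 4, 3, 2, 0]), (4, ![3, 0, 1, 5, 2, 4]), (0, ![3, 5, 0, 1, 2, 4]),
       (7, ![1, 5, 4, 3, 2, 0]), (3, ![3, 5, 1, 0, 2, 4]), (8, ![0, 1, 2, 3, 4, 5])]⟩]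
  | 6 => [
    ⟨[(0, 4, 4), (0, 5, 3), (1, 2, 3), (2, 3, 3), (3, 4, 3)], [], []⟩,
    ⟨[(0, 4, 3), (0, 5, 3), (1, 2, 3), (2, 3, 3), (3, 4, 4)], [], []⟩,
    ⟨[(0, 3, 3), (1, 2, 3), (2, 3, 3), (3, 4, 3), (4, 5, 4)], [], []⟩,
    ⟨[(0, 4, 4), (0, 5, 3), (1, 3, 4), (2, 3, 3), (2, 4, 3)], [], []⟩,
    ⟨[(0, 4, 4), (0, 5, 3), (1, 2, 3), (2, 3, 3), (2, 4, 3)], [], []⟩,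
    ⟨[(0, 3, 3), (0, 5, 4), (1, 2, 4), (2, 3, 3), (3, 4, 3)], [], []⟩,
    ⟨[(0, 2, 3), (0, 3, 3), (0, 4, 3), (0, 5, 3), (1, 2, 4)], [], []⟩,
    ⟨[(0, 4, 3), (0, 5, 3), (1, 2, 3), (1, 5, 3), (2, 3, 3), (3, 4, 4)], [], []⟩,
    ⟨[(0, 1, 3), (0, 5, 4), (1, 2, 3), (2, 3, 4), (3, 4, 3), (4, 5, 3)], [], []⟩,
    ⟨[(0, 2, 3), (0, 5, 3), (1, 2, 3), (2, 3, 3), (3, 4, 3), (4, 5, 3)], [], []⟩,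
    ⟨[(0, 1, 3), (0, 2, 3), (0, 3, 3), (0, 4, 3), (1, 5, 3)], [], []⟩,
    ⟨[(0, 1, 3), (0, 2, 3), (0, 3, 3), (0, 4, 3), (0, 5, 3)], [], []⟩]
  | _ => []

/-- Positive combinations of simple roots in the closed chamber for the spherical diagrams on five
nodes. -/
def sphericalVec : List (Fin 6 → ℤ√2) :=
  [![5, 8, 9, 8, 5, 0],
   ![18, 32, 42, 48, ⟨0, 25⟩, 0],
   ![18, 10, 10, 14, 8, 0]]

/-- An upper bound for `-20 cos (π / m)`. -/
def bound : ℕ → ℤ√2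
  | 1 => 20
  | 2 => 0
  | 3 => -10
  | 4 => ⟨0, -10⟩
  | 5 => -16
  | _ => -17

/-- The label of an edge of a diagram on six nodes. -/
def edgeLabel (E : List (ℕ × ℕ × ℕ)) (i j : Fin 6) : ℕ := cmOfEdges 6 E i j

/-- The diagram on the nodes `0, …, n` obtained by attaching the node `n` with labels `v`. -/
def extendLabels (E : List (ℕ × ℕ × ℕ)) (n : Fin 6) (v : List ℕ) (i j : Fin 6) : ℕ :=
  if i = j then 1 else
    if i = n ∧ j < n then v.getD j 2 else
      if j = n ∧ i < n then v.getD i 2 else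
        if i < n ∧ j < n then edgeLabel E i j else 2

/-- The value at `c` of the quadratic form with coefficients `bound` on the nodes before `n`. -/
def baseForm (E : List (ℕ × ℕ × ℕ)) (n : Fin 6) (c : Fin 6 → ℤ√2) : ℤ√2 :=
  ∑ i, ∑ j, if i < n ∧ j < n then c i * c j * bound (edgeLabel E i j) else 0

/-- The value at `c` of the quadratic form with coefficients `bound` after attaching a node. -/
def boundForm (E : List (ℕ × ℕ × ℕ)) (n : Fin 6) (v : List ℕ) (c : Fin 6 → ℤ√2) : ℤ√2 :=
  baseForm E n c + 2 * c n * (∑ j, if j < n then c j * bound (v.getD j 2) else 0) +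
    20 * c n * c n

/-- The vector `c` is nonnegative with enough zeros. -/
def supportTest (n : Fin 6) (c : Fin 6 → ℤ√2) : Bool :=
  decide (∀ i, nonnegTest (c i) = true) && decide (∀ i, n < i → c i = 0) &&
    decide (∃ i, c i = 0)

/-- The vector `c` has a positive entry and two zeros. -/
def twoZerosTest (c : Fin 6 → ℤ√2) : Bool :=
  decide (∃ i j k, i ≠ j ∧ c i = 0 ∧ c j = 0 ∧ nonnegTest (c k - 1) = true)

/-- A vector shows that a labelling, and any larger one, is impossible. -/
def certTest (E : List (ℕ × ℕ × ℕ)) (n : Fin 6) (v : List ℕ) (c : Fin 6 → ℤ√2) : Bool :=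
  nonnegTest (-boundForm E n v c) && supportTest n c &&
    (twoZerosTest c || nonnegTest (-boundForm E n v c - 1))

/-- Some edge with label at least six meets another edge. -/
def sixTest (L : Fin 6 → Fin 6 → ℕ) : Bool :=
  decide (∃ a b, L a b = 6 ∧ ∃ c, a ≠ b ∧ b ≠ c ∧ a ≠ c ∧ 3 ≤ L b c)

/-- The labelling is impossible. -/
def badTest (s : GrowthStep) (n : Fin 6) (v : List ℕ) : Bool :=
  (v.any (· == 6) || s.edges.any fun x => x.2.2 == 6) && sixTest (extendLabels s.edges n v) ||
    s.certs.any (certTest s.edges n v)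

/-- The labelling is one of those listed as leaves. -/
def leafTest (n : Fin 6) (s : GrowthStep) (v : List ℕ) : Bool :=
  v.all (· == 2) || s.leaves.any fun l =>
    ((growth (n + 1))[l.1]?.any fun s' => decide (∀ i j, i ≤ n → j ≤ n →
      extendLabels s.edges n v (l.2 i) (l.2 j) = edgeLabel s'.edges i j)) &&
    decide (Function.Injective l.2 ∧ (n ≠ 5 → l.2 5 = 5) ∧ ∀ i, i ≤ n → l.2 i ≤ n)

/-- The search through the labels of a new node. -/
def search (n : Fin 6) (s : GrowthStep) : ℕ → List ℕ → Bool
  | 0, v => leafTest n s v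
  | k + 1, v => [2, 3, 4, 5, 6].all fun m =>
      badTest s n (v ++ [m]) || search n s k (v ++ [m])

/-- A diagram on five nodes is spherical. -/
def sphericalTest (E : List (ℕ × ℕ × ℕ)) : Bool :=
  sphericalVec.any fun d => decide (d 5 = 0) && decide (∀ i, nonnegTest (d i) = true) &&
    decide (∀ j : Fin 6, j ≠ 5 → nonnegTest (∑ i, d i * weight (edgeLabel E i j) - 1) = true)

lemma search_growth_one : ∀ s ∈ growth 1, search 1 s 1 [] = true := by
  decide +kernel

lemma search_growth_two : ∀ s ∈ growth 2, search 2 s 2 [] = true := by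
  decide +kernel

lemma search_growth_three : ∀ s ∈ growth 3, search 3 s 3 [] = true := by
  decide +kernel

lemma search_growth_four : ∀ s ∈ growth 4, search 4 s 4 [] = true := by
  decide +kernel

lemma search_growth_five :
    ∀ s ∈ growth 5, sphericalTest s.edges = true ∨ search 5 s 5 [] = true := by
  decide +kernel

lemma growth_six : ∀ s ∈ growth 6, ∃ t, edgeLabel s.edges = fun i j => simplexDiagram t i j := by
  decide +kernel

section

/-- The properties of the Gram matrix `g` of a non-compact simplex and its labels `ℓ` which are
used in the classification; the vertex opposite to the last facet is ideal. -/
structure Chart (g : Fin 6 → Fin 6 → ℝ) (ℓ : Fin 6 → Fin 6 → ℕ) : Prop where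
  symm : ∀ i j, g i j = g j i
  label_symm : ∀ i j, ℓ i j = ℓ j i
  label_self : ∀ i, ℓ i i = 1
  two_le : ∀ i j, i ≠ j → 2 ≤ ℓ i j
  le_six : ∀ i j, ℓ i j ≤ 6
  bound_le : ∀ i j, 20 * g i j ≤ rootTwo (bound (ℓ i j))
  eq_weight : ∀ i j, ℓ i j ≤ 4 → 2 * g i j = rootTwo (weight (ℓ i j))
  six : ∀ i j, ℓ i j = 6 → 2 * g i j ≤ -√3
  psd : ∀ c : Fin 6 → ℝ, (∃ i, c i = 0) → 0 ≤ ∑ i, ∑ j, c i * c j * g i j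
  pd : ∀ c : Fin 6 → ℝ, c ≠ 0 → (∃ i j, i ≠ j ∧ c i = 0 ∧ c j = 0) →
    0 < ∑ i, ∑ j, c i * c j * g i j
  kernel : ∃ c : Fin 6 → ℝ, c 5 = 0 ∧ (∀ j, j ≠ 5 → 0 < c j) ∧
    (∀ i, i ≠ 5 → ∑ j, c j * g i j = 0) ∧ ∑ j, c j * g 5 j ≠ 0

lemma rootTwo_bound_anti {a b : ℕ} (ha : 2 ≤ a) (hab : a ≤ b) (hb : b ≤ 6) :
    rootTwo (bound b) ≤ rootTwo (bound a) := by
  have h : ∀ a b : Fin 7, 2 ≤ (a : ℕ) → (a : ℕ) ≤ b →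
      nonnegTest (bound a - bound b) = true := by decide +kernel
  have := rootTwo_nonneg (h ⟨a, by omega⟩ ⟨b, by omega⟩ ha hab)
  rw [map_sub] at this
  linarith

namespace Chart

variable {g : Fin 6 → Fin 6 → ℝ} {ℓ : Fin 6 → Fin 6 → ℕ}

lemma comp (h : Chart g ℓ) (σ : Equiv.Perm (Fin 6)) (hσ : σ 5 = 5) :
    Chart (fun i j => g (σ i) (σ j)) fun i j => ℓ (σ i) (σ j) := by
  have h5 : ∀ i, i ≠ 5 → σ i ≠ 5 := fun i hi h => hi (σ.injective (h.trans hσ.symm))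
  have hsum : ∀ c : Fin 6 → ℝ, ∑ i, ∑ j, c i * c j * g (σ i) (σ j) =
      ∑ i, ∑ j, c (σ.symm i) * c (σ.symm j) * g i j := fun c => by
    rw [← Equiv.sum_comp σ fun i => ∑ j, c (σ.symm i) * c (σ.symm j) * g i j]
    refine Finset.sum_congr rfl fun i _ => ?_
    rw [← Equiv.sum_comp σ fun j => c (σ.symm (σ i)) * c (σ.symm j) * g (σ i) j]
    simp
  refine ⟨fun _ _ => h.symm _ _, fun _ _ => h.label_symm _ _, fun _ => h.label_self _,
    fun i j hij => h.two_le _ _ (σ.injective.ne hij), fun _ _ => h.le_six _ _,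
    fun _ _ => h.bound_le _ _, fun _ _ => h.eq_weight _ _, fun _ _ => h.six _ _, ?_, ?_, ?_⟩
  · rintro c ⟨i, hi⟩
    rw [hsum]
    exact h.psd (fun i => c (σ.symm i)) ⟨σ i, by simpa using hi⟩
  · rintro c hc ⟨i, j, hij, hi, hj⟩
    rw [hsum]
    refine h.pd (fun i => c (σ.symm i)) (fun h0 => hc ?_)
      ⟨σ i, σ j, σ.injective.ne hij, by simpa using hi, by simpa using hj⟩
    ext i
    simpa using congrFun h0 (σ i)
  · obtain ⟨c, hc5, hc, hk, hn⟩ := h.kernel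
    have hs : ∀ i, ∑ j, c (σ j) * g (σ i) (σ j) = ∑ j, c j * g (σ i) j := fun i =>
      Equiv.sum_comp σ fun j => c j * g (σ i) j
    refine ⟨fun i => c (σ i), (congrArg c hσ).trans hc5, fun j hj => hc _ (h5 j hj), fun i hi => ?_, ?_⟩
    · rw [hs, hk _ (h5 i hi)]
    · rw [hs, hσ]
      exact hn

lemma eq_zero (h : Chart g ℓ) {i j : Fin 6} (hij : ℓ i j = 2) : g i j = 0 := by
  have := h.eq_weight i j (by omega)
  rw [hij] at this
  simpa [weight] using this

lemma self (h : Chart g ℓ) (i : Fin 6) : g i i = 1 := by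
  have := h.eq_weight i i (by rw [h.label_self]; omega)
  rw [h.label_self] at this
  simp only [weight, map_ofNat] at this
  linarith

/-- An edge with label at least six is a connected component. -/
lemma label_eq_two_of_six (h : Chart g ℓ) {a b c : Fin 6} (hbc : b ≠ c)
    (hac : a ≠ c) (h6 : ℓ a b = 6) : ℓ b c = 2 := by
  by_contra hne
  have h3 : 3 ≤ ℓ b c := by have := h.two_le b c hbc; omega
  have h1 := h.six a b h6
  have h2 : 2 * g b c ≤ -1 := by
    have h4 := (h.bound_le b c).trans (rootTwo_bound_anti (by norm_num) h3 (h.le_six b c))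
    simp only [bound, map_neg, map_ofNat] at h4
    linarith
  have h0 : g a c ≤ 0 := by
    have h4 := (h.bound_le a c).trans
      (rootTwo_bound_anti le_rfl (h.two_le a c hac) (h.le_six a c))
    simp only [bound, map_zero] at h4
    linarith
  let x : Fin 6 → ℝ := fun i =>
    (if i = a then √3 else 0) + (if i = b then 2 else 0) + (if i = c then 1 else 0)
  have hx : ∀ i, i ≠ a → i ≠ b → i ≠ c → x i = 0 := fun i h1 h2 h3 => by simp [x, h1, h2, h3]
  obtain ⟨p, q, hpq, hp, hq⟩ : ∃ p q : Fin 6, p ≠ q ∧ (p ≠ a ∧ p ≠ b ∧ p ≠ c) ∧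
      (q ≠ a ∧ q ≠ b ∧ q ≠ c) := by
    clear * -
    revert a b c
    decide +kernel
  have hpos := h.pd x (fun hx0 => by
    have := congrFun hx0 c
    simp [x, hac.symm, hbc.symm] at this)
    ⟨p, q, hpq, hx p hp.1 hp.2.1 hp.2.2, hx q hq.1 hq.2.1 hq.2.2⟩
  have hval : ∑ i, ∑ j, x i * x j * g i j = √3 * √3 * g a a + 4 * g b b + g c c +
      (√3 * 2 * g a b + √3 * g a c + 2 * g b c) + (√3 * 2 * g b a + √3 * g c a + 2 * g c b) := by
    have e1 : ∀ f : Fin 6 → ℝ, ∑ j, x j * f j = √3 * f a + 2 * f b + f c := fun f => by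
      simp [x, add_mul, Finset.sum_add_distrib]
    have e2 : ∀ i, ∑ j, x i * x j * g i j = x i * (√3 * g i a + 2 * g i b + g i c) := fun i => by
      rw [← e1, Finset.mul_sum]
      exact Finset.sum_congr rfl fun j _ => by ring
    simp only [e2, e1]
    ring
  have hs : √3 * √3 = 3 := Real.mul_self_sqrt (by norm_num)
  have hs0 : 0 ≤ √3 := Real.sqrt_nonneg 3
  rw [hval, h.self, h.self, h.self, h.symm b a, h.symm c a, h.symm c b] at hpos
  nlinarith [mul_nonneg hs0 (neg_nonneg.2 h0), mul_nonneg hs0 (sub_nonneg.2 h1)]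

end Chart

end

section

namespace Chart

variable {g : Fin 6 → Fin 6 → ℝ} {ℓ : Fin 6 → Fin 6 → ℕ} {E : List (ℕ × ℕ × ℕ)} {n : Fin 6}

lemma boundForm_le (h : Chart g ℓ) (hE : ∀ i j, i < n → j < n → ℓ i j = edgeLabel E i j)
    {v : List ℕ} (hv : ∀ j, j < n → 2 ≤ v.getD j 2 ∧ v.getD j 2 ≤ ℓ n j) {c : Fin 6 → ℤ√2}
    (hc : ∀ i, 0 ≤ rootTwo (c i)) (hn : ∀ i, n < i → c i = 0) :
    20 * ∑ i, ∑ j, rootTwo (c i) * rootTwo (c j) * g i j ≤ rootTwo (boundForm E n v c) := by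
  have hβ : ∀ j, j < n → 20 * g n j ≤ rootTwo (bound (v.getD j 2)) := fun j hj =>
    (h.bound_le n j).trans (rootTwo_bound_anti (hv j hj).1 (hv j hj).2 (h.le_six n j))
  have hpt : ∀ i j, 20 * (rootTwo (c i) * rootTwo (c j) * g i j) ≤
      (if i < n ∧ j < n then rootTwo (c i) * rootTwo (c j) * rootTwo (bound (edgeLabel E i j))
        else 0) +
      (if i = n then (if j < n then rootTwo (c n) * (rootTwo (c j) *
        rootTwo (bound (v.getD j 2))) else 0) else 0) +
      (if j = n then (if i < n then rootTwo (c n) * (rootTwo (c i) *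
        rootTwo (bound (v.getD i 2))) else 0) else 0) +
      (if i = n then (if j = n then 20 * rootTwo (c n) * rootTwo (c n) else 0) else 0) := by
    intro i j
    rcases lt_trichotomy i n with hi | rfl | hi
    · rcases lt_trichotomy j n with hj | rfl | hj
      · have := h.bound_le i j
        rw [hE i j hi hj] at this
        simp only [hi, hj, hi.ne, hj.ne, and_self, if_true, if_false]
        nlinarith [mul_le_mul_of_nonneg_left this (mul_nonneg (hc i) (hc j))]
      · have := hβ i hi
        rw [h.symm] at this
        simp only [hi, hi.ne, lt_irrefl, and_false, if_true, if_false]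
        nlinarith [mul_le_mul_of_nonneg_left this (mul_nonneg (hc j) (hc i))]
      · rw [hn j hj]
        simp [hj.ne', hi.ne, hj.not_gt]
    · rcases lt_trichotomy j i with hj | rfl | hj
      · have := hβ j hj
        simp only [hj, hj.ne, lt_irrefl, false_and, if_true, if_false]
        nlinarith [mul_le_mul_of_nonneg_left this (mul_nonneg (hc i) (hc j))]
      · simp [h.self]
        ring_nf
        rfl
      · rw [hn j hj]
        simp [hj.ne', hj.not_gt]
    · rw [hn i hi]
      simp [hi.ne', hi.not_gt]
  rw [Finset.mul_sum]
  simp only [Finset.mul_sum]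
  refine (Finset.sum_le_sum fun i _ => Finset.sum_le_sum fun j _ => hpt i j).trans_eq ?_
  simp only [Finset.sum_add_distrib, boundForm, baseForm, map_add, map_mul, map_sum, map_ofNat,
    apply_ite rootTwo, map_zero, Finset.sum_ite_eq', Finset.mem_univ, if_true]
  have e1 : ∀ f : Fin 6 → ℝ, ∑ i, ∑ j, (if i = n then f j else 0) = ∑ j, f j := fun f => by
    rw [Finset.sum_comm]; simp
  have e2 : ∀ f : Fin 6 → ℝ, ∑ j, (if j < n then rootTwo (c n) * f j else 0) =
      rootTwo (c n) * ∑ j, if j < n then f j else 0 := fun f => by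
    rw [Finset.mul_sum]
    exact Finset.sum_congr rfl fun j _ => by split_ifs <;> simp
  rw [e1, e1, e2]
  simp only [Finset.sum_ite_eq', Finset.mem_univ, if_true]
  ring

lemma certTest_eq_false (h : Chart g ℓ)
    (hE : ∀ i j, i < n → j < n → ℓ i j = edgeLabel E i j)
    {v : List ℕ} (hv : ∀ j, j < n → 2 ≤ v.getD j 2 ∧ v.getD j 2 ≤ ℓ n j) (c : Fin 6 → ℤ√2) :
    certTest E n v c = false := by
  rw [← Bool.not_eq_true]
  intro ht
  simp only [certTest, supportTest, twoZerosTest, Bool.and_eq_true, Bool.or_eq_true,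
    decide_eq_true_eq] at ht
  obtain ⟨⟨hneg, ⟨hc, hn⟩, hz⟩, h2⟩ := ht
  have hc' : ∀ i, 0 ≤ rootTwo (c i) := fun i => rootTwo_nonneg (hc i)
  have hle := h.boundForm_le hE hv hc' hn
  rcases h2 with ⟨i, j, k, hij, hi, hj, hk⟩ | h2
  · have h3 := rootTwo_nonneg hneg
    have h4 := rootTwo_nonneg hk
    rw [map_neg] at h3
    rw [map_sub, map_one] at h4
    have := h.pd (fun i => rootTwo (c i)) (fun h0 => by
      have := congrFun h0 k
      simp only [Pi.zero_apply] at this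
      linarith) ⟨i, j, hij, by simp [hi], by simp [hj]⟩
    linarith
  · have h3 := rootTwo_nonneg h2
    rw [map_sub, map_neg, map_one] at h3
    obtain ⟨i, hi⟩ := hz
    have := h.psd (fun i => rootTwo (c i)) ⟨i, by simp [hi]⟩
    linarith

/-- The first `k` labels of the edges at the node `n`. -/
def labelsTo (ℓ : Fin 6 → Fin 6 → ℕ) (n : Fin 6) (k : ℕ) : List ℕ :=
  (List.range k).map fun j => ℓ n (Fin.ofNat 6 j)

lemma labelsTo_succ (k : ℕ) :
    labelsTo ℓ n (k + 1) = labelsTo ℓ n k ++ [ℓ n (Fin.ofNat 6 k)] := by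
  simp [labelsTo, List.range_succ]

lemma labelsTo_getD (k : ℕ) (j : Fin 6) :
    (labelsTo ℓ n k).getD j 2 = if (j : ℕ) < k then ℓ n j else 2 := by
  rw [labelsTo, List.getD_eq_getElem?_getD, List.getElem?_map]
  split_ifs with hj
  · rw [List.getElem?_range hj]
    simp
  · rw [List.getElem?_eq_none (by simpa using hj)]
    simp

lemma labelsTo_bounds (h : Chart g ℓ) (k : ℕ) (j : Fin 6) (hj : j < n) :
    2 ≤ (labelsTo ℓ n k).getD j 2 ∧ (labelsTo ℓ n k).getD j 2 ≤ ℓ n j := by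
  have := h.two_le n j hj.ne'
  rw [labelsTo_getD]
  split_ifs <;> omega

lemma extendLabels_eq (h : Chart g ℓ) (hE : ∀ i j, i < n → j < n → ℓ i j = edgeLabel E i j)
    (k : ℕ) (i j : Fin 6) (hij : i ≠ j) : extendLabels E n (labelsTo ℓ n k) i j = ℓ i j ∨
      extendLabels E n (labelsTo ℓ n k) i j = 2 := by
  rw [extendLabels, if_neg hij, labelsTo_getD, labelsTo_getD]
  split_ifs with h1 h2 h2 h3 h4
  · exact Or.inl (by rw [h1.1])
  · exact Or.inr rfl
  · exact Or.inl (by rw [h2.1, h.label_symm])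
  · exact Or.inr rfl
  · exact Or.inl (hE i j h4.1 h4.2).symm
  · exact Or.inr rfl

lemma extendLabels_self (h : Chart g ℓ)
    (hE : ∀ i j, i < n → j < n → ℓ i j = edgeLabel E i j) (i j : Fin 6)
    (hi : i ≤ n) (hj : j ≤ n) : extendLabels E n (labelsTo ℓ n n) i j = ℓ i j := by
  rcases eq_or_ne i j with rfl | hij
  · rw [extendLabels, if_pos rfl, h.label_self]
  rw [extendLabels, if_neg hij, labelsTo_getD, labelsTo_getD]
  rcases hi.eq_or_lt with rfl | hi
  · have hj : j < i := lt_of_le_of_ne hj hij.symm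
    simp [hj]
  · rcases hj.eq_or_lt with rfl | hj
    · simp [hi, hi.ne, h.label_symm]
    · rw [if_neg (fun h => hi.ne h.1), if_neg (fun h => hj.ne h.1), if_pos ⟨hi, hj⟩, hE i j hi hj]

lemma badTest_eq_false (h : Chart g ℓ) {s : GrowthStep}
    (hE : ∀ i j, i < n → j < n → ℓ i j = edgeLabel s.edges i j) (k : ℕ) :
    badTest s n (labelsTo ℓ n k) = false := by
  rw [← Bool.not_eq_true]
  intro ht
  rw [badTest, Bool.or_eq_true, Bool.and_eq_true, List.any_eq_true] at ht
  rcases ht with ⟨-, h6⟩ | ⟨c, -, hc⟩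
  · simp only [sixTest, decide_eq_true_eq] at h6
    obtain ⟨a, b, hab6, c, hab, hbc, hac, h3⟩ := h6
    rcases h.extendLabels_eq hE k a b hab with e1 | e1 <;>
      rcases h.extendLabels_eq hE k b c hbc with e2 | e2
    · have := h.label_eq_two_of_six hbc hac (e1 ▸ hab6)
      omega
    all_goals omega
  · rw [h.certTest_eq_false hE (fun j hj => h.labelsTo_bounds k j hj) c] at hc
    exact absurd hc (by decide)

lemma leafTest_of_search (h : Chart g ℓ) {s : GrowthStep}
    (hE : ∀ i j, i < n → j < n → ℓ i j = edgeLabel s.edges i j) (k m : ℕ) (hkm : m + k = n)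
    (hs : search n s k (labelsTo ℓ n m) = true) : leafTest n s (labelsTo ℓ n n) = true := by
  induction k generalizing m with
  | zero =>
    rw [← hkm]
    exact hs
  | succ k ih =>
    rw [search, List.all_eq_true] at hs
    have hne : n ≠ Fin.ofNat 6 m := fun h0 => by
      have := congrArg Fin.val h0
      simp only [Fin.ofNat] at this
      omega
    have h2 := h.two_le n _ hne
    have h6 := h.le_six n (Fin.ofNat 6 m)
    have := hs (ℓ n (Fin.ofNat 6 m)) (by simp only [List.mem_cons]; omega)
    rw [← labelsTo_succ, h.badTest_eq_false hE, Bool.false_or] at this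
    exact ih (m + 1) (by omega) this

/-- An attached node leads to a larger diagram of the list. -/
lemma exists_growth (h : Chart g ℓ) {s : GrowthStep}
    (hE : ∀ i j, i < n → j < n → ℓ i j = edgeLabel s.edges i j)
    (hs : search n s n [] = true) (ha : ∃ j, j < n ∧ ℓ n j ≠ 2) :
    ∃ s' ∈ growth (n + 1), ∃ σ : Equiv.Perm (Fin 6), (n ≠ 5 → σ 5 = 5) ∧
      ∀ i j, i ≤ n → j ≤ n → ℓ (σ i) (σ j) = edgeLabel s'.edges i j := by
  have hl := h.leafTest_of_search hE n 0 (by omega) hs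
  rw [leafTest, Bool.or_eq_true, List.any_eq_true, List.all_eq_true] at hl
  rcases hl with hl | ⟨l, -, hl⟩
  · obtain ⟨j, hj, hne⟩ := ha
    refine absurd (hl (ℓ n j) ?_) (by simpa using hne)
    rw [labelsTo, List.mem_map]
    exact ⟨j, by simpa using hj, by simp⟩
  · rw [Bool.and_eq_true, decide_eq_true_eq, Option.any_eq_true] at hl
    obtain ⟨⟨s', hs', hl⟩, hinj, h5, hle⟩ := hl
    rw [decide_eq_true_eq] at hl
    refine ⟨s', List.mem_of_getElem? hs',
      Equiv.ofBijective l.2 (Finite.injective_iff_bijective.1 hinj), h5, fun i j hi hj => ?_⟩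
    rw [← hl i j hi hj, h.extendLabels_self hE _ _ (hle i hi) (hle j hj)]
    rfl

end Chart

end

section

lemma search_growth {n : Fin 6} (h1 : n ≠ 0) (h5 : n ≠ 5) {s : GrowthStep}
    (hs : s ∈ growth n) : search n s n [] = true := by
  fin_cases n
  · exact absurd rfl h1
  · exact search_growth_one s hs
  · exact search_growth_two s hs
  · exact search_growth_three s hs
  · exact search_growth_four s hs
  · exact absurd rfl h5

namespace Chart

variable {g : Fin 6 → Fin 6 → ℝ} {ℓ : Fin 6 → Fin 6 → ℕ}

/-- The diagram of the facets through the chosen ideal vertex is connected. -/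
lemma exists_attached (h : Chart g ℓ) {n : Fin 6} (h1 : n ≠ 0) (h5 : n ≠ 5) :
    ∃ k, n ≤ k ∧ k ≠ 5 ∧ ∃ j, j < n ∧ ℓ k j ≠ 2 := by
  by_contra! hcon
  obtain ⟨c, hc5, hc, hk, -⟩ := h.kernel
  have h0 : (0 : Fin 6) < n := Fin.pos_iff_ne_zero.2 h1
  have h5n : n < 5 := lt_of_le_of_ne (by omega) h5
  have hpos := h.pd (fun i => if i < n then c i else 0)
    (fun hz => by
      have := congrFun hz 0
      simp only [h0, if_true, Pi.zero_apply] at this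
      exact (hc 0 (by decide)).ne' this)
    ⟨n, 5, h5, by simp, by simp [hc5]⟩
  refine hpos.ne' (Finset.sum_eq_zero fun i _ => ?_)
  by_cases hi : i < n
  · have hz := congrArg (c i * ·) (hk i (hi.trans h5n).ne)
    simp only [Finset.mul_sum, mul_zero] at hz
    refine (Finset.sum_congr rfl fun j _ => ?_).trans hz
    by_cases hj : j < n
    · simp only [hi, hj, if_true]; ring
    · simp only [hi, hj, if_true, if_false, mul_zero, zero_mul]
      by_cases hj5 : j = 5
      · simp [hj5, hc5]
      · have := h.eq_zero (hcon j (not_lt.1 hj) hj5 i hi)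
        rw [h.symm, this]
        ring
  · simp [hi]

lemma exists_growth_of_ne_five (h : Chart g ℓ) (k : ℕ) (hk : k < 5) :
    ∃ σ : Equiv.Perm (Fin 6), σ 5 = 5 ∧ ∃ s ∈ growth (k + 1), ∀ i j : Fin 6,
      (i : ℕ) < k + 1 → (j : ℕ) < k + 1 → ℓ (σ i) (σ j) = edgeLabel s.edges i j := by
  induction k with
  | zero =>
    refine ⟨1, rfl, _, List.mem_singleton.2 rfl, fun i j hi hj => ?_⟩
    obtain rfl : i = 0 := Fin.ext (by simpa using hi)
    obtain rfl : j = 0 := Fin.ext (by simpa using hj)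
    rw [h.label_self]
    rfl
  | succ k ih =>
    obtain ⟨σ, hσ, s, hs, hℓ⟩ := ih (by omega)
    have hc := h.comp σ hσ
    let n : Fin 6 := ⟨k + 1, by omega⟩
    have h1 : n ≠ 0 := fun h => absurd (congrArg Fin.val h) (by simp [n])
    have h5 : n ≠ 5 := fun h => by
      have : k + 1 = 5 := congrArg Fin.val h
      omega
    obtain ⟨m, hnm, hm5, j, hj, hne⟩ := hc.exists_attached h1 h5
    have hτ : Equiv.swap n m 5 = 5 := Equiv.swap_apply_of_ne_of_ne h5.symm hm5.symm
    have hfix : ∀ i, i < n → Equiv.swap n m i = i := fun i hi =>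
      Equiv.swap_apply_of_ne_of_ne hi.ne (hi.trans_le hnm).ne
    obtain ⟨s', hs', ρ, hρ, hℓ'⟩ := (hc.comp (Equiv.swap n m) hτ).exists_growth
      (n := n) (s := s) (fun i j hi hj => by
        rw [hfix i hi, hfix j hj]
        exact hℓ i j hi hj)
      (search_growth h1 h5 hs)
      ⟨j, hj, by rwa [Equiv.swap_apply_left, hfix j hj]⟩
    refine ⟨ρ.trans ((Equiv.swap n m).trans σ), by simp [hρ h5, hτ, hσ], s', hs',
      fun i j hi hj => hℓ' i j (Nat.lt_succ_iff.1 hi) (Nat.lt_succ_iff.1 hj)⟩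

lemma sphericalTest_eq_false (h : Chart g ℓ) {E : List (ℕ × ℕ × ℕ)}
    (hE : ∀ i j : Fin 6, i < 5 → j < 5 → ℓ i j = edgeLabel E i j)
    (h4 : ∀ i j, edgeLabel E i j ≤ 4) : sphericalTest E = false := by
  rw [← Bool.not_eq_true]
  intro ht
  rw [sphericalTest, List.any_eq_true] at ht
  obtain ⟨d, -, hd⟩ := ht
  simp only [Bool.and_eq_true, decide_eq_true_eq] at hd
  obtain ⟨⟨hd5, -⟩, hW⟩ := hd
  obtain ⟨c, hc5, hc, hk, -⟩ := h.kernel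
  have hlt : ∀ i : Fin 6, i ≠ 5 → i < 5 := fun i hi => lt_of_le_of_ne (by omega) hi
  have hg : ∀ i j, i ≠ 5 → j ≠ 5 → rootTwo (weight (edgeLabel E i j)) = 2 * g i j :=
    fun i j hi hj => by
      rw [← hE i j (hlt i hi) (hlt j hj), h.eq_weight i j]
      rw [hE i j (hlt i hi) (hlt j hj)]
      exact h4 i j
  have hzero : ∑ j, c j * rootTwo (∑ i, d i * weight (edgeLabel E i j)) = 0 := by
    have e : ∀ i j, c j * (rootTwo (d i) * rootTwo (weight (edgeLabel E i j))) =
        2 * rootTwo (d i) * (c j * g i j) := fun i j => by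
      by_cases hi : i = 5
      · simp [hi, hd5]
      by_cases hj : j = 5
      · simp [hj, hc5]
      rw [hg i j hi hj]
      ring
    simp only [map_sum, map_mul, Finset.mul_sum, e]
    rw [Finset.sum_comm]
    refine Finset.sum_eq_zero fun i _ => ?_
    rw [← Finset.mul_sum]
    by_cases hi : i = 5
    · simp [hi, hd5]
    · rw [hk i hi, mul_zero]
  have hpos : ∀ j, j ≠ 5 → 0 < c j * rootTwo (∑ i, d i * weight (edgeLabel E i j)) :=
    fun j hj => by
      have := rootTwo_nonneg (hW j hj)
      rw [map_sub, map_one] at this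
      exact mul_pos (hc j hj) (by linarith)
  refine (Finset.sum_pos' (fun j _ => ?_) ⟨0, Finset.mem_univ _, hpos 0 (by decide)⟩).ne' hzero
  by_cases hj : j = 5
  · simp [hj, hc5]
  · exact (hpos j hj).le

lemma exists_simplexDiagram (h : Chart g ℓ) :
    ∃ (σ : Equiv.Perm (Fin 6)) (t : Fin 12), ∀ i j, ℓ (σ i) (σ j) = simplexDiagram t i j := by
  obtain ⟨σ, hσ, s, hs, hℓ⟩ := h.exists_growth_of_ne_five 4 (by norm_num)
  have hc := h.comp σ hσ
  have hE : ∀ i j : Fin 6, i < 5 → j < 5 → ℓ (σ i) (σ j) = edgeLabel s.edges i j := hℓ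
  have h4 : ∀ s ∈ growth 5, ∀ i j, edgeLabel s.edges i j ≤ 4 := by decide +kernel
  have hsearch : search 5 s 5 [] = true :=
    (search_growth_five s hs).resolve_left (by rw [hc.sphericalTest_eq_false hE (h4 s hs)]; simp)
  obtain ⟨c, hc5, -, -, hne⟩ := hc.kernel
  obtain ⟨j, -, hj⟩ := Finset.exists_ne_zero_of_sum_ne_zero hne
  have hj5 : j ≠ 5 := fun h => hj (by rw [h, hc5, zero_mul])
  obtain ⟨s', hs', ρ, -, hρ⟩ := hc.exists_growth (n := 5) hE hsearch
    ⟨j, lt_of_le_of_ne (by omega) hj5, fun h2 => hj (by rw [hc.eq_zero h2, mul_zero])⟩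
  obtain ⟨t, ht⟩ := growth_six s' hs'
  refine ⟨ρ.trans σ, t, fun i j => ?_⟩
  rw [← congrFun (congrFun ht i) j]
  exact hρ i j (by omega) (by omega)

end Chart

end

section

/-! ## The classification of the non-compact simplices -/

lemma sqrt_three_le_two_mul_cos {m : ℕ} (hm : 6 ≤ m) : √3 ≤ 2 * Real.cos (Real.pi / m) := by
  have h6 : (6 : ℝ) ≤ m := by exact_mod_cast hm
  have h := Real.cos_le_cos_of_nonneg_of_le_pi (x := Real.pi / m) (y := Real.pi / 6)
    (by positivity) (by linarith [Real.pi_pos])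
    (div_le_div_of_nonneg_left Real.pi_pos.le (by norm_num) h6)
  rw [Real.cos_pi_div_six] at h
  linarith

lemma neg_cos_eq_weight {m : ℕ} (hm : 2 ≤ m) (hm4 : m ≤ 4) :
    2 * -Real.cos (Real.pi / m) = rootTwo (weight m) := by
  interval_cases m
  · simp [weight]
  · simp [weight]
  · simp [weight, rootTwo_apply]; ring

lemma neg_cos_le_bound {m : ℕ} (hm : 2 ≤ m) :
    20 * -Real.cos (Real.pi / m) ≤ rootTwo (bound (min m 6)) := by
  obtain hm6 | hm6 := lt_or_ge m 6
  · interval_cases m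
    · simp [bound]
    · norm_num [bound, rootTwo_apply]
    · norm_num [bound, rootTwo_apply]; linarith
    · have h5 : (2.236 : ℝ) ≤ √5 := Real.le_sqrt_of_sq_le (by norm_num)
      norm_num [bound, rootTwo_apply]; linarith
  · have h := sqrt_three_le_two_mul_cos hm6
    have h3 : (1.7 : ℝ) ≤ √3 := Real.le_sqrt_of_sq_le (by norm_num)
    rw [min_eq_right hm6]
    norm_num [bound, rootTwo_apply]; linarith

variable {e : Fin 6 → EuclideanSpace ℝ (Fin (5 + 1))} {P : Set ↥(hypSet 5)}

namespace IsFrame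

lemma comp_perm (h : IsFrame e P) (σ : Equiv.Perm (Fin 6)) : IsFrame (e ∘ σ) P where
  unit i := h.unit _
  eq := h.eq.trans (σ.surjective.iInter_comp fun i => hHalf 5 (e i)).symm
  fut x hx := h.fut x fun i => by simpa using hx (σ.symm i)

lemma dual_comp_perm (h : IsFrame e P) (σ : Equiv.Perm (Fin 6)) (i : Fin 6) :
    (h.comp_perm σ).dual i = h.dual (σ i) :=
  (h.comp_perm σ).ext_of_mink fun j => by
    rw [mink_dual, Function.comp_apply, mink_dual]
    simp

lemma sum_gram (c : Fin 6 → ℝ) : ∑ i, ∑ j, c i * c j * mink 5 (e i) (e j) =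
    mink 5 (∑ i, c i • e i) (∑ i, c i • e i) := by
  simp only [mink_sum_right, mink_sum_left, mink_smul_left, mink_smul_right, Finset.mul_sum]
  rw [Finset.sum_comm]
  refine Finset.sum_congr rfl fun i _ => Finset.sum_congr rfl fun j _ => by ring

lemma mink_dual_sum_normals (h : IsFrame e P) (c : Fin 6 → ℝ) (i : Fin 6) :
    mink 5 (h.dual i) (∑ j, c j • e j) = -c i := by
  rw [mink_comm, mink_sum_left]
  simp only [mink_smul_left, h.mink_dual]
  simp

/-- A simplex with an ideal vertex opposite to the last facet gives a chart. -/
lemma chart (h : IsFrame e P) (hd : mink 5 (h.dual 5) (h.dual 5) = 0) {m : Fin 6 → Fin 6 → ℕ}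
    (hm : ∀ i j, i ≠ j → 2 ≤ m i j ∧ mink 5 (e i) (e j) = -Real.cos (Real.pi / m i j))
    (hsymm : ∀ i j, m i j = m j i) :
    Chart (fun i j => mink 5 (e i) (e j)) fun i j => if i = j then 1 else min (m i j) 6 where
  symm i j := mink_comm _ _
  label_symm i j := by simp only [hsymm i j, eq_comm (a := i)]
  label_self i := if_pos rfl
  two_le i j hij := by
    rw [if_neg hij]
    exact le_min (hm i j hij).1 (by norm_num)
  le_six i j := by
    split_ifs
    · norm_num
    · exact min_le_right _ _
  bound_le i j := by
    split_ifs with hij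
    · rw [hij, h.unit]
      simp [bound, rootTwo_apply]
    · rw [(hm i j hij).2]
      exact neg_cos_le_bound (hm i j hij).1
  eq_weight i j hl := by
    split_ifs at hl ⊢ with hij
    · rw [hij, h.unit]
      simp [weight, rootTwo_apply]
    · have hm4 : m i j ≤ 4 := by omega
      rw [(hm i j hij).2, min_eq_left (by omega)]
      exact neg_cos_eq_weight (hm i j hij).1 hm4
  six i j hl := by
    obtain rfl | hij := eq_or_ne i j
    · simp at hl
    rw [if_neg hij] at hl
    have := sqrt_three_le_two_mul_cos (m := m i j) (by omega)
    rw [(hm i j hij).2]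
    linarith
  psd c hc := by
    obtain ⟨i, hi⟩ := hc
    rw [sum_gram]
    exact (orth_causal (h.dual_fut i).1 (fut_pos (h.dual_fut i) (h.dual_ne_zero i)).ne'
      (by rw [h.mink_dual_sum_normals, hi, neg_zero])).1
  pd c hc hij := by
    obtain ⟨i, j, hij, hi, hj⟩ := hij
    rw [sum_gram]
    refine orth_timelike (h.sum_timelike (t := fun k => if k = i ∨ k = j then 1 else 0)
      (fun k => by split_ifs <;> norm_num) hij (by simp) (by simp)) ?_ fun h0 => hc ?_
    · rw [mink_sum_left]
      refine Finset.sum_eq_zero fun k _ => ?_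
      rw [mink_smul_left, h.mink_dual_sum_normals]
      split_ifs with hk
      · obtain rfl | rfl := hk <;> simp [hi, hj]
      · simp
    · ext k
      have := h.mink_dual_sum_normals c k
      rw [h0, mink_zero_right] at this
      simp only [Pi.zero_apply]
      linarith
  kernel := by
    have hs : ∀ i, ∑ j, -mink 5 (h.dual 5) (h.dual j) * mink 5 (e i) (e j) =
        mink 5 (e i) (h.dual 5) := fun i => by
      conv_rhs => rw [h.expand_normals (h.dual 5), mink_sum_right]
      simp only [mink_smul_right]
    refine ⟨fun j => -mink 5 (h.dual 5) (h.dual j), by simp [hd], fun j hj => ?_, fun i hi => ?_, ?_⟩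
    · exact neg_pos.2 (h.dual_mink_neg hj.symm)
    · rw [hs, h.mink_dual, if_neg hi]
    · rw [hs, h.mink_dual, if_pos rfl]
      norm_num

end IsFrame

lemma simplexDiagram_le_four (t : Fin 12) (i j : Fin 6) : simplexDiagram t i j ≤ 4 := by
  have h : ∀ t i j, (simplexDiagram t i j).ble 4 = true := by decide +kernel
  exact Nat.le_of_ble_eq_true (h t i j)

/-- A non-compact Coxeter simplex of dimension five has one of the twelve diagrams. -/
theorem exists_hasDiagram (hP : hCoxSimplex 5 P) (hnc : ¬IsCompact P) :
    ∃ e t, IsFrame e P ∧ HasDiagram e t ∧ hVol 5 P < ⊤ := by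
  obtain ⟨e, h, hfin, hm⟩ := exists_frame hP
  obtain ⟨k, hk⟩ : ∃ k, mink 5 (h.dual k) (h.dual k) = 0 := by
    by_contra! hd
    exact hnc (h.isCompact hd)
  choose! m hm2 hm using hm
  let σ := Equiv.swap k 5
  have h' := h.comp_perm σ
  have hm' : ∀ i j, i ≠ j → 2 ≤ m (σ (min i j)) (σ (max i j)) ∧
      mink 5 ((e ∘ σ) i) ((e ∘ σ) j) =
        -Real.cos (Real.pi / m (σ (min i j)) (σ (max i j))) := fun i j hij => by
    obtain hl | hl := hij.lt_or_gt
    · rw [min_eq_left hl.le, max_eq_right hl.le]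
      exact ⟨hm2 _ _ (σ.injective.ne hij), hm _ _ (σ.injective.ne hij)⟩
    · rw [min_eq_right hl.le, max_eq_left hl.le, mink_comm]
      exact ⟨hm2 _ _ (σ.injective.ne hij.symm), hm _ _ (σ.injective.ne hij.symm)⟩
  have hd : mink 5 (h'.dual 5) (h'.dual 5) = 0 := by
    rw [h.dual_comp_perm σ, Equiv.swap_apply_right, hk]
  have hc := h'.chart hd (m := fun i j => m (σ (min i j)) (σ (max i j))) hm' fun i j => by
    rw [min_comm, max_comm]
  obtain ⟨ρ, t, ht⟩ := hc.exists_simplexDiagram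
  refine ⟨(e ∘ σ) ∘ ρ, t, h'.comp_perm ρ, fun i j => ?_, hfin⟩
  have := hc.eq_weight (ρ i) (ρ j) ((ht i j).le.trans (simplexDiagram_le_four t i j))
  rw [ht] at this
  exact this

lemma simplexGram_star : ∀ i j, simplexGram 11 i j = starGram i j := by decide +kernel

lemma simplexGram_base : ∀ i j, simplexGram 10 i j = baseGram i j := by decide +kernel

end

/-- **(Lemma 9 and Section 3.2.4 of the paper.)** There exists a Coxeter
decomposition of the second type of the hyperbolic simplex `H₁₁⁵` with
fundamental simplex `H₄⁵`; it has `N = 20` tiles, four of the five ideal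
vertices of `H₁₁⁵` belong to exactly one tile each, and the remaining ideal
vertex (the one of type `D̃₄`) belongs to `16` tiles. -/
theorem statement17 (P F : Set ↥(hypSet 5)) (hF : IsH45 F) (hP : IsH115 P) :
    ∃ 𝒯, hSTDecomp 5 P F 𝒯 ∧ 𝒯.ncard = 20 ∧
      ∃ w ∈ hIdealVerts 5 P, hIdealLink 5 P w cmD4t ∧ hTilesAt 5 𝒯 w = 16 ∧
        ∀ w' ∈ hIdealVerts 5 P, w' ≠ w → hTilesAt 5 𝒯 w' = 1 := by
  obtain ⟨-, hPs, hPc, hcard, -, hvol, -⟩ := hP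
  have hFvol := hvol F hF
  obtain ⟨-, hFs, hFc, hlow, -⟩ := hF
  obtain ⟨e, t, h, ht, hPfin⟩ := exists_hasDiagram hPs hPc
  obtain ⟨b, s, hb, hs, hFfin⟩ := exists_hasDiagram hFs hFc
  obtain rfl : t = 11 := eq_eleven_of_card t (h.ncard_idealVerts ht ▸ hcard)
  obtain rfl : s = 10 :=
    eq_ten_of_hVol_eq h ht hb hs hFvol (zero_le.trans_lt hlow).ne' hFfin.ne
  exact star_decomposition h (fun i j => by rw [ht, simplexGram_star, map_intCast]) hPfin hb
    fun i j => by rw [hs, simplexGram_base, map_intCast]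

end CD
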